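/- There exist universal constants Δ > 0 and C₂ > 0 such that for every quasisymmetric homeomorphism φ of ℝP¹ with cross-ratio norm ‖φ‖_cr > Δ, the minimal Lagrangian extension Φ_ML: ℍ² → ℍ² of φ has maximal dilatation K(Φ_ML) satisfying ln K(Φ_ML) ≤ C₂ · ‖φ‖_cr. -/

import Mathlib

/-!
Common framework for formalizing "Maximal surfaces in Anti-de Sitter space, width of
convex hulls and quasiconformal extensions of quasisymmetric homeomorphisms" (A. Seppi).

Anti-de Sitter space is modeled projectively: `qform` is the bilinear form of
signature (2,2) on ℝ⁴, `AdS3` is the projectivization of its negative cone,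
and spacelike surfaces are recorded through (lifts of) smooth spacelike embeddings
of ℝ² into the quadric {⟨x,x⟩ = -1} (the double cover of AdS³), together with a
future-directed unit normal field and the associated shape operator.
-/

noncomputable section

open Real Set Filter Topology

namespace AdSPaper

/-- The bilinear form of signature `(2,2)` on `ℝ⁴`. -/
def qform (x y : Fin 4 → ℝ) : ℝ :=
  x 0 * y 0 + x 1 * y 1 - x 2 * y 2 - x 3 * y 3

/-- Quotient topology on a projectivization. -/
instance (K V : Type*) [DivisionRing K] [AddCommGroup V] [Module K V] [TopologicalSpace V] :
    TopologicalSpace (Projectivization K V) := by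
  unfold Projectivization
  infer_instance

/-- Real projective 3-space. -/
abbrev RP3 := Projectivization ℝ (Fin 4 → ℝ)

/-- The real projective line. -/
abbrev RP1 := Projectivization ℝ (Fin 2 → ℝ)

/-- The point of `ℝP³` determined by a nonzero vector of `ℝ⁴`. -/
def projPt (x : Fin 4 → ℝ) (hx : x ≠ 0) : RP3 := Projectivization.mk ℝ x hx

/-- Anti-de Sitter space: the projectivization of the negative cone of `qform`.
(The sign of `qform x x` does not depend on the chosen representative.) -/
def AdS3 : Set RP3 := {P | qform P.rep P.rep < 0}

/-- The boundary at infinity of Anti-de Sitter space: the projectivization of the null cone. -/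
def bdryAdS3 : Set RP3 := {P | qform P.rep P.rep = 0}

/-- The nonzero lifts of a subset of `ℝP³`. -/
def lifts (Γ : Set RP3) : Set (Fin 4 → ℝ) :=
  {x | ∃ hx : x ≠ 0, projPt x hx ∈ Γ}

/-- The (projective) convex hull of a set `Γ ⊆ ℝP³` contained in an affine chart:
the image of the convex hull of a coherent family of lifts of `Γ`, chosen on the positive
side of a linear hyperplane avoiding all lifts of `Γ` (i.e. an affine chart containing `Γ`). -/
def projConvexHull (Γ : Set RP3) : Set RP3 :=
  {P | ∃ L : (Fin 4 → ℝ) →ₗ[ℝ] ℝ, (∀ x ∈ lifts Γ, L x ≠ 0) ∧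
      ∃ (y : Fin 4 → ℝ) (hy : y ≠ 0), projPt y hy = P ∧
        y ∈ convexHull ℝ {x | x ∈ lifts Γ ∧ 0 < L x}}

/-- The width of (the convex hull of) a set `Γ ⊆ ℝP³`: the supremum of the lengths of
timelike geodesic segments `t ↦ [cos t • a + sin t • b]` contained in the convex hull of `Γ`. -/
def width (Γ : Set RP3) : ℝ :=
  sSup {T : ℝ | 0 ≤ T ∧ T < π ∧ ∃ a b : Fin 4 → ℝ,
      qform a a = -1 ∧ qform b b = -1 ∧ qform a b = 0 ∧
      ∀ t ∈ Icc (0 : ℝ) T, ∃ h : (Real.cos t • a + Real.sin t • b) ≠ 0,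
        projPt (Real.cos t • a + Real.sin t • b) h ∈ projConvexHull Γ}

/-- Inverse hyperbolic cosine. -/
def arcosh (x : ℝ) : ℝ := Real.log (x + Real.sqrt (x ^ 2 - 1))

/-! ### The projective line, cross-ratios and quasisymmetric homeomorphisms -/

/-- Determinant of a pair of vectors of ℝ². -/
def det2 (v w : Fin 2 → ℝ) : ℝ := v 0 * w 1 - v 1 * w 0

/-- The cross-ratio of a quadruple of points of `ℝP¹`, with the convention
`cr(z₁,z₂,z₃,z₄) = (z₄−z₁)(z₃−z₂)/((z₂−z₁)(z₃−z₄))`.  (The expression below is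
invariant under rescaling of each of the four representatives.) -/
def crossRatio (z₁ z₂ z₃ z₄ : RP1) : ℝ :=
  (det2 z₄.rep z₁.rep * det2 z₃.rep z₂.rep) / (det2 z₂.rep z₁.rep * det2 z₃.rep z₄.rep)

/-- The cyclic orientation invariant of a triple of points of `ℝP¹`
(for finite points `a,b,c` it equals `(a−b)(b−c)(c−a)` and its sign is scale invariant). -/
def tripleOrient (a b c : RP1) : ℝ :=
  det2 a.rep b.rep * det2 b.rep c.rep * det2 c.rep a.rep

/-- A map of `ℝP¹` is orientation-preserving if it preserves the cyclic orientation
of triples of points. -/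
def OrientationPreserving (φ : RP1 → RP1) : Prop :=
  ∀ a b c : RP1, 0 < tripleOrient a b c → 0 < tripleOrient (φ a) (φ b) (φ c)

/-- The set of cross-ratio distortions `|ln |cr(φ(Q))||` of symmetric quadruples
(`cr(Q) = -1`) under the map `φ`. -/
def crSet (φ : RP1 → RP1) : Set ℝ :=
  {r | ∃ z₁ z₂ z₃ z₄ : RP1, crossRatio z₁ z₂ z₃ z₄ = -1 ∧
      r = |Real.log (abs (crossRatio (φ z₁) (φ z₂) (φ z₃) (φ z₄)))|}

/-- The cross-ratio norm `‖φ‖_cr` of a circle map `φ`. -/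
def crNorm (φ : RP1 → RP1) : ℝ := sSup (crSet φ)

/-- A quasisymmetric homeomorphism of `ℝP¹`: an orientation-preserving homeomorphism
with finite cross-ratio norm. -/
def Quasisymmetric (φ : RP1 ≃ₜ RP1) : Prop :=
  OrientationPreserving ⇑φ ∧ BddAbove (crSet ⇑φ)

/-- The null vector of ℝ^{2,2} corresponding to the pair of lines `([v],[w]) ∈ ℝP¹ × ℝP¹`
under the standard identification of `∂∞AdS³` with `ℝP¹ × ℝP¹` (via the rank-one
2×2 matrix `v wᵀ`, identifying ℝ^{2,2} with 2×2 matrices with minus the determinant). -/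
def toBoundary (v w : Fin 2 → ℝ) : Fin 4 → ℝ :=
  ![(v 0 * w 0 - v 1 * w 1) / 2, (v 0 * w 1 + v 1 * w 0) / 2,
    (v 0 * w 0 + v 1 * w 1) / 2, (v 0 * w 1 - v 1 * w 0) / 2]

/-- The graph `gr(φ)` of a map `φ : ℝP¹ → ℝP¹`, as a curve in `∂∞AdS³ ⊆ ℝP³`. -/
def grGraph (φ : RP1 → RP1) : Set RP3 :=
  {P | ∃ (v w : Fin 2 → ℝ) (hv : v ≠ 0) (hw : w ≠ 0) (hx : toBoundary v w ≠ 0),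
      projPt (toBoundary v w) hx = P ∧
      φ (Projectivization.mk ℝ v hv) = Projectivization.mk ℝ w hw}

/-! ### Spacelike and maximal surfaces in AdS³ -/

/-- The global timelike vector field `x ↦ (0,0,−x₄,x₃)` on the quadric, fixing the
time orientation of AdS³. -/
def timeVec (x : Fin 4 → ℝ) : Fin 4 → ℝ := ![0, 0, -(x 3), x 2]

/-- A (lifted, parametrized) smooth spacelike embedded disc in AdS³: a smooth embedding
of ℝ² into the quadric `{⟨x,x⟩ = −1} ⊆ ℝ^{2,2}` (the double cover of AdS³), with spacelike
first fundamental form, together with its future-directed unit normal field and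
the associated shape operator `B = ∇N`. -/
structure SpacelikeSurface where
  /-- the embedding of ℝ² into the quadric -/
  emb : (Fin 2 → ℝ) → (Fin 4 → ℝ)
  /-- the future-directed unit normal vector field -/
  normal : (Fin 2 → ℝ) → (Fin 4 → ℝ)
  /-- the shape operator, in the coordinates of the parametrization -/
  shape : (Fin 2 → ℝ) → ((Fin 2 → ℝ) →ₗ[ℝ] (Fin 2 → ℝ))
  smooth_emb : ContDiff ℝ (⊤ : ℕ∞) emb
  smooth_normal : ContDiff ℝ (⊤ : ℕ∞) normal
  inj : Function.Injective emb
  on_quadric : ∀ y, qform (emb y) (emb y) = -1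
  spacelike : ∀ y v, v ≠ 0 → 0 < qform (fderiv ℝ emb y v) (fderiv ℝ emb y v)
  normal_unit : ∀ y, qform (normal y) (normal y) = -1
  normal_orth_base : ∀ y, qform (normal y) (emb y) = 0
  normal_orth : ∀ y v, qform (normal y) (fderiv ℝ emb y v) = 0
  normal_future : ∀ y, qform (normal y) (timeVec (emb y)) < 0
  shape_spec : ∀ y v, fderiv ℝ normal y v = fderiv ℝ emb y (shape y v)

namespace SpacelikeSurface

variable (S : SpacelikeSurface)

/-- A spacelike surface is maximal if its shape operator is traceless. -/
def IsMaximal : Prop := ∀ y, LinearMap.trace ℝ (Fin 2 → ℝ) (S.shape y) = 0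

/-- The surface as a subset of `ℝP³` (i.e. of AdS³). -/
def proj : Set RP3 :=
  {P | ∃ (y : Fin 2 → ℝ) (h : S.emb y ≠ 0), projPt (S.emb y) h = P}

/-- The asymptotic boundary `∂∞S` of the surface: the frontier `closure S \ S`. -/
def bdryAtInfinity : Set RP3 := closure S.proj \ S.proj

/-- The surface is entire if its frontier is contained in the boundary at
infinity of AdS³. -/
def IsEntire : Prop := S.bdryAtInfinity ⊆ bdryAdS3

/-- The nonnegative principal curvature `λ` at a point: for a maximal surface the
principal curvatures are `±λ` with `λ = √(−det B)`. -/
def lambdaAt (y : Fin 2 → ℝ) : ℝ := Real.sqrt (-(LinearMap.det (S.shape y)))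

/-- The supremum `‖λ‖∞` of the principal curvatures of the surface. -/
def lambdaSup : ℝ := ⨆ y, S.lambdaAt y

/-- Nonpositive curvature: by the Gauss equation `K = −1 + λ²`, this is `λ ≤ 1`. -/
def NonpositiveCurvature : Prop := ∀ y, S.lambdaAt y ≤ 1

/-- Uniformly negative curvature: `λ ≤ 1 − ε` for some `ε > 0`. -/
def UniformlyNegativeCurvature : Prop := ∃ ε > 0, ∀ y, S.lambdaAt y ≤ 1 - ε

/-- The set of non-umbilical points of a maximal surface (where `λ ≠ 0`). -/
def nonUmbilic : Set (Fin 2 → ℝ) := {y | LinearMap.det (S.shape y) ≠ 0}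

/-- The intrinsic distance of the induced Riemannian metric on the surface. -/
def idist (y₁ y₂ : Fin 2 → ℝ) : ℝ :=
  sInf {L | ∃ c : ℝ → (Fin 2 → ℝ), ContDiff ℝ (⊤ : ℕ∞) c ∧ c 0 = y₁ ∧ c 1 = y₂ ∧
      L = ∫ t in (0:ℝ)..(1:ℝ),
        Real.sqrt (qform (deriv (fun s => S.emb (c s)) t) (deriv (fun s => S.emb (c s)) t))}

/-- `F` is the intrinsic gradient field of the function `f` on `U ⊆ S`: the vector field
which is `I`-dual to the differential of `f`. -/
def IsGradientOn (U : Set (Fin 2 → ℝ)) (f : (Fin 2 → ℝ) → ℝ)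
    (F : (Fin 2 → ℝ) → (Fin 2 → ℝ)) : Prop :=
  ∀ y ∈ U, ∀ v, qform (fderiv ℝ S.emb y (F y)) (fderiv ℝ S.emb y v) = fderiv ℝ f y v

/-- `H` is the intrinsic Hessian (as a (1,1)-tensor) of a function with gradient field `F`
on `U ⊆ S`: the tangential part of the ambient flat derivative of the ambient gradient
field (the normal part, in the ambient coordinates, lies in `span{σ(y), N(y)}`). -/
def IsHessianOn (U : Set (Fin 2 → ℝ)) (F : (Fin 2 → ℝ) → (Fin 2 → ℝ))
    (H : (Fin 2 → ℝ) → ((Fin 2 → ℝ) →ₗ[ℝ] (Fin 2 → ℝ))) : Prop :=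
  ∀ y ∈ U, ∀ v, ∃ a b : ℝ,
    fderiv ℝ (fun y' => fderiv ℝ S.emb y' (F y')) y v
      = fderiv ℝ S.emb y (H y v) + a • S.emb y + b • S.normal y

/-- The squared norm `‖grad f‖²` of a gradient field `F`, for the induced metric. -/
def gradNormSq (F : (Fin 2 → ℝ) → (Fin 2 → ℝ)) (y : Fin 2 → ℝ) : ℝ :=
  qform (fderiv ℝ S.emb y (F y)) (fderiv ℝ S.emb y (F y))

/-- `Δf` is the Laplace–Beltrami operator of the induced metric applied to `f`, on `U`:
the trace of the intrinsic Hessian. -/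
def IsLaplacianOn (U : Set (Fin 2 → ℝ)) (f Δf : (Fin 2 → ℝ) → ℝ) : Prop :=
  ∃ F H, S.IsGradientOn U f F ∧ S.IsHessianOn U F H ∧
    ∀ y ∈ U, Δf y = LinearMap.trace ℝ (Fin 2 → ℝ) (H y)

/-- `c` parametrizes an intrinsic geodesic of the surface: the ambient acceleration
is orthogonal to the surface, i.e. lies in `span{σ(c t), N(c t)}`. -/
def IsIntrinsicGeodesic (c : ℝ → (Fin 2 → ℝ)) : Prop :=
  ∀ t, ∃ a b : ℝ,
    deriv (deriv (fun s => S.emb (c s))) t = a • S.emb (c t) + b • S.normal (c t)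

/-- `E` is a system of normal coordinates for the surface centered at `y₀` (i.e. the
exponential map of the induced metric at that point, read in an orthonormal frame). -/
def IsNormalCoordsAt (y₀ : Fin 2 → ℝ) (E : (Fin 2 → ℝ) → (Fin 2 → ℝ)) : Prop :=
  E 0 = y₀ ∧ (∀ v, S.IsIntrinsicGeodesic (fun t => E (t • v))) ∧
  ∀ v w : Fin 2 → ℝ,
    qform (deriv (fun t : ℝ => S.emb (E (t • v))) 0) (deriv (fun t : ℝ => S.emb (E (t • w))) 0)
      = v 0 * w 0 + v 1 * w 1

end SpacelikeSurface

/-- The normal flow at time `ρ`: the parametrization of the surface `S_ρ` at constant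
timelike distance `ρ` from `S`. -/
def parallelEmb (S : SpacelikeSurface) (ρ : ℝ) : (Fin 2 → ℝ) → (Fin 4 → ℝ) :=
  fun y => Real.cos ρ • S.emb y + Real.sin ρ • S.normal y

/-- The pull-back to `S` of the first fundamental form of the parallel surface `S_ρ`. -/
def Irho (S : SpacelikeSurface) (ρ : ℝ) (y : Fin 2 → ℝ) (v w : Fin 2 → ℝ) : ℝ :=
  qform (fderiv ℝ (parallelEmb S ρ) y v) (fderiv ℝ (parallelEmb S ρ) y w)

/-- The second fundamental form of the parallel surface `S_ρ`, via `II_ρ = ½ dI_ρ/dρ`. -/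
def IIrho (S : SpacelikeSurface) (ρ : ℝ) (y : Fin 2 → ℝ) (v w : Fin 2 → ℝ) : ℝ :=
  (1 / 2) * deriv (fun ρ' => Irho S ρ' y v w) ρ

/-! ### Euclidean balls and `C⁰`/`C²` norms on ℝ² -/

/-- The Euclidean ball of radius `r` centered at the origin of ℝ². -/
def eball (r : ℝ) : Set (Fin 2 → ℝ) := {z | Real.sqrt ((z 0) ^ 2 + (z 1) ^ 2) < r}

/-- The `C⁰` norm of a function on the Euclidean ball of radius `r`. -/
def C0norm (u : (Fin 2 → ℝ) → ℝ) (r : ℝ) : ℝ :=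
  sSup {a | ∃ z ∈ eball r, a = |u z|}

/-- The `C²` norm of a function on the Euclidean ball of radius `r`. -/
def C2norm (u : (Fin 2 → ℝ) → ℝ) (r : ℝ) : ℝ :=
  sSup {a | ∃ z ∈ eball r, a = |u z| + ‖fderiv ℝ u z‖ + ‖fderiv ℝ (fderiv ℝ u) z‖}

end AdSPaper
/-! ### The hyperbolic plane, quasiconformal dilatation and minimal Lagrangian maps -/

namespace AdSPaper

/-- The upper half-plane model of ℍ², as a subset of ℂ. -/
def Hset : Set ℂ := {z | 0 < z.im}

/-- The real inner product on ℂ ≅ ℝ². -/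
def rinner (v w : ℂ) : ℝ := v.re * w.re + v.im * w.im

/-- The Christoffel bilinear form of the hyperbolic metric `(dx² + dy²)/y²` on the
upper half-plane: `Γ_z(v,w) = (i / Im z) · (v·w)` (complex multiplication). -/
def Gamma (z v w : ℂ) : ℂ := (Complex.I / (z.im : ℂ)) * (v * w)

/-- The quasiconformal dilatation of a map `Φ` at the point `z`: the ratio between the
major and the minor axis of the image of a unit circle under the differential of `Φ`. -/
def dilatationAt (Φ : ℂ → ℂ) (z : ℂ) : ℝ :=
  (⨆ v : {v : ℂ // ‖v‖ = 1}, ‖fderiv ℝ Φ z (v : ℂ)‖) /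
    (⨅ v : {v : ℂ // ‖v‖ = 1}, ‖fderiv ℝ Φ z (v : ℂ)‖)

/-- The maximal dilatation `K(Φ)` of a map of the upper half-plane. -/
def maxDilatation (Φ : ℂ → ℂ) : ℝ := ⨆ z : Hset, dilatationAt Φ (z : ℂ)

/-- `Φ` is a minimal Lagrangian diffeomorphism of ℍ² (upper half-plane model): a smooth
diffeomorphism of ℍ² which is area-preserving and whose graph is minimal in ℍ² × ℍ²;
equivalently (Bonsante–Schlenker, Prop. 1.2.6 of Toulisse), `Φ*g = g(b·,b·)` for a
self-adjoint, `det = 1`, Codazzi bundle morphism `b`. -/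
def IsMinimalLagrangian (Φ : ℂ → ℂ) : Prop :=
  ContDiffOn ℝ (⊤ : ℕ∞) Φ Hset ∧ Set.BijOn Φ Hset Hset ∧
  (∃ Ψ : ℂ → ℂ, ContDiffOn ℝ (⊤ : ℕ∞) Ψ Hset ∧ Set.InvOn Ψ Φ Hset Hset) ∧
  ∃ b : ℂ → (ℂ →L[ℝ] ℂ),
    (∀ z ∈ Hset, ∀ v w : ℂ, rinner (b z v) w = rinner v (b z w)) ∧
    (∀ z ∈ Hset, LinearMap.det ((b z : ℂ →L[ℝ] ℂ) : ℂ →ₗ[ℝ] ℂ) = 1) ∧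
    (∀ z ∈ Hset, ∀ v w : ℂ,
      rinner (fderiv ℝ Φ z v) (fderiv ℝ Φ z w) / (Φ z).im ^ 2
        = rinner (b z v) (b z w) / z.im ^ 2) ∧
    (∀ z ∈ Hset, ∀ v w : ℂ,
      fderiv ℝ (fun u => b u w) z v + Gamma z v (b z w) - b z (Gamma z v w)
        = fderiv ℝ (fun u => b u v) z w + Gamma z w (b z v) - b z (Gamma z w v))

/-- The point of the boundary `∂ℍ² = ℝ ∪ {∞}` of the upper half-plane (inside the
Riemann sphere `ℂ ∪ {∞}`) corresponding to a point of `ℝP¹`. -/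
def rp1ToSphere (ξ : RP1) : OnePoint ℂ :=
  if ξ.rep 1 = 0 then OnePoint.infty
  else OnePoint.some ((ξ.rep 0 / ξ.rep 1 : ℝ) : ℂ)

/-- `Φ : ℍ² → ℍ²` extends the circle map `φ : ℝP¹ → ℝP¹`: at every boundary point `ξ`,
`Φ(z) → φ(ξ)` as `z → ξ` from inside the upper half-plane (in the Riemann sphere). -/
def ExtendsToBoundary (Φ : ℂ → ℂ) (φ : RP1 → RP1) : Prop :=
  ∀ ξ : RP1, Filter.Tendsto (fun z => OnePoint.some (Φ z))
      ((Filter.comap OnePoint.some (nhds (rp1ToSphere ξ))) ⊓ Filter.principal Hset)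
      (nhds (rp1ToSphere (φ ξ)))

/-- `Φ` is the (unique) minimal Lagrangian extension of the quasisymmetric
homeomorphism `φ` of `ℝP¹`. -/
def IsMinimalLagrangianExtension (Φ : ℂ → ℂ) (φ : RP1 → RP1) : Prop :=
  IsMinimalLagrangian Φ ∧ ExtendsToBoundary Φ φ

end AdSPaper

namespace AdSPaper

/-! ### Derivatives along vector fields of the plane -/

section dirDeriv

variable {E : Type*} [NormedAddCommGroup E] [NormedSpace ℝ E]

/-- The derivative of `f` along the vector field `V`. -/
def dirDeriv (V : ℂ → ℂ) (f : ℂ → E) (z : ℂ) : E := fderiv ℝ f z (V z)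

variable {N : Set ℂ} {V W : ℂ → ℂ} {z : ℂ}

theorem dirDeriv_smooth (hN : IsOpen N) (hV : ContDiffOn ℝ (⊤ : ℕ∞) V N) {f : ℂ → E}
    (hf : ContDiffOn ℝ (⊤ : ℕ∞) f N) : ContDiffOn ℝ (⊤ : ℕ∞) (dirDeriv V f) N :=
  (hf.fderiv_of_isOpen hN (by simp)).clm_apply hV

theorem differentiableAt_of_smooth (hN : IsOpen N) {f : ℂ → E}
    (hf : ContDiffOn ℝ (⊤ : ℕ∞) f N) (hz : z ∈ N) : DifferentiableAt ℝ f z :=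
  (hf.contDiffAt (hN.mem_nhds hz)).differentiableAt (by simp)

theorem dirDeriv_congr (hN : IsOpen N) (hz : z ∈ N) {f g : ℂ → E} (h : EqOn f g N) :
    dirDeriv V f z = dirDeriv V g z := by
  have : f =ᶠ[𝓝 z] g := h.eventuallyEq_of_mem (hN.mem_nhds hz)
  simp only [dirDeriv, this.fderiv_eq]

theorem dirDeriv_const (c : E) : dirDeriv V (fun _ => c) z = 0 := by
  simp [dirDeriv]

theorem dirDeriv_add {f g : ℂ → E} (hf : DifferentiableAt ℝ f z) (hg : DifferentiableAt ℝ g z) :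
    dirDeriv V (fun z => f z + g z) z = dirDeriv V f z + dirDeriv V g z := by
  simp [dirDeriv, fderiv_fun_add hf hg]

theorem dirDeriv_sub {f g : ℂ → E} (hf : DifferentiableAt ℝ f z) (hg : DifferentiableAt ℝ g z) :
    dirDeriv V (fun z => f z - g z) z = dirDeriv V f z - dirDeriv V g z := by
  simp [dirDeriv, fderiv_fun_sub hf hg]

theorem dirDeriv_mul {A : Type*} [NormedCommRing A] [NormedAlgebra ℝ A] {f g : ℂ → A}
    (hf : DifferentiableAt ℝ f z) (hg : DifferentiableAt ℝ g z) :
    dirDeriv V (fun z => f z * g z) z = dirDeriv V f z * g z + f z * dirDeriv V g z := by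
  simp [dirDeriv, fderiv_fun_mul hf hg, mul_comm, add_comm]

theorem dirDeriv_comp {f : ℂ → ℝ} {h : ℝ → E} {h' : E} (hh : HasDerivAt h h' (f z))
    (hf : DifferentiableAt ℝ f z) :
    dirDeriv V (fun z => h (f z)) z = dirDeriv V f z • h' := by
  have := (hh.hasFDerivAt.comp z hf.hasFDerivAt).fderiv
  simp only [dirDeriv]
  rw [show (fun z => h (f z)) = h ∘ f from rfl, this]
  simp

theorem dirDeriv_ofReal {f : ℂ → ℝ} (hf : DifferentiableAt ℝ f z) :
    dirDeriv V (fun z => (f z : ℂ)) z = ((dirDeriv V f z : ℝ) : ℂ) := by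
  have := (Complex.ofRealCLM.hasFDerivAt.comp z hf.hasFDerivAt).fderiv
  simp only [dirDeriv]
  rw [show (fun z => (f z : ℂ)) = Complex.ofRealCLM ∘ f from rfl, this]
  simp

theorem dirDeriv_im : dirDeriv V (fun z => z.im) z = (V z).im := by
  simp only [dirDeriv]
  rw [show (fun z : ℂ => z.im) = Complex.imCLM from rfl, ContinuousLinearMap.fderiv]
  simp

theorem dirDeriv_re : dirDeriv V (fun z => z.re) z = (V z).re := by
  simp only [dirDeriv]
  rw [show (fun z : ℂ => z.re) = Complex.reCLM from rfl, ContinuousLinearMap.fderiv]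
  simp

theorem dirDeriv_dirDeriv (hN : IsOpen N) (hz : z ∈ N) (hW : ContDiffOn ℝ (⊤ : ℕ∞) W N)
    {f : ℂ → E} (hf : ContDiffOn ℝ (⊤ : ℕ∞) f N) :
    dirDeriv V (dirDeriv W f) z
      = fderiv ℝ (fderiv ℝ f) z (V z) (W z) + fderiv ℝ f z (dirDeriv V W z) := by
  have h1 : DifferentiableAt ℝ (fderiv ℝ f) z :=
    differentiableAt_of_smooth hN (hf.fderiv_of_isOpen hN (by simp)) hz
  have h2 := differentiableAt_of_smooth hN hW hz
  have := (h1.hasFDerivAt.clm_apply h2.hasFDerivAt).fderiv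
  change fderiv ℝ (fun z => fderiv ℝ f z (W z)) z (V z) = _
  rw [this]
  simp [dirDeriv, add_comm]

/-- Derivatives along two fields commute at every point where the fields commute. -/
theorem dirDeriv_comm (hN : IsOpen N) (hz : z ∈ N) (hV : ContDiffOn ℝ (⊤ : ℕ∞) V N)
    (hW : ContDiffOn ℝ (⊤ : ℕ∞) W N) (hVW : dirDeriv V W z = dirDeriv W V z)
    {f : ℂ → E} (hf : ContDiffOn ℝ (⊤ : ℕ∞) f N) :
    dirDeriv V (dirDeriv W f) z = dirDeriv W (dirDeriv V f) z := by
  have hs : IsSymmSndFDerivAt ℝ f z :=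
    (hf.contDiffAt (hN.mem_nhds hz)).isSymmSndFDerivAt (by simp; norm_cast)
  rw [dirDeriv_dirDeriv hN hz hW hf, dirDeriv_dirDeriv hN hz hV hf, hVW, hs.eq]

/-- The second derivative of a function of one variable is nonpositive at a local maximum. -/
theorem deriv_deriv_nonpos_of_isLocalMax {g : ℝ → ℝ} {x : ℝ} (h : IsLocalMax g x)
    (hc : ContinuousAt g x) : deriv (deriv g) x ≤ 0 := by
  by_contra! hpos
  have hmin := isLocalMin_of_deriv_deriv_pos hpos h.deriv_eq_zero hc
  have heq : g =ᶠ[𝓝 x] fun _ => g x := by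
    filter_upwards [h, hmin] with t h1 h2 using le_antisymm h1 h2
  have h1 : deriv g =ᶠ[𝓝 x] deriv fun _ => g x := heq.deriv
  rw [h1.deriv_eq] at hpos
  simp at hpos

theorem dirDeriv_eq_zero_of_isLocalMax {f : ℂ → ℝ} (h : IsLocalMax f z) :
    dirDeriv V f z = 0 := by
  simp [dirDeriv, h.fderiv_eq_zero]

theorem dirDeriv_dirDeriv_nonpos_of_isLocalMax (hN : IsOpen N) (hz : z ∈ N)
    (hV : ContDiffOn ℝ (⊤ : ℕ∞) V N) {f : ℂ → ℝ} (hf : ContDiffOn ℝ (⊤ : ℕ∞) f N)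
    (h : IsLocalMax f z) : dirDeriv V (dirDeriv V f) z ≤ 0 := by
  rw [dirDeriv_dirDeriv hN hz hV hf, h.fderiv_eq_zero]
  set v := V z
  have hline : ∀ t : ℝ, HasDerivAt (fun t : ℝ => z + t * v) v t := by
    intro t
    have := ((Complex.ofRealCLM.hasDerivAt (x := t)).mul_const v).const_add z
    simpa using this
  have hcont : ContinuousAt (fun t : ℝ => z + t * v) 0 := (hline 0).continuousAt
  have h0 : z + ((0 : ℝ) : ℂ) * v = z := by simp
  have hmem : ∀ᶠ t : ℝ in 𝓝 0, z + t * v ∈ N := by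
    apply hcont.eventually_mem
    rw [h0]; exact hN.mem_nhds hz
  have hd : deriv (fun t : ℝ => f (z + t * v)) =ᶠ[𝓝 0]
      fun t : ℝ => fderiv ℝ f (z + t * v) v := by
    filter_upwards [hmem] with t ht
    exact ((differentiableAt_of_smooth hN hf ht).hasFDerivAt.comp_hasDerivAt t (hline t)).deriv
  have h1 : DifferentiableAt ℝ (fderiv ℝ f) z :=
    differentiableAt_of_smooth hN (hf.fderiv_of_isOpen hN (by simp)) hz
  have hd2 : deriv (deriv (fun t : ℝ => f (z + t * v))) 0 = fderiv ℝ (fderiv ℝ f) z v v := by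
    rw [hd.deriv_eq]
    have h2 : HasFDerivAt (fderiv ℝ f) (fderiv ℝ (fderiv ℝ f) z) (z + ((0 : ℝ) : ℂ) * v) := by
      rw [h0]; exact h1.hasFDerivAt
    have h3 : HasDerivAt (fun t : ℝ => fderiv ℝ f (z + t * v)) (fderiv ℝ (fderiv ℝ f) z v) 0 :=
      h2.comp_hasDerivAt (0 : ℝ) (hline 0)
    have h4 := (ContinuousLinearMap.apply ℝ ℝ v).hasFDerivAt.comp_hasDerivAt (0 : ℝ) h3
    exact h4.deriv
  have hmax : IsLocalMax (fun t : ℝ => f (z + t * v)) 0 := by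
    have : IsLocalMax f (z + ((0 : ℝ) : ℂ) * v) := by rw [h0]; exact h
    exact hcont.eventually this
  have hfc : ContinuousAt (fun t : ℝ => f (z + t * v)) 0 := by
    have : ContinuousAt f (z + ((0 : ℝ) : ℂ) * v) := by
      rw [h0]; exact (differentiableAt_of_smooth hN hf hz).continuousAt
    exact ContinuousAt.comp (f := fun t : ℝ => z + t * v) this hcont
  have := deriv_deriv_nonpos_of_isLocalMax hmax hfc
  rw [hd2] at this
  simpa using this

end dirDeriv

/-! ### The conformal frame attached to a Codazzi tensor -/

/-- First field of the conformal frame attached to `(u, ϑ)`. -/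
def frameOne (u ϑ : ℂ → ℝ) (z : ℂ) : ℂ :=
  ((2 * cosh (u z / 2) * z.im * sin (ϑ z) : ℝ) : ℂ)
    - ((2 * cosh (u z / 2) * z.im * cos (ϑ z) : ℝ) : ℂ) * Complex.I

/-- Second field of the conformal frame attached to `(u, ϑ)`. -/
def frameTwo (u ϑ : ℂ → ℝ) (z : ℂ) : ℂ :=
  ((2 * sinh (u z / 2) * z.im * cos (ϑ z) : ℝ) : ℂ)
    + ((2 * sinh (u z / 2) * z.im * sin (ϑ z) : ℝ) : ℂ) * Complex.I

/-- The differential relations between `u` and `ϑ` expressing that the operator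
`v ↦ coth u · v + (e^{2iϑ} / sinh u) · conj v` is Codazzi on the upper half-plane. -/
structure IsCodazziFrame (N : Set ℂ) (u ϑ : ℂ → ℝ) : Prop where
  isOpen : IsOpen N
  smooth_u : ContDiffOn ℝ (⊤ : ℕ∞) u N
  smooth_ϑ : ContDiffOn ℝ (⊤ : ℕ∞) ϑ N
  im_pos : ∀ z ∈ N, 0 < z.im
  one : ∀ z ∈ N, dirDeriv (frameOne u ϑ) ϑ z
    = -(dirDeriv (frameTwo u ϑ) u z / 2) - 2 * cosh (u z / 2) * sin (ϑ z)
  two : ∀ z ∈ N, dirDeriv (frameTwo u ϑ) ϑ z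
    = dirDeriv (frameOne u ϑ) u z / 2 - 2 * sinh (u z / 2) * cos (ϑ z)

namespace IsCodazziFrame

variable {N : Set ℂ} {u ϑ : ℂ → ℝ} {z : ℂ}

theorem smooth_one (h : IsCodazziFrame N u ϑ) : ContDiffOn ℝ (⊤ : ℕ∞) (frameOne u ϑ) N := by
  have h1 := h.smooth_u
  have h2 := h.smooth_ϑ
  have h3 : ContDiffOn ℝ (⊤ : ℕ∞) (fun z : ℂ => z.im) N := Complex.imCLM.contDiff.contDiffOn
  have h4 : ContDiffOn ℝ (⊤ : ℕ∞) (fun z : ℂ => cosh (u z / 2)) N :=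
    Real.contDiff_cosh.comp_contDiffOn (h1.div_const 2)
  have h5 : ContDiffOn ℝ (⊤ : ℕ∞) (fun z : ℂ => sin (ϑ z)) N :=
    Real.contDiff_sin.comp_contDiffOn h2
  have h6 : ContDiffOn ℝ (⊤ : ℕ∞) (fun z : ℂ => cos (ϑ z)) N :=
    Real.contDiff_cos.comp_contDiffOn h2
  exact (Complex.ofRealCLM.contDiff.comp_contDiffOn
      (((contDiffOn_const (c := (2 : ℝ))).mul h4 |>.mul h3).mul h5)).sub
    ((Complex.ofRealCLM.contDiff.comp_contDiffOn
      (((contDiffOn_const (c := (2 : ℝ))).mul h4 |>.mul h3).mul h6)).mul contDiffOn_const)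

theorem smooth_two (h : IsCodazziFrame N u ϑ) : ContDiffOn ℝ (⊤ : ℕ∞) (frameTwo u ϑ) N := by
  have h1 := h.smooth_u
  have h2 := h.smooth_ϑ
  have h3 : ContDiffOn ℝ (⊤ : ℕ∞) (fun z : ℂ => z.im) N := Complex.imCLM.contDiff.contDiffOn
  have h4 : ContDiffOn ℝ (⊤ : ℕ∞) (fun z : ℂ => sinh (u z / 2)) N :=
    Real.contDiff_sinh.comp_contDiffOn (h1.div_const 2)
  have h5 : ContDiffOn ℝ (⊤ : ℕ∞) (fun z : ℂ => sin (ϑ z)) N :=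
    Real.contDiff_sin.comp_contDiffOn h2
  have h6 : ContDiffOn ℝ (⊤ : ℕ∞) (fun z : ℂ => cos (ϑ z)) N :=
    Real.contDiff_cos.comp_contDiffOn h2
  exact (Complex.ofRealCLM.contDiff.comp_contDiffOn
      (((contDiffOn_const (c := (2 : ℝ))).mul h4 |>.mul h3).mul h6)).add
    ((Complex.ofRealCLM.contDiff.comp_contDiffOn
      (((contDiffOn_const (c := (2 : ℝ))).mul h4 |>.mul h3).mul h5)).mul contDiffOn_const)

theorem diff_u (h : IsCodazziFrame N u ϑ) (hz : z ∈ N) : DifferentiableAt ℝ u z :=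
  differentiableAt_of_smooth h.isOpen h.smooth_u hz

theorem diff_ϑ (h : IsCodazziFrame N u ϑ) (hz : z ∈ N) : DifferentiableAt ℝ ϑ z :=
  differentiableAt_of_smooth h.isOpen h.smooth_ϑ hz

theorem frameOne_im : (frameOne u ϑ z).im = -(2 * cosh (u z / 2) * z.im * cos (ϑ z)) := by
  simp [frameOne, -Complex.ofReal_mul, -Complex.ofReal_cosh, -Complex.ofReal_cos,
    -Complex.ofReal_sin]

theorem frameOne_re : (frameOne u ϑ z).re = 2 * cosh (u z / 2) * z.im * sin (ϑ z) := by
  simp [frameOne, -Complex.ofReal_mul, -Complex.ofReal_cosh, -Complex.ofReal_cos,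
    -Complex.ofReal_sin]

theorem frameTwo_im : (frameTwo u ϑ z).im = 2 * sinh (u z / 2) * z.im * sin (ϑ z) := by
  simp [frameTwo, -Complex.ofReal_mul, -Complex.ofReal_sinh, -Complex.ofReal_cos,
    -Complex.ofReal_sin]

theorem frameTwo_re : (frameTwo u ϑ z).re = 2 * sinh (u z / 2) * z.im * cos (ϑ z) := by
  simp [frameTwo, -Complex.ofReal_mul, -Complex.ofReal_sinh, -Complex.ofReal_cos,
    -Complex.ofReal_sin]

section components

variable {V : ℂ → ℂ}

theorem dirDeriv_cosh_half {c : ℝ} (hu : DifferentiableAt ℝ u z) :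
    dirDeriv V (fun z => c * cosh (u z / 2)) z = c / 2 * sinh (u z / 2) * dirDeriv V u z := by
  have h : HasDerivAt (fun t => c * cosh (t / 2)) (c * (sinh (u z / 2) * (1 / 2))) (u z) :=
    (((hasDerivAt_id (u z)).div_const 2).cosh).const_mul c
  rw [dirDeriv_comp h hu, smul_eq_mul]; ring

theorem dirDeriv_sinh_half {c : ℝ} (hu : DifferentiableAt ℝ u z) :
    dirDeriv V (fun z => c * sinh (u z / 2)) z = c / 2 * cosh (u z / 2) * dirDeriv V u z := by
  have h : HasDerivAt (fun t => c * sinh (t / 2)) (c * (cosh (u z / 2) * (1 / 2))) (u z) :=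
    (((hasDerivAt_id (u z)).div_const 2).sinh).const_mul c
  rw [dirDeriv_comp h hu, smul_eq_mul]; ring

theorem dirDeriv_cos (hϑ : DifferentiableAt ℝ ϑ z) :
    dirDeriv V (fun z => cos (ϑ z)) z = -sin (ϑ z) * dirDeriv V ϑ z := by
  rw [dirDeriv_comp (Real.hasDerivAt_cos (ϑ z)) hϑ, smul_eq_mul]; ring

theorem dirDeriv_sin (hϑ : DifferentiableAt ℝ ϑ z) :
    dirDeriv V (fun z => sin (ϑ z)) z = cos (ϑ z) * dirDeriv V ϑ z := by
  rw [dirDeriv_comp (Real.hasDerivAt_sin (ϑ z)) hϑ, smul_eq_mul]; ring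

theorem differentiableAt_im : DifferentiableAt ℝ (fun z : ℂ => z.im) z :=
  Complex.imCLM.differentiableAt

theorem differentiableAt_re : DifferentiableAt ℝ (fun z : ℂ => z.re) z :=
  Complex.reCLM.differentiableAt

theorem dirDeriv_mul_mul {f g k : ℂ → ℝ} (hf : DifferentiableAt ℝ f z)
    (hg : DifferentiableAt ℝ g z) (hk : DifferentiableAt ℝ k z) :
    dirDeriv V (fun z => f z * g z * k z) z
      = dirDeriv V f z * g z * k z + f z * dirDeriv V g z * k z + f z * g z * dirDeriv V k z := by
  rw [dirDeriv_mul (hf.fun_mul hg) hk, dirDeriv_mul hf hg]; ring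

theorem dirDeriv_complex {f g : ℂ → ℝ} (hf : DifferentiableAt ℝ f z)
    (hg : DifferentiableAt ℝ g z) :
    dirDeriv V (fun z => (f z : ℂ) + (g z : ℂ) * Complex.I) z
      = ((dirDeriv V f z : ℝ) : ℂ) + ((dirDeriv V g z : ℝ) : ℂ) * Complex.I := by
  have hf' : DifferentiableAt ℝ (fun z => (f z : ℂ)) z :=
    Complex.ofRealCLM.differentiableAt.comp z hf
  have hg' : DifferentiableAt ℝ (fun z => (g z : ℂ)) z :=
    Complex.ofRealCLM.differentiableAt.comp z hg
  rw [dirDeriv_add hf' (hg'.mul_const _), dirDeriv_mul hg' (differentiableAt_const _),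
    dirDeriv_const, dirDeriv_ofReal hf, dirDeriv_ofReal hg]
  simp

theorem dirDeriv_frameOne (hu : DifferentiableAt ℝ u z) (hϑ : DifferentiableAt ℝ ϑ z) :
    dirDeriv V (frameOne u ϑ) z =
      ((sinh (u z / 2) * dirDeriv V u z * z.im * sin (ϑ z) + 2 * cosh (u z / 2) * (V z).im
        * sin (ϑ z) + 2 * cosh (u z / 2) * z.im * (cos (ϑ z) * dirDeriv V ϑ z) : ℝ) : ℂ)
      + ((-(sinh (u z / 2) * dirDeriv V u z * z.im * cos (ϑ z) + 2 * cosh (u z / 2) * (V z).im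
        * cos (ϑ z) - 2 * cosh (u z / 2) * z.im * (sin (ϑ z) * dirDeriv V ϑ z)) : ℝ) : ℂ)
        * Complex.I := by
  have h1 : DifferentiableAt ℝ (fun z => 2 * cosh (u z / 2)) z := by fun_prop
  have h2 : DifferentiableAt ℝ (fun z => -2 * cosh (u z / 2)) z := by fun_prop
  have h3 : DifferentiableAt ℝ (fun z => sin (ϑ z)) z := by fun_prop
  have h4 : DifferentiableAt ℝ (fun z => cos (ϑ z)) z := by fun_prop
  have h5 := differentiableAt_im (z := z)
  have e : frameOne u ϑ = fun z => ((2 * cosh (u z / 2) * z.im * sin (ϑ z) : ℝ) : ℂ)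
      + ((-2 * cosh (u z / 2) * z.im * cos (ϑ z) : ℝ) : ℂ) * Complex.I := by
    funext z; simp only [frameOne]; push_cast; ring
  rw [e, dirDeriv_complex ((h1.fun_mul h5).fun_mul h3) ((h2.fun_mul h5).fun_mul h4),
    dirDeriv_mul_mul h1 h5 h3, dirDeriv_mul_mul h2 h5 h4, dirDeriv_cosh_half hu,
    dirDeriv_cosh_half hu, dirDeriv_im, dirDeriv_sin hϑ, dirDeriv_cos hϑ]
  congr 3 <;> ring

theorem dirDeriv_frameTwo (hu : DifferentiableAt ℝ u z) (hϑ : DifferentiableAt ℝ ϑ z) :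
    dirDeriv V (frameTwo u ϑ) z =
      ((cosh (u z / 2) * dirDeriv V u z * z.im * cos (ϑ z) + 2 * sinh (u z / 2) * (V z).im
        * cos (ϑ z) - 2 * sinh (u z / 2) * z.im * (sin (ϑ z) * dirDeriv V ϑ z) : ℝ) : ℂ)
      + ((cosh (u z / 2) * dirDeriv V u z * z.im * sin (ϑ z) + 2 * sinh (u z / 2) * (V z).im
        * sin (ϑ z) + 2 * sinh (u z / 2) * z.im * (cos (ϑ z) * dirDeriv V ϑ z) : ℝ) : ℂ)
        * Complex.I := by
  have h1 : DifferentiableAt ℝ (fun z => 2 * sinh (u z / 2)) z := by fun_prop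
  have h3 : DifferentiableAt ℝ (fun z => sin (ϑ z)) z := by fun_prop
  have h4 : DifferentiableAt ℝ (fun z => cos (ϑ z)) z := by fun_prop
  have h5 := differentiableAt_im (z := z)
  rw [show frameTwo u ϑ = fun z => ((2 * sinh (u z / 2) * z.im * cos (ϑ z) : ℝ) : ℂ)
      + ((2 * sinh (u z / 2) * z.im * sin (ϑ z) : ℝ) : ℂ) * Complex.I from rfl,
    dirDeriv_complex ((h1.fun_mul h5).fun_mul h4) ((h1.fun_mul h5).fun_mul h3),
    dirDeriv_mul_mul h1 h5 h3, dirDeriv_mul_mul h1 h5 h4, dirDeriv_sinh_half hu,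
    dirDeriv_im, dirDeriv_sin hϑ, dirDeriv_cos hϑ]
  congr 3 <;> ring

end components

/-- The two fields of the frame commute. -/
theorem lie_eq_zero (h : IsCodazziFrame N u ϑ) (hz : z ∈ N) :
    dirDeriv (frameOne u ϑ) (frameTwo u ϑ) z = dirDeriv (frameTwo u ϑ) (frameOne u ϑ) z := by
  rw [dirDeriv_frameOne (h.diff_u hz) (h.diff_ϑ hz), dirDeriv_frameTwo (h.diff_u hz) (h.diff_ϑ hz),
    h.one z hz, h.two z hz, frameOne_im, frameTwo_im]
  congr 3 <;> ring

theorem comm (h : IsCodazziFrame N u ϑ) (hz : z ∈ N) {f : ℂ → ℝ}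
    (hf : ContDiffOn ℝ (⊤ : ℕ∞) f N) :
    dirDeriv (frameOne u ϑ) (dirDeriv (frameTwo u ϑ) f) z
      = dirDeriv (frameTwo u ϑ) (dirDeriv (frameOne u ϑ) f) z :=
  dirDeriv_comm h.isOpen hz h.smooth_one h.smooth_two (h.lie_eq_zero hz) hf

/-- The sinh-Gordon equation satisfied by `u`. -/
theorem sinhGordon (h : IsCodazziFrame N u ϑ) (hz : z ∈ N) :
    dirDeriv (frameOne u ϑ) (dirDeriv (frameOne u ϑ) u) z
      + dirDeriv (frameTwo u ϑ) (dirDeriv (frameTwo u ϑ) u) z = 4 * sinh (u z) := by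
  have hu := h.diff_u hz
  have hϑ := h.diff_ϑ hz
  have hd : ∀ {V : ℂ → ℂ}, ContDiffOn ℝ (⊤ : ℕ∞) V N → DifferentiableAt ℝ (dirDeriv V u) z :=
    fun hV => differentiableAt_of_smooth h.isOpen (dirDeriv_smooth h.isOpen hV h.smooth_u) hz
  have h1 := hd h.smooth_one
  have h2 := hd h.smooth_two
  have key := h.comm hz h.smooth_ϑ
  have e1 : dirDeriv (frameOne u ϑ) (dirDeriv (frameTwo u ϑ) ϑ) z
      = dirDeriv (frameOne u ϑ)
        (fun z => (1 / 2) * dirDeriv (frameOne u ϑ) u z - 2 * sinh (u z / 2) * cos (ϑ z)) z :=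
    dirDeriv_congr h.isOpen hz fun z hz => by rw [h.two z hz]; ring
  have e2 : dirDeriv (frameTwo u ϑ) (dirDeriv (frameOne u ϑ) ϑ) z
      = dirDeriv (frameTwo u ϑ)
        (fun z => (-1 / 2) * dirDeriv (frameTwo u ϑ) u z - 2 * cosh (u z / 2) * sin (ϑ z)) z :=
    dirDeriv_congr h.isOpen hz fun z hz => by rw [h.one z hz]; ring
  have hs : DifferentiableAt ℝ (fun z => 2 * sinh (u z / 2)) z := by fun_prop
  have hc : DifferentiableAt ℝ (fun z => 2 * cosh (u z / 2)) z := by fun_prop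
  have h3 : DifferentiableAt ℝ (fun z => sin (ϑ z)) z := by fun_prop
  have h4 : DifferentiableAt ℝ (fun z => cos (ϑ z)) z := by fun_prop
  rw [e1, e2, dirDeriv_sub (h1.const_mul _) (hs.fun_mul h4),
    dirDeriv_sub (h2.const_mul _) (hc.fun_mul h3), dirDeriv_mul (differentiableAt_const _) h1,
    dirDeriv_mul (differentiableAt_const _) h2, dirDeriv_const, dirDeriv_const,
    dirDeriv_mul hs h4, dirDeriv_mul hc h3, dirDeriv_sinh_half hu, dirDeriv_cosh_half hu,
    dirDeriv_sin hϑ, dirDeriv_cos hϑ, h.one z hz, h.two z hz] at key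
  have hsinh : sinh (u z) = 2 * sinh (u z / 2) * cosh (u z / 2) := by
    rw [← Real.sinh_two_mul]; ring_nf
  have htrig := Real.sin_sq_add_cos_sq (ϑ z)
  rw [hsinh]
  linear_combination 2 * key + 8 * sinh (u z / 2) * cosh (u z / 2) * htrig

end IsCodazziFrame

/-- The hyperbolic cosine of the hyperbolic distance from `p` to `z`. -/
def coshDist (p z : ℂ) : ℝ := 1 + ((z.re - p.re) ^ 2 + (z.im - p.im) ^ 2) / (2 * z.im * p.im)

namespace IsCodazziFrame

variable {N : Set ℂ} {u ϑ : ℂ → ℝ} {z p : ℂ} {V : ℂ → ℂ}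

theorem smooth_coshDist (hN : ∀ z ∈ N, 0 < z.im) (hp : 0 < p.im) :
    ContDiffOn ℝ (⊤ : ℕ∞) (coshDist p) N := by
  have h1 : ContDiffOn ℝ (⊤ : ℕ∞) (fun z : ℂ => z.im) N := Complex.imCLM.contDiff.contDiffOn
  have h2 : ContDiffOn ℝ (⊤ : ℕ∞) (fun z : ℂ => z.re) N := Complex.reCLM.contDiff.contDiffOn
  refine contDiffOn_const.add (((h2.sub contDiffOn_const).pow 2 |>.add
    ((h1.sub contDiffOn_const).pow 2)).div ((contDiffOn_const.mul h1).mul contDiffOn_const) ?_)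
  intro z hz
  have := hN z hz
  positivity

theorem dirDeriv_coshDist (hz : 0 < z.im) (hp : 0 < p.im) :
    dirDeriv V (coshDist p) z = (z.re - p.re) / p.im * ((V z).re / z.im)
      + ((z.im - p.im) / p.im - (coshDist p z - 1)) * ((V z).im / z.im) := by
  have hr := differentiableAt_re (z := z)
  have hi := differentiableAt_im (z := z)
  have d1 : DifferentiableAt ℝ (fun z : ℂ => (z.re - p.re)) z := hr.sub_const _
  have d2 : DifferentiableAt ℝ (fun z : ℂ => (z.im - p.im)) z := hi.sub_const _
  have hinv : HasDerivAt (fun t : ℝ => (2 * t * p.im)⁻¹)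
      (-(2 * 1 * p.im) / (2 * z.im * p.im) ^ 2) z.im := by
    have h0 : HasDerivAt (fun t : ℝ => 2 * t * p.im) (2 * 1 * p.im) z.im :=
      ((hasDerivAt_id z.im).const_mul 2).mul_const p.im
    exact h0.fun_inv (by positivity)
  have d3 : DifferentiableAt ℝ (fun z : ℂ => (2 * z.im * p.im)⁻¹) z :=
    hinv.differentiableAt.comp z hi
  have e : coshDist p = fun z => 1 + ((z.re - p.re) * (z.re - p.re)
      + (z.im - p.im) * (z.im - p.im)) * (2 * z.im * p.im)⁻¹ := by
    funext z; simp only [coshDist]; rw [div_eq_mul_inv]; ring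
  have e1 : dirDeriv V (fun z : ℂ => (2 * z.im * p.im)⁻¹) z = _ :=
    dirDeriv_comp (h := fun t : ℝ => (2 * t * p.im)⁻¹) hinv hi
  rw [e, dirDeriv_add (differentiableAt_const _)
    (((d1.fun_mul d1).fun_add (d2.fun_mul d2)).fun_mul d3), dirDeriv_const,
    dirDeriv_mul ((d1.fun_mul d1).fun_add (d2.fun_mul d2)) d3,
    dirDeriv_add (d1.fun_mul d1) (d2.fun_mul d2), dirDeriv_mul d1 d1, dirDeriv_mul d2 d2,
    dirDeriv_sub hr (differentiableAt_const _), dirDeriv_sub hi (differentiableAt_const _),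
    dirDeriv_const, dirDeriv_re, dirDeriv_im, e1, dirDeriv_im, dirDeriv_const, smul_eq_mul]
  field_simp
  ring

theorem dirDeriv_dirDeriv_coshDist {f g : ℂ → ℝ} (hN : IsOpen N) (hN' : ∀ z ∈ N, 0 < z.im)
    (hz : z ∈ N) (hp : 0 < p.im) (hf : DifferentiableAt ℝ f z) (hg : DifferentiableAt ℝ g z)
    (hVf : ∀ z ∈ N, (V z).re = f z * z.im) (hVg : ∀ z ∈ N, (V z).im = g z * z.im) :
    dirDeriv V (dirDeriv V (coshDist p)) z =
      (V z).re / p.im * f z + (z.re - p.re) / p.im * dirDeriv V f z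
      + ((V z).im / p.im - dirDeriv V (coshDist p) z) * g z
      + ((z.im - p.im) / p.im - (coshDist p z - 1)) * dirDeriv V g z := by
  have hr := differentiableAt_re (z := z)
  have hi := differentiableAt_im (z := z)
  have hA := differentiableAt_of_smooth hN (smooth_coshDist hN' hp) hz
  have d1 : DifferentiableAt ℝ (fun z : ℂ => (z.re - p.re)) z := hr.sub_const _
  have d2 : DifferentiableAt ℝ (fun z : ℂ => (z.im - p.im)) z := hi.sub_const _
  have d3 : DifferentiableAt ℝ (fun z : ℂ => (coshDist p z - 1)) z := hA.sub_const _
  have dc : DifferentiableAt ℝ (fun _ : ℂ => p.im⁻¹) z := differentiableAt_const _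
  have e : dirDeriv V (dirDeriv V (coshDist p)) z = dirDeriv V (fun z => (z.re - p.re) * p.im⁻¹ * f z
      + ((z.im - p.im) * p.im⁻¹ - (coshDist p z - 1)) * g z) z := by
    refine dirDeriv_congr hN hz fun z hz => ?_
    have := hN' z hz
    rw [dirDeriv_coshDist this hp, hVf z hz, hVg z hz]
    field_simp
  rw [e, dirDeriv_add ((d1.fun_mul dc).fun_mul hf) (((d2.fun_mul dc).fun_sub d3).fun_mul hg),
    dirDeriv_mul_mul d1 dc hf, dirDeriv_mul ((d2.fun_mul dc).fun_sub d3) hg,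
    dirDeriv_sub (d2.fun_mul dc) d3, dirDeriv_mul d2 dc,
    dirDeriv_sub hr (differentiableAt_const _), dirDeriv_sub hi (differentiableAt_const _),
    dirDeriv_sub hA (differentiableAt_const _),
    dirDeriv_const, dirDeriv_re, dirDeriv_im, dirDeriv_const, dirDeriv_const, dirDeriv_const]
  field_simp
  ring

theorem laplacian_coshDist (h : IsCodazziFrame N u ϑ) (hz : z ∈ N) (hp : 0 < p.im) :
    dirDeriv (frameOne u ϑ) (dirDeriv (frameOne u ϑ) (coshDist p)) z
      + dirDeriv (frameTwo u ϑ) (dirDeriv (frameTwo u ϑ) (coshDist p)) z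
      = 4 * cosh (u z) * coshDist p z := by
  have hu := h.diff_u hz
  have hϑ := h.diff_ϑ hz
  have hy := h.im_pos z hz
  have h1 : DifferentiableAt ℝ (fun z => 2 * sinh (u z / 2)) z := by fun_prop
  have h2 : DifferentiableAt ℝ (fun z => 2 * cosh (u z / 2)) z := by fun_prop
  have h2' : DifferentiableAt ℝ (fun z => -2 * cosh (u z / 2)) z := by fun_prop
  have h3 : DifferentiableAt ℝ (fun z => sin (ϑ z)) z := by fun_prop
  have h4 : DifferentiableAt ℝ (fun z => cos (ϑ z)) z := by fun_prop
  rw [dirDeriv_dirDeriv_coshDist (V := frameOne u ϑ) (f := fun z => 2 * cosh (u z / 2) * sin (ϑ z))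
      (g := fun z => -2 * cosh (u z / 2) * cos (ϑ z)) h.isOpen h.im_pos hz hp (h2.fun_mul h3)
      (h2'.fun_mul h4) (fun z _ => by rw [frameOne_re]; ring)
      (fun z _ => by rw [frameOne_im]; ring),
    dirDeriv_dirDeriv_coshDist (V := frameTwo u ϑ) (f := fun z => 2 * sinh (u z / 2) * cos (ϑ z))
      (g := fun z => 2 * sinh (u z / 2) * sin (ϑ z)) h.isOpen h.im_pos hz hp (h1.fun_mul h4)
      (h1.fun_mul h3) (fun z _ => by rw [frameTwo_re]; ring)
      (fun z _ => by rw [frameTwo_im]; ring),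
    dirDeriv_mul h2 h3, dirDeriv_mul h2' h4, dirDeriv_mul h1 h3, dirDeriv_mul h1 h4,
    dirDeriv_sinh_half hu, dirDeriv_cosh_half hu, dirDeriv_cosh_half hu,
    dirDeriv_sin hϑ, dirDeriv_cos hϑ, dirDeriv_sin hϑ, dirDeriv_cos hϑ,
    dirDeriv_coshDist hy hp, dirDeriv_coshDist hy hp,
    frameOne_re, frameOne_im, frameTwo_re, frameTwo_im, h.one z hz, h.two z hz]
  have hcosh : cosh (u z) = cosh (u z / 2) ^ 2 + sinh (u z / 2) ^ 2 := by
    rw [← Real.cosh_two_mul]; ring_nf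
  have htrig : cos (ϑ z) ^ 2 = 1 - sin (ϑ z) ^ 2 := by
    linarith [Real.sin_sq_add_cos_sq (ϑ z)]
  rw [hcosh]
  simp only [coshDist]
  field_simp
  ring_nf
  simp only [htrig]
  ring

theorem gradSq_coshDist (h : IsCodazziFrame N u ϑ) (hz : z ∈ N) (hp : 0 < p.im) :
    dirDeriv (frameOne u ϑ) (coshDist p) z ^ 2 + dirDeriv (frameTwo u ϑ) (coshDist p) z ^ 2
      ≤ (2 * cosh (u z) + 2) * (coshDist p z ^ 2 - 1) := by
  have hy := h.im_pos z hz
  have hcosh : cosh (u z) = cosh (u z / 2) ^ 2 + sinh (u z / 2) ^ 2 := by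
    rw [← Real.cosh_two_mul]; ring_nf
  have hcs := Real.cosh_sq (u z / 2)
  rw [dirDeriv_coshDist hy hp, dirDeriv_coshDist hy hp, frameOne_re, frameOne_im, frameTwo_re,
    frameTwo_im]
  set P := (z.re - p.re) / p.im
  set Q := (z.im - p.im) / p.im - (coshDist p z - 1)
  have hPQ : P ^ 2 + Q ^ 2 = coshDist p z ^ 2 - 1 := by
    simp only [P, Q, coshDist]
    field_simp
    ring
  rw [← hPQ, hcosh]
  have e1 : ∀ a b : ℝ, a * z.im * b / z.im = a * b := fun a b => by field_simp
  have e2 : ∀ a b : ℝ, -(a * z.im * b) / z.im = -(a * b) := fun a b => by field_simp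
  rw [e1, e2, e1, e1]
  have htrig := Real.sin_sq_add_cos_sq (ϑ z)
  set S := sinh (u z / 2)
  set C := cosh (u z / 2)
  set a := sin (ϑ z)
  set b := cos (ϑ z)
  have e3 : (P ^ 2 + Q ^ 2) = (P * a - Q * b) ^ 2 + (P * b + Q * a) ^ 2 := by
    linear_combination (-P ^ 2 - Q ^ 2) * htrig
  rw [e3, hcs]
  nlinarith [sq_nonneg (P * b + Q * a), hcs]

end IsCodazziFrame

section second

variable {N : Set ℂ} {V : ℂ → ℂ} {z : ℂ}

theorem dirDeriv_dirDeriv_mul (hN : IsOpen N) (hz : z ∈ N) (hV : ContDiffOn ℝ (⊤ : ℕ∞) V N)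
    {f g : ℂ → ℝ} (hf : ContDiffOn ℝ (⊤ : ℕ∞) f N) (hg : ContDiffOn ℝ (⊤ : ℕ∞) g N) :
    dirDeriv V (dirDeriv V (fun z => f z * g z)) z = dirDeriv V (dirDeriv V f) z * g z
      + 2 * dirDeriv V f z * dirDeriv V g z + f z * dirDeriv V (dirDeriv V g) z := by
  have d : ∀ {k : ℂ → ℝ} {z : ℂ}, ContDiffOn ℝ (⊤ : ℕ∞) k N → z ∈ N → DifferentiableAt ℝ k z :=
    fun hk hz => differentiableAt_of_smooth hN hk hz
  have e : dirDeriv V (dirDeriv V (fun z => f z * g z)) z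
      = dirDeriv V (fun z => dirDeriv V f z * g z + f z * dirDeriv V g z) z :=
    dirDeriv_congr hN hz fun z hz => dirDeriv_mul (d hf hz) (d hg hz)
  have hf' := d (dirDeriv_smooth hN hV hf) hz
  have hg' := d (dirDeriv_smooth hN hV hg) hz
  rw [e, dirDeriv_add (hf'.fun_mul (d hg hz)) ((d hf hz).fun_mul hg'), dirDeriv_mul hf' (d hg hz),
    dirDeriv_mul (d hf hz) hg']
  ring

theorem dirDeriv_dirDeriv_add (hN : IsOpen N) (hz : z ∈ N) (hV : ContDiffOn ℝ (⊤ : ℕ∞) V N)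
    {f g : ℂ → ℝ} (hf : ContDiffOn ℝ (⊤ : ℕ∞) f N) (hg : ContDiffOn ℝ (⊤ : ℕ∞) g N) :
    dirDeriv V (dirDeriv V (fun z => f z + g z)) z = dirDeriv V (dirDeriv V f) z
      + dirDeriv V (dirDeriv V g) z := by
  have d : ∀ {k : ℂ → ℝ} {z : ℂ}, ContDiffOn ℝ (⊤ : ℕ∞) k N → z ∈ N → DifferentiableAt ℝ k z :=
    fun hk hz => differentiableAt_of_smooth hN hk hz
  have e : dirDeriv V (dirDeriv V (fun z => f z + g z)) z
      = dirDeriv V (fun z => dirDeriv V f z + dirDeriv V g z) z :=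
    dirDeriv_congr hN hz fun z hz => dirDeriv_add (d hf hz) (d hg hz)
  rw [e, dirDeriv_add (d (dirDeriv_smooth hN hV hf) hz) (d (dirDeriv_smooth hN hV hg) hz)]

theorem dirDeriv_dirDeriv_comp (hN : IsOpen N) (hz : z ∈ N) (hV : ContDiffOn ℝ (⊤ : ℕ∞) V N)
    {f : ℂ → ℝ} (hf : ContDiffOn ℝ (⊤ : ℕ∞) f N) {h h' : ℝ → ℝ} {h'' : ℝ}
    (hh : ∀ t, HasDerivAt h (h' t) t) (hh' : HasDerivAt h' h'' (f z)) :
    dirDeriv V (dirDeriv V (fun z => h (f z))) z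
      = h'' * dirDeriv V f z ^ 2 + h' (f z) * dirDeriv V (dirDeriv V f) z := by
  have d : ∀ {k : ℂ → ℝ} {z : ℂ}, ContDiffOn ℝ (⊤ : ℕ∞) k N → z ∈ N → DifferentiableAt ℝ k z :=
    fun hk hz => differentiableAt_of_smooth hN hk hz
  have e : dirDeriv V (dirDeriv V (fun z => h (f z))) z
      = dirDeriv V (fun z => dirDeriv V f z * h' (f z)) z :=
    dirDeriv_congr hN hz fun z hz => by rw [dirDeriv_comp (hh _) (d hf hz), smul_eq_mul]
  have hf' := d (dirDeriv_smooth hN hV hf) hz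
  have hh'' : DifferentiableAt ℝ (fun z => h' (f z)) z := hh'.differentiableAt.comp z (d hf hz)
  rw [e, dirDeriv_mul hf' hh'', dirDeriv_comp hh' (d hf hz), smul_eq_mul]
  ring

end second

/-- The pointwise inequality obtained at an interior maximum of `η² |∇u|² / W(u)`, where
`W(u) = sinh² u · e^{3u}` and `η = 2 - A`. -/
theorem gradient_algebra {S C T A u₁ u₂ u₁₁ u₁₂ u₂₂ A₁ A₂ J : ℝ} (hS : 0 < S)
    (hT : T = C + S) (hCS : C ^ 2 = S ^ 2 + 1) (hC : 1 ≤ C)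
    (hA1 : 1 ≤ A) (hA2 : A < 2) (hG : 0 < u₁ ^ 2 + u₂ ^ 2)
    (hJ : J * (S ^ 2 * T ^ 3) = (2 - A) ^ 2 * (u₁ ^ 2 + u₂ ^ 2))
    (hlap : u₁₁ + u₂₂ = 4 * S)
    (h₁ : -(2 * (2 - A) * A₁) * (u₁ ^ 2 + u₂ ^ 2) + (2 - A) ^ 2 * (2 * (u₁ * u₁₁ + u₂ * u₁₂))
      = J * ((2 * S * C + 3 * S ^ 2) * T ^ 3) * u₁)
    (h₂ : -(2 * (2 - A) * A₂) * (u₁ ^ 2 + u₂ ^ 2) + (2 - A) ^ 2 * (2 * (u₁ * u₁₂ + u₂ * u₂₂))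
      = J * ((2 * S * C + 3 * S ^ 2) * T ^ 3) * u₂)
    (hsec : (2 * (A₁ ^ 2 + A₂ ^ 2) - 2 * (2 - A) * (4 * C * A)) * (u₁ ^ 2 + u₂ ^ 2)
      - 4 * (2 - A) * (A₁ * (2 * (u₁ * u₁₁ + u₂ * u₁₂)) + A₂ * (2 * (u₁ * u₁₂ + u₂ * u₂₂)))
      + (2 - A) ^ 2 * (2 * (u₁₁ ^ 2 + 2 * u₁₂ ^ 2 + u₂₂ ^ 2) + 8 * C * (u₁ ^ 2 + u₂ ^ 2))
      ≤ J * ((2 * C ^ 2 + 11 * S ^ 2 + 12 * S * C) * T ^ 3 * (u₁ ^ 2 + u₂ ^ 2)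
        + (2 * S * C + 3 * S ^ 2) * T ^ 3 * (4 * S)))
    (hgrad : A₁ ^ 2 + A₂ ^ 2 ≤ (2 * C + 2) * (A ^ 2 - 1)) :
    J ≤ 54 := by
  have hη : 0 < 2 - A := by linarith
  have hT1 : 1 ≤ T := by linarith
  have hT3 : 0 < T ^ 3 := by positivity
  obtain ⟨η, hηA⟩ : ∃ η, η = 2 - A := ⟨_, rfl⟩
  rw [← hηA] at hη hJ h₁ h₂ hsec
  obtain ⟨τ₁, hτ₁⟩ : ∃ τ₁, A₁ = η * τ₁ / 2 := ⟨2 * A₁ / η, by field_simp⟩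
  obtain ⟨τ₂, hτ₂⟩ : ∃ τ₂, A₂ = η * τ₂ / 2 := ⟨2 * A₂ / η, by field_simp⟩
  obtain ⟨g, hg⟩ : ∃ g, g * S = 2 * C + 3 * S := ⟨(2 * C + 3 * S) / S, by field_simp⟩
  obtain ⟨X, hX⟩ : ∃ X, u₁ ^ 2 + u₂ ^ 2 = X * S ^ 2 := ⟨(u₁ ^ 2 + u₂ ^ 2) / S ^ 2, by field_simp⟩
  have hJX : J * T ^ 3 = η ^ 2 * X := by
    rw [hX] at hJ
    have : (S ^ 2) ≠ 0 := by positivity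
    apply mul_right_cancel₀ this
    linear_combination hJ
  have hη2 : (η ^ 2) ≠ 0 := by positivity
  set G := u₁ ^ 2 + u₂ ^ 2 with hGdef
  set m₁ := u₁ * u₁₁ + u₂ * u₁₂ with hm₁
  set m₂ := u₁ * u₁₂ + u₂ * u₂₂ with hm₂
  have hgX : X * (2 * S * C + 3 * S ^ 2) = G * g := by rw [hX]; linear_combination -X * S * hg
  have e₁ : 2 * m₁ = G * (g * u₁ + τ₁) := by
    apply mul_left_cancel₀ hη2
    rw [hτ₁] at h₁
    linear_combination h₁ + (2 * S * C + 3 * S ^ 2) * u₁ * hJX + η ^ 2 * u₁ * hgX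
  have e₂ : 2 * m₂ = G * (g * u₂ + τ₂) := by
    apply mul_left_cancel₀ hη2
    rw [hτ₂] at h₂
    linear_combination h₂ + (2 * S * C + 3 * S ^ 2) * u₂ * hJX + η ^ 2 * u₂ * hgX
  have hess : 2 * (u₁₁ ^ 2 + 2 * u₁₂ ^ 2 + u₂₂ ^ 2)
      = G * ((g * u₁ + τ₁) ^ 2 + (g * u₂ + τ₂) ^ 2)
        + 8 * S * (4 * S - g * G - (τ₁ * u₁ + τ₂ * u₂)) := by
    apply mul_left_cancel₀ hG.ne'
    have id : G * (2 * (u₁₁ ^ 2 + 2 * u₁₂ ^ 2 + u₂₂ ^ 2)) = (2 * m₁) ^ 2 + (2 * m₂) ^ 2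
        + 2 * (u₁₁ + u₂₂) * ((u₁₁ + u₂₂) * G - (u₁ * (2 * m₁) + u₂ * (2 * m₂))) := by
      rw [hm₁, hm₂, hGdef]; ring
    rw [id, e₁, e₂, hlap]
    rw [hGdef]; ring
  have hC2 : X * (2 * C ^ 2 + 11 * S ^ 2 + 12 * S * C) = G * g ^ 2 - 2 * X := by
    rw [hX]
    linear_combination (-X) * (g * S + 2 * C + 3 * S) * hg - 2 * X * hCS
  have hsec' : η ^ 2 * (2 * X * G) ≤ η ^ 2 * (G * ((τ₁ ^ 2 + τ₂ ^ 2) / 2 + 16 * C + 36 * S)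
      - 32 * S ^ 2 + 8 * S * (τ₁ * u₁ + τ₂ * u₂)) + 8 * C * A * η * G := by
    rw [hess, hτ₁, hτ₂, e₁, e₂] at hsec
    have r : J * ((2 * C ^ 2 + 11 * S ^ 2 + 12 * S * C) * T ^ 3 * G
        + (2 * S * C + 3 * S ^ 2) * T ^ 3 * (4 * S))
        = η ^ 2 * ((G * g ^ 2 - 2 * X) * G + G * g * (4 * S)) := by
      linear_combination ((2 * C ^ 2 + 11 * S ^ 2 + 12 * S * C) * G
        + (2 * S * C + 3 * S ^ 2) * (4 * S)) * hJX + η ^ 2 * G * hC2 + η ^ 2 * 4 * S * hgX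
    rw [r] at hsec
    have hGG : G * g ^ 2 * u₁ ^ 2 + G * g ^ 2 * u₂ ^ 2 = G * g ^ 2 * G := by rw [hGdef]; ring
    linear_combination hsec + 12 * η ^ 2 * G * hg - η ^ 2 * hGG
  have amgm : 8 * S * (τ₁ * u₁ + τ₂ * u₂) ≤ 32 * S ^ 2 + G * ((τ₁ ^ 2 + τ₂ ^ 2) / 2) := by
    rw [hGdef]
    linear_combination (1 / 2) * sq_nonneg (8 * S - (τ₁ * u₁ + τ₂ * u₂))
      + (1 / 2) * sq_nonneg (τ₁ * u₂ - τ₂ * u₁)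
  have h3 : 2 * (η ^ 2 * X) ≤ η ^ 2 * (τ₁ ^ 2 + τ₂ ^ 2 + 16 * C + 36 * S) + 8 * C * A * η := by
    have : G * (2 * (η ^ 2 * X))
        ≤ G * (η ^ 2 * (τ₁ ^ 2 + τ₂ ^ 2 + 16 * C + 36 * S) + 8 * C * A * η) := by
      have := mul_le_mul_of_nonneg_left amgm (sq_nonneg η)
      linear_combination this + hsec'
    exact le_of_mul_le_mul_left this hG
  have h4 : η ^ 2 * (τ₁ ^ 2 + τ₂ ^ 2) = 4 * (A₁ ^ 2 + A₂ ^ 2) := by rw [hτ₁, hτ₂]; ring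
  have hη1 : η ≤ 1 := by linarith
  have hη3 : η ^ 2 ≤ 1 := pow_le_one₀ hη.le hη1
  have hA3 : A ^ 2 - 1 ≤ 3 := by
    have := pow_le_pow_left₀ (zero_le_one.trans hA1) hA2.le 2
    linarith
  have h5 : η ^ 2 * (16 * C + 36 * S) ≤ 52 * T := by
    have := mul_le_mul_of_nonneg_right hη3 (show 0 ≤ 16 * C + 36 * S by linarith)
    linarith
  have h6 : 4 * (A₁ ^ 2 + A₂ ^ 2) ≤ 48 * T := by
    have := mul_le_mul_of_nonneg_left hA3 (show 0 ≤ 2 * C + 2 by linarith)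
    linarith
  have h7 : 8 * C * A * η ≤ 8 * T := by
    have h : A * η ≤ 1 := by rw [hηA]; linear_combination sq_nonneg (A - 1)
    have := mul_le_mul_of_nonneg_left h (show 0 ≤ 8 * C by linarith)
    linarith
  have h8 : J * T ^ 3 ≤ 54 * T := by
    linear_combination hJX + h3 / 2 + h4 / 2 + h5 / 2 + h6 / 2 + h7 / 2
  have h9 : 54 * T ≤ 54 * T ^ 3 := by
    have := pow_le_pow_right₀ hT1 (show 1 ≤ 3 by norm_num)
    linarith
  exact le_of_mul_le_mul_right (h8.trans h9) hT3


namespace IsCodazziFrame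

variable {N : Set ℂ} {u ϑ : ℂ → ℝ} {z p : ℂ}

/-- The squared norm of the gradient of `u` in the conformal frame. -/
def frameGradSq (u ϑ : ℂ → ℝ) (z : ℂ) : ℝ :=
  dirDeriv (frameOne u ϑ) u z ^ 2 + dirDeriv (frameTwo u ϑ) u z ^ 2

theorem one_le_coshDist (hz : 0 < z.im) (hp : 0 < p.im) : 1 ≤ coshDist p z := by
  have : 0 ≤ ((z.re - p.re) ^ 2 + (z.im - p.im) ^ 2) / (2 * z.im * p.im) := by positivity
  simp only [coshDist]; linarith

/-- Differentiating the sinh-Gordon equation. -/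
theorem dirDeriv_sinhGordon (h : IsCodazziFrame N u ϑ) (hz : z ∈ N) {V : ℂ → ℂ} :
    dirDeriv V (dirDeriv (frameOne u ϑ) (dirDeriv (frameOne u ϑ) u)) z
      + dirDeriv V (dirDeriv (frameTwo u ϑ) (dirDeriv (frameTwo u ϑ) u)) z
      = 4 * cosh (u z) * dirDeriv V u z := by
  have hN := h.isOpen
  have s11 := dirDeriv_smooth hN h.smooth_one (dirDeriv_smooth hN h.smooth_one h.smooth_u)
  have s22 := dirDeriv_smooth hN h.smooth_two (dirDeriv_smooth hN h.smooth_two h.smooth_u)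
  rw [← dirDeriv_add (differentiableAt_of_smooth hN s11 hz) (differentiableAt_of_smooth hN s22 hz),
    dirDeriv_congr hN hz (g := fun z => 4 * sinh (u z)) fun w hw => h.sinhGordon hw,
    dirDeriv_comp ((Real.hasDerivAt_sinh (u z)).const_mul 4) (h.diff_u hz), smul_eq_mul]
  ring

theorem laplacian_dirDeriv_one (h : IsCodazziFrame N u ϑ) (hz : z ∈ N) :
    dirDeriv (frameOne u ϑ) (dirDeriv (frameOne u ϑ) (dirDeriv (frameOne u ϑ) u)) z
      + dirDeriv (frameTwo u ϑ) (dirDeriv (frameTwo u ϑ) (dirDeriv (frameOne u ϑ) u)) z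
      = 4 * cosh (u z) * dirDeriv (frameOne u ϑ) u z := by
  have hN := h.isOpen
  rw [← h.dirDeriv_sinhGordon hz, h.comm hz (dirDeriv_smooth hN h.smooth_two h.smooth_u),
    dirDeriv_congr hN hz fun w hw => h.comm hw h.smooth_u]

theorem laplacian_dirDeriv_two (h : IsCodazziFrame N u ϑ) (hz : z ∈ N) :
    dirDeriv (frameOne u ϑ) (dirDeriv (frameOne u ϑ) (dirDeriv (frameTwo u ϑ) u)) z
      + dirDeriv (frameTwo u ϑ) (dirDeriv (frameTwo u ϑ) (dirDeriv (frameTwo u ϑ) u)) z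
      = 4 * cosh (u z) * dirDeriv (frameTwo u ϑ) u z := by
  have hN := h.isOpen
  rw [← h.dirDeriv_sinhGordon hz, ← h.comm hz (dirDeriv_smooth hN h.smooth_one h.smooth_u),
    dirDeriv_congr hN hz (f := dirDeriv (frameOne u ϑ) (dirDeriv (frameTwo u ϑ) u))
      fun w hw => h.comm hw h.smooth_u]

/-- The interior gradient estimate at a maximum point. -/
theorem gradient_estimate (h : IsCodazziFrame N u ϑ) (hz : z ∈ N) (hp : 0 < p.im)
    (hu : ∀ z ∈ N, 0 < u z) (hA : coshDist p z < 2) (hG : 0 < frameGradSq u ϑ z)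
    (hmax : IsLocalMax (fun z => (2 - coshDist p z) ^ 2 * frameGradSq u ϑ z
      / (sinh (u z) ^ 2 * exp (u z) ^ 3)) z) :
    (2 - coshDist p z) ^ 2 * frameGradSq u ϑ z / (sinh (u z) ^ 2 * exp (u z) ^ 3) ≤ 54 := by
  have hN := h.isOpen
  have sO := h.smooth_one
  have sT := h.smooth_two
  have su := h.smooth_u
  have sA := smooth_coshDist (p := p) h.im_pos hp
  have s1 := dirDeriv_smooth hN sO su
  have s2 := dirDeriv_smooth hN sT su
  have d : ∀ {k : ℂ → ℝ}, ContDiffOn ℝ (⊤ : ℕ∞) k N → DifferentiableAt ℝ k z :=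
    fun hk => differentiableAt_of_smooth hN hk hz
  set J := (2 - coshDist p z) ^ 2 * frameGradSq u ϑ z / (sinh (u z) ^ 2 * exp (u z) ^ 3) with hJ
  set W : ℝ → ℝ := fun t => -J * (sinh t ^ 2 * exp t ^ 3) with hW
  set W' : ℝ → ℝ := fun t => -J * ((2 * sinh t * cosh t + 3 * sinh t ^ 2) * exp t ^ 3) with hW'
  have dW : ∀ t, HasDerivAt W (W' t) t := by
    intro t
    have := (((Real.hasDerivAt_sinh t).pow 2).mul ((Real.hasDerivAt_exp t).pow 3)).const_mul (-J)
    refine this.congr_deriv ?_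
    simp only [hW', Pi.pow_apply]; push_cast; ring
  have dW' : HasDerivAt W' (-J * ((2 * cosh (u z) ^ 2 + 11 * sinh (u z) ^ 2
      + 12 * sinh (u z) * cosh (u z)) * exp (u z) ^ 3)) (u z) := by
    have := (((((Real.hasDerivAt_sinh (u z)).const_mul 2).mul (Real.hasDerivAt_cosh (u z))).add
      (((Real.hasDerivAt_sinh (u z)).pow 2).const_mul 3)).mul
      ((Real.hasDerivAt_exp (u z)).pow 3)).const_mul (-J)
    refine this.congr_deriv ?_
    simp only [Pi.pow_apply, Pi.mul_apply, Pi.add_apply]; push_cast; ring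
  have sη : ContDiffOn ℝ (⊤ : ℕ∞) (fun z => 2 - coshDist p z) N := contDiffOn_const.sub sA
  have sE : ContDiffOn ℝ (⊤ : ℕ∞) (fun z => (2 - coshDist p z) * (2 - coshDist p z)) N := sη.mul sη
  have sG : ContDiffOn ℝ (⊤ : ℕ∞) (fun z => dirDeriv (frameOne u ϑ) u z * dirDeriv (frameOne u ϑ) u z
      + dirDeriv (frameTwo u ϑ) u z * dirDeriv (frameTwo u ϑ) u z) N := (s1.mul s1).add (s2.mul s2)
  have sEG := sE.mul sG
  have sW : ContDiffOn ℝ (⊤ : ℕ∞) (fun z => W (u z)) N := by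
    have : ContDiff ℝ (⊤ : ℕ∞) W :=
      contDiff_const.mul ((Real.contDiff_sinh.pow 2).mul (Real.contDiff_exp.pow 3))
    exact this.comp_contDiffOn su
  set F : ℂ → ℝ := fun z => ((2 - coshDist p z) * (2 - coshDist p z))
      * (dirDeriv (frameOne u ϑ) u z * dirDeriv (frameOne u ϑ) u z
        + dirDeriv (frameTwo u ϑ) u z * dirDeriv (frameTwo u ϑ) u z) + W (u z) with hF
  have sF : ContDiffOn ℝ (⊤ : ℕ∞) F N := sEG.add sW
  have hposW : ∀ z ∈ N, 0 < sinh (u z) ^ 2 * exp (u z) ^ 3 := fun z hz => by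
    have := Real.sinh_pos_iff.2 (hu z hz)
    positivity
  have hFmax : IsLocalMax F z := by
    have hFz : F z = 0 := by
      have := hposW z hz
      have hJ' : J * (sinh (u z) ^ 2 * exp (u z) ^ 3) = (2 - coshDist p z) ^ 2 * frameGradSq u ϑ z :=
        div_mul_cancel₀ _ this.ne'
      simp only [hF, hW, frameGradSq] at hJ' ⊢
      linear_combination -hJ'
    filter_upwards [hmax, hN.mem_nhds hz] with w hw hwN
    rw [hFz]
    have hpw := hposW w hwN
    have : _ ≤ J := hw
    rw [div_le_iff₀ hpw] at this
    simp only [hF, hW, frameGradSq] at this ⊢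
    nlinarith
  have hη : ∀ {V : ℂ → ℂ}, dirDeriv V (fun z => 2 - coshDist p z) z
      = -dirDeriv V (coshDist p) z := fun {V} => by
    rw [dirDeriv_sub (differentiableAt_const _) (d sA), dirDeriv_const]; ring
  have hηη : ∀ {V : ℂ → ℂ}, ContDiffOn ℝ (⊤ : ℕ∞) V N →
      dirDeriv V (dirDeriv V (fun z => 2 - coshDist p z)) z
        = -dirDeriv V (dirDeriv V (coshDist p)) z := fun {V} hV => by
    have e : dirDeriv V (dirDeriv V (fun z => 2 - coshDist p z)) z
        = dirDeriv V (fun z => 0 - dirDeriv V (coshDist p) z) z :=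
      dirDeriv_congr hN hz fun w hw => by
        rw [dirDeriv_sub (differentiableAt_const _) (differentiableAt_of_smooth hN sA hw),
          dirDeriv_const]
    rw [e, dirDeriv_sub (differentiableAt_const _) (d (dirDeriv_smooth hN hV sA)),
      dirDeriv_const]; ring
  have first : ∀ {V : ℂ → ℂ}, dirDeriv V F z = _ := fun {V} =>
    (dirDeriv_add (V := V) (d sEG) (d sW)).trans (congrArg₂ _
      ((dirDeriv_mul (d sE) (d sG)).trans (congrArg₂ _ (congrArg₂ _ (dirDeriv_mul (d sη) (d sη)) rfl)
        (congrArg₂ _ rfl ((dirDeriv_add (d (s1.mul s1)) (d (s2.mul s2))).trans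
          (congrArg₂ _ (dirDeriv_mul (d s1) (d s1)) (dirDeriv_mul (d s2) (d s2)))))))
      (dirDeriv_comp (dW (u z)) (d su)))
  have second : ∀ {V : ℂ → ℂ}, ContDiffOn ℝ (⊤ : ℕ∞) V N → dirDeriv V (dirDeriv V F) z = _ :=
    fun {V} hV => (dirDeriv_dirDeriv_add hN hz hV sEG sW).trans (congrArg₂ _
      ((dirDeriv_dirDeriv_mul hN hz hV sE sG).trans rfl) (dirDeriv_dirDeriv_comp hN hz hV su dW dW'))
  have f1 := dirDeriv_eq_zero_of_isLocalMax (V := frameOne u ϑ) hFmax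
  have f2 := dirDeriv_eq_zero_of_isLocalMax (V := frameTwo u ϑ) hFmax
  have g1 := dirDeriv_dirDeriv_nonpos_of_isLocalMax hN hz sO sF hFmax
  have g2 := dirDeriv_dirDeriv_nonpos_of_isLocalMax hN hz sT sF hFmax
  rw [first] at f1 f2
  rw [second sO, dirDeriv_mul (d sη) (d sη), dirDeriv_dirDeriv_mul hN hz sO sη sη,
    dirDeriv_dirDeriv_add hN hz sO (s1.mul s1) (s2.mul s2), dirDeriv_add (d (s1.mul s1)) (d (s2.mul s2)),
    dirDeriv_mul (d s1) (d s1), dirDeriv_mul (d s2) (d s2), dirDeriv_dirDeriv_mul hN hz sO s1 s1,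
    dirDeriv_dirDeriv_mul hN hz sO s2 s2, hηη sO] at g1
  rw [second sT, dirDeriv_mul (d sη) (d sη), dirDeriv_dirDeriv_mul hN hz sT sη sη,
    dirDeriv_dirDeriv_add hN hz sT (s1.mul s1) (s2.mul s2), dirDeriv_add (d (s1.mul s1)) (d (s2.mul s2)),
    dirDeriv_mul (d s1) (d s1), dirDeriv_mul (d s2) (d s2), dirDeriv_dirDeriv_mul hN hz sT s1 s1,
    dirDeriv_dirDeriv_mul hN hz sT s2 s2, hηη sT] at g2
  simp only [hη, smul_eq_mul] at f1 f2 g1 g2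
  have hcomm := h.comm hz su
  have hthird₁ := h.laplacian_dirDeriv_one hz
  have hthird₂ := h.laplacian_dirDeriv_two hz
  have hlap := h.sinhGordon hz
  have hlapA := h.laplacian_coshDist hz hp
  have hgrA := h.gradSq_coshDist hz hp
  have huz := hu z hz
  have hJeq : J * (sinh (u z) ^ 2 * exp (u z) ^ 3)
      = (2 - coshDist p z) ^ 2 * frameGradSq u ϑ z := div_mul_cancel₀ _ (hposW z hz).ne'
  rw [hcomm] at f1 g1
  simp only [hW'] at f1 f2 g1 g2
  simp only [frameGradSq] at hG hJeq
  refine gradient_algebra (Real.sinh_pos_iff.2 huz) (Real.cosh_add_sinh (u z)).symm (Real.cosh_sq _)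
    (Real.one_le_cosh _) (one_le_coshDist (h.im_pos z hz) hp) hA hG hJeq hlap
    (u₁₂ := dirDeriv (frameTwo u ϑ) (dirDeriv (frameOne u ϑ) u) z) ?_ ?_ ?_ hgrA
  · linear_combination f1
  · linear_combination f2
  · linear_combination g1 + g2 + 2 * (2 - coshDist p z) * (dirDeriv (frameOne u ϑ) u z ^ 2
        + dirDeriv (frameTwo u ϑ) u z ^ 2) * hlapA
      - 2 * (2 - coshDist p z) ^ 2 * dirDeriv (frameOne u ϑ) u z * hthird₁
      - 2 * (2 - coshDist p z) ^ 2 * dirDeriv (frameTwo u ϑ) u z * hthird₂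
      + J * ((2 * sinh (u z) * cosh (u z) + 3 * sinh (u z) ^ 2) * exp (u z) ^ 3) * hlap

end IsCodazziFrame

open scoped ComplexConjugate

/-! ### Codazzi tensors of determinant one on the upper half-plane -/

/-- The self-adjoint operator field `v ↦ α v + β conj v` has determinant one, is positive and
satisfies the Codazzi equation of the hyperbolic metric. -/
structure IsCodazziPair (α : ℂ → ℝ) (β : ℂ → ℂ) : Prop where
  smooth_α : ContDiffOn ℝ (⊤ : ℕ∞) α Hset
  smooth_β : ContDiffOn ℝ (⊤ : ℕ∞) β Hset
  pos : ∀ z ∈ Hset, 0 < α z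
  det : ∀ z ∈ Hset, α z ^ 2 = 1 + ‖β z‖ ^ 2
  codazzi : ∀ z ∈ Hset, ∀ v w : ℂ,
    (fderiv ℝ α z v : ℂ) * w + fderiv ℝ β z v * conj w + Complex.I / z.im * β z * v * conj w
      = (fderiv ℝ α z w : ℂ) * v + fderiv ℝ β z w * conj v + Complex.I / z.im * β z * w * conj v

theorem isOpen_Hset : IsOpen Hset := isOpen_lt continuous_const Complex.continuous_im

/-- The frame direction `e^{iϑ}`. -/
def unitDir (ϑ : ℝ) : ℂ := (cos ϑ : ℝ) + (sin ϑ : ℝ) * Complex.I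

theorem unitDir_mul_conj (ϑ : ℝ) : unitDir ϑ * conj (unitDir ϑ) = 1 := by
  apply Complex.ext
  · simp [unitDir, -Complex.ofReal_cos, -Complex.ofReal_sin]
    nlinarith [sin_sq_add_cos_sq ϑ]
  · simp [unitDir, -Complex.ofReal_cos, -Complex.ofReal_sin]
    ring

theorem unitDir_eq_exp (ϑ : ℝ) : unitDir ϑ = Complex.exp (ϑ * Complex.I) := by
  rw [Complex.exp_mul_I, unitDir]; push_cast; rfl

theorem frameOne_eq (u ϑ : ℂ → ℝ) (z : ℂ) : frameOne u ϑ z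
    = -(2 * Complex.I) * (cosh (u z / 2) : ℝ) * z.im * unitDir (ϑ z) := by
  simp only [frameOne, unitDir]; push_cast
  linear_combination (2 : ℂ) * Complex.cosh (u z / 2) * z.im * Complex.sin (ϑ z) * Complex.I_sq

theorem frameTwo_eq (u ϑ : ℂ → ℝ) (z : ℂ) : frameTwo u ϑ z
    = 2 * (sinh (u z / 2) : ℝ) * z.im * unitDir (ϑ z) := by
  simp only [frameTwo, unitDir]; push_cast; ring

theorem cosh_eq_half (t : ℝ) : cosh t = cosh (t / 2) ^ 2 + sinh (t / 2) ^ 2 := by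
  rw [← cosh_two_mul]; congr 1; ring

theorem sinh_eq_half (t : ℝ) : sinh t = 2 * sinh (t / 2) * cosh (t / 2) := by
  rw [← sinh_two_mul]; congr 1; ring

/-- Polar data `u`, `ϑ` with `α = coth u` and `β = e^{2iϑ} / sinh u` satisfy the frame relations. -/
theorem IsCodazziPair.isCodazziFrame {α : ℂ → ℝ} {β : ℂ → ℂ} (h : IsCodazziPair α β) {N : Set ℂ}
    (hN : IsOpen N) (hNH : N ⊆ Hset) {u ϑ : ℂ → ℝ} (su : ContDiffOn ℝ (⊤ : ℕ∞) u N)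
    (sϑ : ContDiffOn ℝ (⊤ : ℕ∞) ϑ N) (hu : ∀ z ∈ N, 0 < u z)
    (hα : ∀ z ∈ N, α z = cosh (u z) / sinh (u z))
    (hβ : ∀ z ∈ N, β z = unitDir (ϑ z) ^ 2 * ((sinh (u z))⁻¹ : ℝ)) :
    IsCodazziFrame N u ϑ ∧ ∀ z ∈ N, ∀ v, fderiv ℝ α z v = -(fderiv ℝ u z v * (sinh (u z))⁻¹ ^ 2) := by
  have key : ∀ z ∈ N, ∀ v, fderiv ℝ α z v = -(fderiv ℝ u z v * (sinh (u z))⁻¹ ^ 2) := by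
    intro z hz v
    have hS := Real.sinh_pos_iff.2 (hu z hz)
    have e := dirDeriv_congr (V := fun _ => v) hN hz hα
    have d := (Real.hasDerivAt_cosh (u z)).div (Real.hasDerivAt_sinh (u z)) hS.ne'
    rw [dirDeriv_comp (h := fun t => cosh t / sinh t) d (differentiableAt_of_smooth hN su hz)] at e
    simp only [dirDeriv, smul_eq_mul] at e
    rw [e]
    field_simp
    linear_combination -fderiv ℝ u z v * Real.cosh_sq (u z)
  have keyβ : ∀ z ∈ N, ∀ v, fderiv ℝ β z v = (2 * Complex.I * (fderiv ℝ ϑ z v : ℝ)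
      - (cosh (u z) * (sinh (u z))⁻¹ : ℝ) * (fderiv ℝ u z v : ℝ))
        * (unitDir (ϑ z) ^ 2 * ((sinh (u z))⁻¹ : ℝ)) := by
    intro z hz v
    have hS := Real.sinh_pos_iff.2 (hu z hz)
    have du := differentiableAt_of_smooth hN su hz
    have dϑ := differentiableAt_of_smooth hN sϑ hz
    have e := dirDeriv_congr (V := fun _ => v) hN hz hβ
    have d1 : HasDerivAt (fun t : ℝ => unitDir t ^ 2)
        (2 * Complex.I * unitDir (ϑ z) ^ 2) (ϑ z) := by
      have h1 : HasDerivAt unitDir (((-sin (ϑ z) : ℝ) : ℂ) + (cos (ϑ z) : ℝ) * Complex.I) (ϑ z) :=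
        ((Real.hasDerivAt_cos _).ofReal_comp).add
          (((Real.hasDerivAt_sin _).ofReal_comp).mul_const _)
      refine (h1.pow 2).congr_deriv ?_
      simp only [unitDir]; push_cast
      linear_combination (2 * Complex.sin (ϑ z) * (Complex.cos (ϑ z) + Complex.sin (ϑ z) * Complex.I))
        * -Complex.I_sq
    have d2 : HasDerivAt (fun t : ℝ => (((sinh t)⁻¹ : ℝ) : ℂ))
        ((-(cosh (u z)) / sinh (u z) ^ 2 : ℝ) : ℂ) (u z) :=
      ((Real.hasDerivAt_sinh (u z)).inv hS.ne').ofReal_comp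
    rw [dirDeriv_mul (f := fun z => unitDir (ϑ z) ^ 2) (g := fun z => (((sinh (u z))⁻¹ : ℝ) : ℂ))
      (d1.differentiableAt.comp z dϑ) (d2.differentiableAt.comp z du),
      dirDeriv_comp d1 dϑ, dirDeriv_comp d2 du] at e
    simp only [dirDeriv, Complex.real_smul] at e
    rw [e]; push_cast
    ring
  have frame : ∀ z ∈ N, dirDeriv (frameOne u ϑ) ϑ z
      = -(dirDeriv (frameTwo u ϑ) u z / 2) - 2 * cosh (u z / 2) * sin (ϑ z) ∧
      dirDeriv (frameTwo u ϑ) ϑ z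
      = dirDeriv (frameOne u ϑ) u z / 2 - 2 * sinh (u z / 2) * cos (ϑ z) := by
    intro z hz
    have hS := Real.sinh_pos_iff.2 (hu z hz)
    have hy : 0 < z.im := hNH hz
    have hsh := Real.sinh_pos_iff.2 (half_pos (hu z hz))
    have hch := Real.cosh_pos (u z / 2)
    have c := h.codazzi z (hNH hz) (frameOne u ϑ z) (frameTwo u ϑ z)
    rw [key z hz, key z hz, keyβ z hz, keyβ z hz, hβ z hz] at c
    simp only [dirDeriv]
    have he := unitDir_mul_conj (ϑ z)
    have he0 : unitDir (ϑ z) ≠ 0 := fun h0 => by simp [h0] at he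
    set D₁u := fderiv ℝ u z (frameOne u ϑ z)
    set D₂u := fderiv ℝ u z (frameTwo u ϑ z)
    set D₁ϑ := fderiv ℝ ϑ z (frameOne u ϑ z)
    set D₂ϑ := fderiv ℝ ϑ z (frameTwo u ϑ z)
    rw [frameOne_eq, frameTwo_eq] at c
    simp only [map_mul, map_neg, Complex.conj_ofReal, Complex.conj_I, map_ofNat] at c
    set Si := (sinh (u z))⁻¹ with hSi
    have hSi0 : Si ≠ 0 := inv_ne_zero hS.ne'
    set sh := sinh (u z / 2) with hsh'
    set ch := cosh (u z / 2) with hch'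
    set e := unitDir (ϑ z) with hedef
    have X : (sh * (-(1 + cosh (u z)) * Si * D₁u + 2 * Complex.I * D₁ϑ) + 4 * ch * sh * e
        - ch * (Complex.I * (1 - cosh (u z)) * Si * D₂u - 2 * D₂ϑ) : ℂ) = 0 := by
      have hne : (2 * z.im * e * Si : ℂ) ≠ 0 := by
        simp [he0, hSi0, hy.ne']
      apply mul_left_cancel₀ hne
      push_cast at c ⊢
      have hy' : (z.im : ℂ) ≠ 0 := by exact_mod_cast hy.ne'
      rw [div_eq_mul_inv] at c
      have hyy : (z.im : ℂ) * (z.im : ℂ)⁻¹ = 1 := mul_inv_cancel₀ hy'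
      linear_combination c - ((2 * Complex.I * D₁ϑ - Complex.cosh (u z) * Si * D₁u) * 2 * sh * z.im * e * Si
        - (2 * Complex.I * D₂ϑ - Complex.cosh (u z) * Si * D₂u) * 2 * Complex.I * ch * z.im * e * Si
        + 8 * e ^ 2 * Si * ch * sh * z.im * (z.im * (z.im : ℂ)⁻¹)) * he
        - 8 * e ^ 2 * Si * ch * sh * z.im * hyy
        + (8 * ch * sh * z.im * (z.im * (z.im : ℂ)⁻¹) * e ^ 2 * Si * (e * conj e)
          + 4 * D₂ϑ * ch * z.im * e * Si) * Complex.I_sq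
    have hch2 : 1 + cosh (u z) = 2 * ch ^ 2 := by
      rw [cosh_eq_half]; linear_combination -Real.cosh_sq (u z / 2)
    have hsh2 : 1 - cosh (u z) = -(2 * sh ^ 2) := by
      rw [cosh_eq_half]; linear_combination -Real.cosh_sq (u z / 2)
    have hSi2 : Si * (2 * sh * ch) = 1 := by
      rw [hSi, hsh', hch', ← sinh_eq_half]; exact inv_mul_cancel₀ hS.ne'
    have Xr := congrArg Complex.re X
    have Xi := congrArg Complex.im X
    simp [hedef, unitDir, -Complex.ofReal_cos, -Complex.ofReal_sin, -Complex.ofReal_cosh,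
      -Complex.ofReal_sinh] at Xr Xi
    constructor
    · apply mul_left_cancel₀ (show 2 * sh ≠ 0 by positivity)
      linear_combination Xi + ch * Si * D₂u * hsh2 - sh * D₂u * hSi2
    · apply mul_left_cancel₀ (show 2 * ch ≠ 0 by positivity)
      linear_combination Xr + sh * Si * D₁u * hch2 + ch * D₁u * hSi2
  exact ⟨⟨hN, su, sϑ, fun z hz => hNH hz, fun z hz => (frame z hz).1, fun z hz => (frame z hz).2⟩, key⟩

/-- Away from the zeros of `β` the pair `(α, β)` has smooth polar data. -/
theorem IsCodazziPair.exists_polar {α : ℂ → ℝ} {β : ℂ → ℂ} (h : IsCodazziPair α β) {z₀ : ℂ}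
    (hz₀ : z₀ ∈ Hset) (hβ₀ : β z₀ ≠ 0) :
    ∃ (N : Set ℂ) (u ϑ : ℂ → ℝ), IsOpen N ∧ z₀ ∈ N ∧ N ⊆ Hset ∧ ContDiffOn ℝ (⊤ : ℕ∞) u N ∧
      ContDiffOn ℝ (⊤ : ℕ∞) ϑ N ∧ (∀ z ∈ N, 0 < u z) ∧
      (∀ z ∈ N, α z = cosh (u z) / sinh (u z)) ∧
      (∀ z ∈ N, β z = unitDir (ϑ z) ^ 2 * ((sinh (u z))⁻¹ : ℝ)) := by
  have sq : ContDiffOn ℝ (⊤ : ℕ∞) (fun z => β z / β z₀) Hset := h.smooth_β.div_const _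
  set N := Hset ∩ (fun z => β z / β z₀) ⁻¹' Complex.slitPlane with hNdef
  have hN : IsOpen N := sq.continuousOn.isOpen_inter_preimage isOpen_Hset Complex.isOpen_slitPlane
  have hNH : N ⊆ Hset := inter_subset_left
  have hne : ∀ z ∈ N, β z ≠ 0 := fun z hz h0 => by
    have := hz.2
    simp [h0] at this
  have hsinh : ∀ z, sinh (arsinh (‖β z‖⁻¹)) = ‖β z‖⁻¹ := fun z => Real.sinh_arsinh _
  refine ⟨N, fun z => arsinh (‖β z‖⁻¹), fun z => Complex.arg (β z₀) / 2
    + (Complex.log (β z / β z₀)).im / 2, hN, ⟨hz₀, ?_⟩, hNH, ?_, ?_, ?_, ?_, ?_⟩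
  · simp [div_self hβ₀]
  · exact Real.contDiff_arsinh.comp_contDiffOn
      (((h.smooth_β.mono hNH).norm ℝ hne).inv fun z hz => norm_ne_zero_iff.2 (hne z hz))
  · refine contDiffOn_const.add (ContDiffOn.div_const ?_ _)
    refine Complex.imCLM.contDiff.comp_contDiffOn (f := fun z => Complex.log (β z / β z₀)) ?_
    intro z hz
    exact ((Complex.contDiffAt_log hz.2).restrict_scalars ℝ).comp_contDiffWithinAt z
      ((sq.mono hNH) z hz)
  · intro z hz
    exact Real.arsinh_pos_iff.2 (inv_pos.2 (norm_pos_iff.2 (hne z hz)))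
  · intro z hz
    have hb := norm_pos_iff.2 (hne z hz)
    have hc : cosh (arsinh (‖β z‖⁻¹)) = α z * ‖β z‖⁻¹ := by
      refine (pow_left_inj₀ (Real.cosh_pos _).le (mul_pos (h.pos z hz.1) (inv_pos.2 hb)).le
        two_ne_zero).1 ?_
      rw [Real.cosh_sq, hsinh, mul_pow, h.det z hz.1]
      field_simp
    rw [hc, hsinh]
    field_simp
  · intro z hz
    have hb := hne z hz
    simp only []
    rw [hsinh, inv_inv, unitDir_eq_exp, ← Complex.exp_nat_mul, Complex.log_im]
    have e : ((2 : ℕ) : ℂ) * (((β z₀).arg / 2 + (β z / β z₀).arg / 2 : ℝ) * Complex.I)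
        = (β z₀).arg * Complex.I + (β z / β z₀).arg * Complex.I := by push_cast; ring
    rw [e, Complex.exp_add]
    have e1 := Complex.norm_mul_exp_arg_mul_I (β z₀)
    have e2 := Complex.norm_mul_exp_arg_mul_I (β z / β z₀)
    rw [norm_div] at e2
    have n0 : (‖β z₀‖ : ℂ) ≠ 0 := by exact_mod_cast norm_ne_zero_iff.2 hβ₀
    calc β z = β z₀ * (β z / β z₀) := by field_simp
      _ = ‖β z₀‖ * Complex.exp ((β z₀).arg * Complex.I) * ((‖β z‖ / ‖β z₀‖ : ℝ)
          * Complex.exp ((β z / β z₀).arg * Complex.I)) := by rw [e1, e2]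
      _ = _ := by
        push_cast
        field_simp

/-- The gradient quantity controlled by the maximum principle. -/
def gradQuantity (α : ℂ → ℝ) (β : ℂ → ℂ) (z : ℂ) : ℝ :=
  2 * z.im ^ 2 * (α z * (fderiv ℝ α z 1 ^ 2 + fderiv ℝ α z Complex.I ^ 2)
    - ((β z).re * (fderiv ℝ α z 1 ^ 2 - fderiv ℝ α z Complex.I ^ 2)
      + 2 * (β z).im * (fderiv ℝ α z 1 * fderiv ℝ α z Complex.I))) / (1 + α z) ^ 3

theorem fderiv_eq_re_im (f : ℂ → ℝ) (z v : ℂ) :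
    fderiv ℝ f z v = v.re * fderiv ℝ f z 1 + v.im * fderiv ℝ f z Complex.I := by
  conv_lhs => rw [← Complex.re_add_im v]
  have e : ((v.re : ℂ) + v.im * Complex.I) = v.re • (1 : ℂ) + v.im • Complex.I := by simp
  rw [e, map_add, map_smul, map_smul, smul_eq_mul, smul_eq_mul]

theorem frameGradSq_eq {α : ℂ → ℝ} {β : ℂ → ℂ} {u ϑ : ℂ → ℝ} {z : ℂ} (hu : 0 < u z)
    (hα : α z = cosh (u z) / sinh (u z))
    (hβ : β z = unitDir (ϑ z) ^ 2 * ((sinh (u z))⁻¹ : ℝ))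
    (hd : ∀ v, fderiv ℝ α z v = -(fderiv ℝ u z v * (sinh (u z))⁻¹ ^ 2)) :
    IsCodazziFrame.frameGradSq u ϑ z / (sinh (u z) ^ 2 * exp (u z) ^ 3) = gradQuantity α β z := by
  have hS := Real.sinh_pos_iff.2 hu
  have hd' : ∀ v, fderiv ℝ u z v = -(sinh (u z) ^ 2 * fderiv ℝ α z v) := fun v => by
    rw [hd]; field_simp
  have hα' : 1 + α z = exp (u z) / sinh (u z) := by
    rw [hα, ← Real.cosh_add_sinh]; field_simp; ring
  have hre : (β z).re = (cos (ϑ z) ^ 2 - sin (ϑ z) ^ 2) / sinh (u z) := by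
    rw [hβ]
    simp [unitDir, pow_two, -Complex.ofReal_cos, -Complex.ofReal_sin,
      -Complex.ofReal_sinh, -Complex.ofReal_inv, div_eq_mul_inv]
  have him : (β z).im = (2 * sin (ϑ z) * cos (ϑ z)) / sinh (u z) := by
    rw [hβ]
    simp [unitDir, pow_two, -Complex.ofReal_cos, -Complex.ofReal_sin,
      -Complex.ofReal_sinh, -Complex.ofReal_inv, div_eq_mul_inv, -mul_eq_mul_right_iff]
    ring
  rw [gradQuantity, hα', hre, him, hα, IsCodazziFrame.frameGradSq]
  simp only [dirDeriv]
  rw [hd', hd', fderiv_eq_re_im, fderiv_eq_re_im α z (frameTwo u ϑ z),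
    IsCodazziFrame.frameOne_re, IsCodazziFrame.frameOne_im, IsCodazziFrame.frameTwo_re,
    IsCodazziFrame.frameTwo_im]
  field_simp
  have h1 := cosh_eq_half (u z)
  have h2 := Real.cosh_sq (u z / 2)
  have h3 := Real.sin_sq_add_cos_sq (ϑ z)
  obtain ⟨X, hX⟩ : ∃ X, X = fderiv ℝ α z 1 := ⟨_, rfl⟩
  obtain ⟨Y, hY⟩ : ∃ Y, Y = fderiv ℝ α z Complex.I := ⟨_, rfl⟩
  rw [← hX, ← hY]
  linear_combination (-1 : ℝ) * z.im ^ 2 * (X ^ 2 + Y ^ 2) * h1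
    + z.im ^ 2 * (cosh (u z / 2) ^ 2 + sinh (u z / 2) ^ 2) * (X ^ 2 + Y ^ 2) * h3
    + z.im ^ 2 * ((sin (ϑ z) ^ 2 - cos (ϑ z) ^ 2) * (X ^ 2 - Y ^ 2)
      - 4 * sin (ϑ z) * cos (ϑ z) * X * Y) * h2

/-- A closed hyperbolic disc, described by a polynomial inequality. -/
theorem isCompact_coshDist_le {p : ℂ} (hp : 0 < p.im) :
    IsCompact {z : ℂ | (z.re - p.re) ^ 2 + z.im ^ 2 - 4 * z.im * p.im + p.im ^ 2 ≤ 0} := by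
  refine Metric.isCompact_of_isClosed_isBounded ?_ ?_
  · exact isClosed_le (by fun_prop) continuous_const
  · refine (Metric.isBounded_closedBall (x := p) (r := 3 * p.im)).subset ?_
    intro z hz
    rw [mem_ofPred_eq] at hz
    rw [mem_closedBall_iff_norm]
    refine abs_le_of_sq_le_sq' ?_ (by positivity) |>.2
    rw [Complex.sq_norm, Complex.normSq_apply, Complex.sub_re, Complex.sub_im]
    nlinarith [sq_nonneg (z.im - 2 * p.im), sq_nonneg (z.re - p.re)]

theorem im_pos_of_coshDist_le {p z : ℂ} (hp : 0 < p.im)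
    (hz : (z.re - p.re) ^ 2 + z.im ^ 2 - 4 * z.im * p.im + p.im ^ 2 ≤ 0) : 0 < z.im := by
  by_contra h
  nlinarith [sq_nonneg (z.im), sq_nonneg (z.re - p.re), mul_pos hp hp,
    mul_nonneg (neg_nonneg.2 (not_lt.1 h)) hp.le]

theorem coshDist_eq {p z : ℂ} (hp : 0 < p.im) (hz : 0 < z.im) :
    2 - coshDist p z
      = -((z.re - p.re) ^ 2 + z.im ^ 2 - 4 * z.im * p.im + p.im ^ 2) / (2 * z.im * p.im) := by
  rw [coshDist]; field_simp; ring

namespace IsCodazziPair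

variable {α : ℂ → ℝ} {β : ℂ → ℂ}

theorem one_le (h : IsCodazziPair α β) {z : ℂ} (hz : z ∈ Hset) : 1 ≤ α z := by
  nlinarith [h.det z hz, h.pos z hz, sq_nonneg ‖β z‖]

theorem continuousOn_fderiv (h : IsCodazziPair α β) (v : ℂ) :
    ContinuousOn (fun z => fderiv ℝ α z v) Hset :=
  (dirDeriv_smooth (V := fun _ => v) isOpen_Hset contDiffOn_const h.smooth_α).continuousOn

theorem continuousOn_gradQuantity (h : IsCodazziPair α β) :
    ContinuousOn (gradQuantity α β) Hset := by
  have h1 := h.continuousOn_fderiv 1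
  have h2 := h.continuousOn_fderiv Complex.I
  have h3 := h.smooth_α.continuousOn
  have h4 := h.smooth_β.continuousOn
  have h5 : ContinuousOn (fun z => (β z).re) Hset := Complex.continuous_re.comp_continuousOn h4
  have h6 : ContinuousOn (fun z => (β z).im) Hset := Complex.continuous_im.comp_continuousOn h4
  have h7 : ContinuousOn (fun z : ℂ => z.im) Hset := Complex.continuous_im.continuousOn
  refine ContinuousOn.div (((continuousOn_const.mul (h7.pow 2))).mul ((h3.mul ((h1.pow 2).add
    (h2.pow 2))).sub ((h5.mul ((h1.pow 2).sub (h2.pow 2))).add ((continuousOn_const.mul h6).mul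
      (h1.mul h2))))) ((continuousOn_const.add h3).pow 3) ?_
  intro z hz
  have := h.pos z hz
  positivity

/-- The interior gradient estimate for Codazzi pairs. -/
theorem gradQuantity_le (h : IsCodazziPair α β) {p : ℂ} (hp : p ∈ Hset) :
    gradQuantity α β p ≤ 54 := by
  have hp' : 0 < p.im := hp
  set K := {z : ℂ | (z.re - p.re) ^ 2 + z.im ^ 2 - 4 * z.im * p.im + p.im ^ 2 ≤ 0} with hK
  have hKH : K ⊆ Hset := fun z hz => im_pos_of_coshDist_le hp' hz
  have hpK : p ∈ K := by rw [hK, mem_ofPred_eq]; nlinarith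
  set F : ℂ → ℝ := fun z => (2 - coshDist p z) ^ 2 * gradQuantity α β z with hF
  have cF : ContinuousOn F K :=
    ((continuousOn_const.sub (IsCodazziFrame.smooth_coshDist (N := Hset) (fun z hz => hz) hp').continuousOn).pow 2
      |>.mul h.continuousOn_gradQuantity).mono hKH
  obtain ⟨z₀, hz₀, hmax⟩ := (isCompact_coshDist_le hp').exists_isMaxOn ⟨p, hpK⟩ cF
  have hFp : F p = gradQuantity α β p := by simp [hF, coshDist]; ring
  have hle : gradQuantity α β p ≤ F z₀ := hFp ▸ hmax hpK
  refine hle.trans ?_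
  by_contra! hlt
  have hzH : z₀ ∈ Hset := hKH hz₀
  have hzH' : 0 < z₀.im := hzH
  have hA : coshDist p z₀ < 2 := by
    have h1 := coshDist_eq hp' hzH
    have h2 : 0 ≤ 2 - coshDist p z₀ := by
      rw [h1]
      have : 0 ≤ -((z₀.re - p.re) ^ 2 + z₀.im ^ 2 - 4 * z₀.im * p.im + p.im ^ 2) := by
        have : _ ≤ (0 : ℝ) := hz₀
        linarith
      positivity
    refine lt_of_le_of_ne (by linarith) fun h3 => ?_
    simp [hF, h3] at hlt
    linarith
  have hKn : K ∈ 𝓝 z₀ := by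
    have : {z : ℂ | (z.re - p.re) ^ 2 + z.im ^ 2 - 4 * z.im * p.im + p.im ^ 2 < 0} ∈ 𝓝 z₀ := by
      refine (isOpen_lt (by fun_prop) continuous_const).mem_nhds ?_
      have h1 := coshDist_eq hp' hzH
      have h2 : 0 < 2 - coshDist p z₀ := by linarith
      rw [h1, div_pos_iff_of_pos_right (by positivity)] at h2
      rw [mem_ofPred_eq]; linarith
    filter_upwards [this] with z hz
    exact le_of_lt hz
  have hloc : IsLocalMax F z₀ := hmax.isLocalMax hKn
  have hβ₀ : β z₀ ≠ 0 := by
    intro h0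
    have h1 : α z₀ = 1 := by
      have := h.det z₀ hzH
      rw [h0, norm_zero] at this
      have hpos := h.pos z₀ hzH
      exact (pow_eq_one_iff_of_nonneg hpos.le two_ne_zero).1 (by linarith)
    have h2 : IsLocalMin α z₀ := by
      filter_upwards [isOpen_Hset.mem_nhds hzH] with z hz
      rw [h1]; exact h.one_le hz
    have h3 := h2.fderiv_eq_zero
    have : F z₀ = 0 := by simp [hF, gradQuantity, h3]
    linarith
  obtain ⟨N, u, ϑ, hN, hzN, hNH, su, sϑ, hu, hα, hβ⟩ := h.exists_polar hzH hβ₀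
  obtain ⟨hfr, hd⟩ := h.isCodazziFrame hN hNH su sϑ hu hα hβ
  have heq : ∀ z ∈ N, (2 - coshDist p z) ^ 2 * IsCodazziFrame.frameGradSq u ϑ z
      / (sinh (u z) ^ 2 * exp (u z) ^ 3) = F z := fun z hz => by
    rw [mul_div_assoc, frameGradSq_eq (hu z hz) (hα z hz) (hβ z hz) (hd z hz)]
  have hG : 0 < IsCodazziFrame.frameGradSq u ϑ z₀ := by
    refine lt_of_le_of_ne (by unfold IsCodazziFrame.frameGradSq; positivity) fun h0 => ?_
    have := heq z₀ hzN
    rw [← h0] at this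
    simp at this
    linarith
  have := hfr.gradient_estimate hzN hp' hu hA hG (hloc.congr (by
    filter_upwards [hN.mem_nhds hzN] with z hz using (heq z hz).symm))
  rw [heq z₀ hzN] at this
  linarith

end IsCodazziPair

theorem exists_unit_sq {b : ℂ} (hb : b ≠ 0) : ∃ e : ℂ, ‖e‖ = 1 ∧ b = ‖b‖ * e ^ 2 := by
  obtain ⟨e, he⟩ := IsAlgClosed.exists_pow_nat_eq (b / ‖b‖) (n := 2) (by norm_num)
  have hb' : (‖b‖ : ℂ) ≠ 0 := by exact_mod_cast norm_ne_zero_iff.2 hb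
  refine ⟨e, ?_, by rw [he]; field_simp⟩
  have h := congrArg norm he
  rw [norm_pow, norm_div, Complex.norm_real, norm_norm, div_self (norm_ne_zero_iff.2 hb)] at h
  exact (pow_eq_one_iff_of_nonneg (norm_nonneg _) two_ne_zero).1 h

namespace IsCodazziPair

variable {α : ℂ → ℝ} {β : ℂ → ℂ} {z e : ℂ}

theorem norm_lt (h : IsCodazziPair α β) (hz : z ∈ Hset) : ‖β z‖ < α z :=
  abs_lt_of_sq_lt_sq' (by linarith [h.det z hz]) (h.pos z hz).le |>.2

theorem re_im_sq_of_norm_eq_one (he : ‖e‖ = 1) : e.re ^ 2 + e.im ^ 2 = 1 := by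
  have := Complex.sq_norm e
  rw [he, Complex.normSq_apply] at this
  linarith

/-- The gradient estimate in the principal directions of `β`. -/
theorem gradient_principal (h : IsCodazziPair α β) (hz : z ∈ Hset) (he : ‖e‖ = 1)
    (hβ : β z = ‖β z‖ * e ^ 2) :
    z.im ^ 2 * ((α z - ‖β z‖) * fderiv ℝ α z e ^ 2
      + (α z + ‖β z‖) * fderiv ℝ α z (Complex.I * e) ^ 2) ≤ 216 * α z ^ 3 := by
  have h1 := h.gradQuantity_le hz
  have hα := h.one_le hz
  rw [gradQuantity, div_le_iff₀ (by positivity)] at h1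
  have hre := congrArg Complex.re hβ
  have him := congrArg Complex.im hβ
  simp only [pow_two, Complex.mul_re, Complex.mul_im, Complex.ofReal_re, Complex.ofReal_im] at hre him
  have hn := re_im_sq_of_norm_eq_one he
  rw [fderiv_eq_re_im α z e, fderiv_eq_re_im α z (Complex.I * e)]
  simp only [Complex.mul_re, Complex.mul_im, Complex.I_re, Complex.I_im]
  set X := fderiv ℝ α z 1
  set Y := fderiv ℝ α z Complex.I
  set ρ := ‖β z‖
  rw [hre, him] at h1
  have h2 : (1 + α z) ^ 3 ≤ (2 * α z) ^ 3 := pow_le_pow_left₀ (by linarith) (by linarith) 3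
  linear_combination h1 / 2 + 27 * h2 + z.im ^ 2 * α z * (X ^ 2 + Y ^ 2) * hn

theorem im_mul_fderiv_I_mul_le (h : IsCodazziPair α β) (hz : z ∈ Hset) (he : ‖e‖ = 1)
    (hβ : β z = ‖β z‖ * e ^ 2) : z.im * |fderiv ℝ α z (Complex.I * e)| ≤ 15 * α z := by
  have h1 := h.gradient_principal hz he hβ
  have h2 := h.norm_lt hz
  have hα := h.pos z hz
  have hy : 0 < z.im := hz
  refine abs_le_of_sq_le_sq' ?_ (by positivity) |>.2
  rw [mul_pow, sq_abs]
  have h3 : α z * (z.im ^ 2 * fderiv ℝ α z (Complex.I * e) ^ 2) ≤ α z * (216 * α z ^ 2) := by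
    have h4 : 0 ≤ z.im ^ 2 * ((α z - ‖β z‖) * fderiv ℝ α z e ^ 2) := by
      have : 0 < α z - ‖β z‖ := by linarith
      positivity
    have h5 : 0 ≤ z.im ^ 2 * (‖β z‖ * fderiv ℝ α z (Complex.I * e) ^ 2) := by positivity
    linear_combination h1 + h4 + h5
  have h6 := le_of_mul_le_mul_left h3 hα
  nlinarith [sq_nonneg (α z)]

theorem im_mul_fderiv_le_aux (h : IsCodazziPair α β) (hz : z ∈ Hset) (he : ‖e‖ = 1)
    (hβ : β z = ‖β z‖ * e ^ 2) : z.im * |fderiv ℝ α z e| ≤ 21 * α z ^ 2 := by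
  have h1 := h.gradient_principal hz he hβ
  have h2 := h.norm_lt hz
  have hα := h.pos z hz
  have hy : 0 < z.im := hz
  have hdet := h.det z hz
  refine abs_le_of_sq_le_sq' ?_ (by positivity) |>.2
  rw [mul_pow, sq_abs]
  have h4 : 0 ≤ z.im ^ 2 * ((α z + ‖β z‖) * fderiv ℝ α z (Complex.I * e) ^ 2) := by positivity
  have h5 : z.im ^ 2 * ((α z - ‖β z‖) * fderiv ℝ α z e ^ 2) ≤ 216 * α z ^ 3 := by linarith
  have h6 := mul_le_mul_of_nonneg_left h5 (show 0 ≤ α z + ‖β z‖ by positivity)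
  have h7 : (α z + ‖β z‖) * (216 * α z ^ 3) ≤ 2 * α z * (216 * α z ^ 3) :=
    mul_le_mul_of_nonneg_right (by linarith) (by positivity)
  have h8 : 0 ≤ α z ^ 4 := by positivity
  linear_combination h6 + h7 + z.im ^ 2 * fderiv ℝ α z e ^ 2 * -hdet + 9 * h8

theorem fderiv_eq_principal (f : ℂ → ℝ) (he : ‖e‖ = 1) (v : ℂ) :
    fderiv ℝ f z v = (v * conj e).re * fderiv ℝ f z e + (v * conj e).im * fderiv ℝ f z (Complex.I * e) := by
  have h1 : v = (v * conj e).re • e + (v * conj e).im • (Complex.I * e) := by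
    have h2 : e * conj e = 1 := by rw [Complex.mul_conj, Complex.normSq_eq_norm_sq, he]; simp
    have h3 := Complex.re_add_im (v * conj e)
    simp only [Complex.real_smul]
    linear_combination -v * h2 - e * h3
  conv_lhs => rw [h1]
  rw [map_add, map_smul, map_smul, smul_eq_mul, smul_eq_mul]

theorem norm_mul_conj_eq (he : ‖e‖ = 1) (v : ℂ) : ‖v * conj e‖ = ‖v‖ := by
  rw [norm_mul, RCLike.norm_conj, he, mul_one]

/-- The gradient of `α` is controlled by `α²`. -/
theorem im_mul_fderiv_le (h : IsCodazziPair α β) (hz : z ∈ Hset) (v : ℂ) :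
    z.im * |fderiv ℝ α z v| ≤ 36 * α z ^ 2 * ‖v‖ := by
  by_cases hβ : β z = 0
  · have h1 : α z = 1 := by
      have := h.det z hz
      rw [hβ, norm_zero] at this
      exact (pow_eq_one_iff_of_nonneg (h.pos z hz).le two_ne_zero).1 (by linarith)
    have h2 : IsLocalMin α z := by
      filter_upwards [isOpen_Hset.mem_nhds hz] with w hw
      rw [h1]; exact h.one_le hw
    rw [h2.fderiv_eq_zero]
    simp only [zero_apply, abs_zero, mul_zero]
    positivity
  · obtain ⟨e, he, hβe⟩ := exists_unit_sq hβ
    have h1 := h.im_mul_fderiv_le_aux hz he hβe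
    have h2 := h.im_mul_fderiv_I_mul_le hz he hβe
    have hα := h.one_le hz
    have hy : 0 < z.im := hz
    rw [fderiv_eq_principal α he v]
    have h3 := Complex.abs_re_le_norm (v * conj e)
    have h4 := Complex.abs_im_le_norm (v * conj e)
    rw [norm_mul_conj_eq he] at h3 h4
    calc _ ≤ z.im * (|(v * conj e).re| * |fderiv ℝ α z e|
          + |(v * conj e).im| * |fderiv ℝ α z (Complex.I * e)|) := by
          refine mul_le_mul_of_nonneg_left ?_ hy.le
          rw [← abs_mul, ← abs_mul]; exact abs_add_le _ _
      _ = |(v * conj e).re| * (z.im * |fderiv ℝ α z e|)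
          + |(v * conj e).im| * (z.im * |fderiv ℝ α z (Complex.I * e)|) := by ring
      _ ≤ ‖v‖ * (21 * α z ^ 2) + ‖v‖ * (15 * α z ^ 2) := by
          refine add_le_add (mul_le_mul h3 h1 (by positivity) (norm_nonneg _))
            (mul_le_mul h4 (h2.trans ?_) (by positivity) (norm_nonneg _))
          nlinarith
      _ = _ := by ring

theorem differentiableAt_α (h : IsCodazziPair α β) (hz : z ∈ Hset) : DifferentiableAt ℝ α z :=
  differentiableAt_of_smooth isOpen_Hset h.smooth_α hz

theorem differentiableAt_β (h : IsCodazziPair α β) (hz : z ∈ Hset) : DifferentiableAt ℝ β z :=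
  differentiableAt_of_smooth isOpen_Hset h.smooth_β hz

theorem dirDeriv_norm (h : IsCodazziPair α β) (hz : z ∈ Hset) (hβ : β z ≠ 0) (v : ℂ) :
    ‖β z‖ * fderiv ℝ (fun z => ‖β z‖) z v = α z * fderiv ℝ α z v := by
  have dρ : DifferentiableAt ℝ (fun z => ‖β z‖) z := (h.differentiableAt_β hz).norm ℝ hβ
  have dα := h.differentiableAt_α hz
  have e := dirDeriv_congr (V := fun _ => v) (f := fun z => α z * α z)
    (g := fun z => 1 + ‖β z‖ * ‖β z‖) isOpen_Hset hz
    fun w hw => by simp only; linear_combination h.det w hw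
  rw [dirDeriv_mul dα dα, dirDeriv_add (differentiableAt_const _) (dρ.fun_mul dρ), dirDeriv_const,
    dirDeriv_mul dρ dρ] at e
  simp only [dirDeriv] at e
  linear_combination -e / 2

theorem re_fderiv_mul_conj (h : IsCodazziPair α β) (hz : z ∈ Hset) (v : ℂ) :
    (fderiv ℝ β z v * conj (β z)).re = α z * fderiv ℝ α z v := by
  have dα := h.differentiableAt_α hz
  have dβ := h.differentiableAt_β hz
  have dc : DifferentiableAt ℝ (fun z => conj (β z)) z := Complex.conjCLE.differentiableAt.comp z dβ
  have e := dirDeriv_congr (V := fun _ => v) (f := fun z => ((α z : ℝ) : ℂ) * (α z : ℝ))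
    (g := fun z => 1 + β z * conj (β z)) isOpen_Hset hz
    fun w hw => by
      simp only
      rw [Complex.mul_conj, Complex.normSq_eq_norm_sq, ← pow_two]
      exact_mod_cast h.det w hw
  have dα' : DifferentiableAt ℝ (fun z => ((α z : ℝ) : ℂ)) z := Complex.ofRealCLM.differentiableAt.comp z dα
  rw [dirDeriv_mul dα' dα', dirDeriv_add (differentiableAt_const _) (dβ.fun_mul dc), dirDeriv_const,
    dirDeriv_mul dβ dc, dirDeriv_ofReal dα] at e
  have hc : dirDeriv (fun _ => v) (fun z => conj (β z)) z = conj (fderiv ℝ β z v) := by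
    have := (Complex.conjCLE.toContinuousLinearMap.hasFDerivAt.comp z dβ.hasFDerivAt).fderiv
    exact congrArg (fun L => L v) this
  rw [hc] at e
  simp only [dirDeriv] at e
  have := congrArg Complex.re e
  simp at this
  simp
  linarith

/-- The rotation speed of `β` in the principal directions, as dictated by the Codazzi equation. -/
theorem rotation_principal (h : IsCodazziPair α β) (hz : z ∈ Hset) (he : ‖e‖ = 1)
    (hβ : β z = ‖β z‖ * e ^ 2) :
    (fderiv ℝ β z e * conj (β z)).im
      = (‖β z‖ + α z) * fderiv ℝ α z (Complex.I * e) - 2 * ‖β z‖ ^ 2 * e.re / z.im ∧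
    (fderiv ℝ β z (Complex.I * e) * conj (β z)).im
      = (‖β z‖ - α z) * fderiv ℝ α z e + 2 * ‖β z‖ ^ 2 * e.im / z.im := by
  have hee : e * conj e = 1 := by rw [Complex.mul_conj, Complex.normSq_eq_norm_sq, he]; simp
  have c := h.codazzi z hz e (Complex.I * e)
  have r1 := h.re_fderiv_mul_conj hz e
  have r2 := h.re_fderiv_mul_conj hz (Complex.I * e)
  have hcβ : conj (β z) = ‖β z‖ * conj e ^ 2 := by
    conv_lhs => rw [hβ]
    simp
  set P := fderiv ℝ β z e * conj (β z) with hP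
  set Q := fderiv ℝ β z (Complex.I * e) * conj (β z) with hQ
  set ρ := ‖β z‖ with hρ
  have key : Complex.I * (ρ * fderiv ℝ α z e : ℝ) - Complex.I * P + (2 * ρ ^ 2 / z.im : ℝ) * e
      = (ρ * fderiv ℝ α z (Complex.I * e) : ℝ) + Q := by
    rw [hP, hQ, hcβ]
    rw [hβ] at c
    simp only [map_mul, Complex.conj_I] at c
    push_cast
    linear_combination (ρ * conj e) * c
      + (ρ * (fderiv ℝ α z (Complex.I * e) : ℂ) - ρ * Complex.I * (fderiv ℝ α z e : ℂ)
        - 2 * ρ ^ 2 / z.im * e * (1 + e * conj e)) * hee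
      + 2 * ρ ^ 2 / z.im * e ^ 3 * conj e ^ 2 * Complex.I_sq
  have k1 := congrArg Complex.re key
  have k2 := congrArg Complex.im key
  simp only [Complex.add_re, Complex.add_im, Complex.sub_re, Complex.sub_im, Complex.mul_re,
    Complex.mul_im, Complex.I_re, Complex.I_im, Complex.ofReal_re, Complex.ofReal_im] at k1 k2
  constructor
  · linear_combination k1 + r2
  · linear_combination -k2 - r1

/-- Where `‖β‖ ≥ 1`, the direction of `β` rotates at bounded hyperbolic speed. -/
theorem im_mul_rotation_le (h : IsCodazziPair α β) (hz : z ∈ Hset) (hβ1 : 1 ≤ ‖β z‖) (v : ℂ) :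
    z.im * |(fderiv ℝ β z v * conj (β z)).im| ≤ 100 * ‖β z‖ ^ 2 * ‖v‖ := by
  have hβ0 : β z ≠ 0 := norm_pos_iff.1 (by linarith)
  obtain ⟨e, he, hβe⟩ := exists_unit_sq hβ0
  obtain ⟨r1, r2⟩ := h.rotation_principal hz he hβe
  have h1 := h.im_mul_fderiv_le_aux hz he hβe
  have h2 := h.im_mul_fderiv_I_mul_le hz he hβe
  have hα := h.one_le hz
  have hlt := h.norm_lt hz
  have hdet := h.det z hz
  have hy : 0 < z.im := hz
  have hα2 : α z ≤ 3 / 2 * ‖β z‖ := by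
    refine abs_le_of_sq_le_sq' ?_ (by positivity) |>.2
    nlinarith
  have hre := (Complex.abs_re_le_norm e).trans he.le
  have him := (Complex.abs_im_le_norm e).trans he.le
  set ρ := ‖β z‖ with hρ
  have b1 : z.im * |(fderiv ℝ β z e * conj (β z)).im| ≤ 60 * ρ ^ 2 := by
    rw [r1]
    calc z.im * |(ρ + α z) * fderiv ℝ α z (Complex.I * e) - 2 * ρ ^ 2 * e.re / z.im|
        ≤ z.im * ((ρ + α z) * |fderiv ℝ α z (Complex.I * e)| + 2 * ρ ^ 2 * |e.re| / z.im) := by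
          refine mul_le_mul_of_nonneg_left ((abs_sub _ _).trans (le_of_eq ?_)) hy.le
          rw [abs_mul, abs_div, abs_mul, abs_of_pos hy, abs_of_pos (show 0 < ρ + α z by linarith),
            abs_of_nonneg (show 0 ≤ 2 * ρ ^ 2 by positivity)]
      _ = (ρ + α z) * (z.im * |fderiv ℝ α z (Complex.I * e)|) + 2 * ρ ^ 2 * |e.re| := by field_simp
      _ ≤ (ρ + 3 / 2 * ρ) * (15 * (3 / 2 * ρ)) + 2 * ρ ^ 2 * 1 := by
          have h3 : z.im * |fderiv ℝ α z (Complex.I * e)| ≤ 15 * (3 / 2 * ρ) := h2.trans (by linarith)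
          gcongr
      _ ≤ _ := by nlinarith [sq_nonneg ρ]
  have b2 : z.im * |(fderiv ℝ β z (Complex.I * e) * conj (β z)).im| ≤ 40 * ρ ^ 2 := by
    rw [r2]
    have hd : (α z - ρ) * α z ^ 2 ≤ 3 / 2 * ρ := by
      have h3 : (α z - ρ) * α z ≤ 1 := by nlinarith
      nlinarith
    calc z.im * |(ρ - α z) * fderiv ℝ α z e + 2 * ρ ^ 2 * e.im / z.im|
        ≤ z.im * ((α z - ρ) * |fderiv ℝ α z e| + 2 * ρ ^ 2 * |e.im| / z.im) := by
          refine mul_le_mul_of_nonneg_left ((abs_add_le _ _).trans (le_of_eq ?_)) hy.le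
          rw [abs_mul, abs_div, abs_mul, abs_of_pos hy, abs_of_neg (show ρ - α z < 0 by linarith),
            abs_of_nonneg (show 0 ≤ 2 * ρ ^ 2 by positivity), neg_sub]
      _ = (α z - ρ) * (z.im * |fderiv ℝ α z e|) + 2 * ρ ^ 2 * |e.im| := by field_simp
      _ ≤ (α z - ρ) * (21 * α z ^ 2) + 2 * ρ ^ 2 * 1 := by
          have : 0 ≤ α z - ρ := by linarith
          gcongr
      _ ≤ _ := by nlinarith
  have hlin : (fderiv ℝ β z v * conj (β z)).im = (v * conj e).re * (fderiv ℝ β z e * conj (β z)).im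
      + (v * conj e).im * (fderiv ℝ β z (Complex.I * e) * conj (β z)).im := by
    have h1 : v = (v * conj e).re • e + (v * conj e).im • (Complex.I * e) := by
      have h2 : e * conj e = 1 := by rw [Complex.mul_conj, Complex.normSq_eq_norm_sq, he]; simp
      have h3 := Complex.re_add_im (v * conj e)
      simp only [Complex.real_smul]
      linear_combination -v * h2 - e * h3
    conv_lhs => rw [h1, map_add, map_smul, map_smul, add_mul, Complex.add_im, smul_mul_assoc,
      smul_mul_assoc, Complex.smul_im, Complex.smul_im, smul_eq_mul, smul_eq_mul]
  have h3 := Complex.abs_re_le_norm (v * conj e)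
  have h4 := Complex.abs_im_le_norm (v * conj e)
  rw [norm_mul_conj_eq he] at h3 h4
  rw [hlin]
  calc _ ≤ z.im * (|(v * conj e).re| * |(fderiv ℝ β z e * conj (β z)).im|
        + |(v * conj e).im| * |(fderiv ℝ β z (Complex.I * e) * conj (β z)).im|) := by
        refine mul_le_mul_of_nonneg_left ?_ hy.le
        rw [← abs_mul, ← abs_mul]; exact abs_add_le _ _
    _ = |(v * conj e).re| * (z.im * |(fderiv ℝ β z e * conj (β z)).im|)
        + |(v * conj e).im| * (z.im * |(fderiv ℝ β z (Complex.I * e) * conj (β z)).im|) := by ring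
    _ ≤ ‖v‖ * (60 * ρ ^ 2) + ‖v‖ * (40 * ρ ^ 2) :=
        add_le_add (mul_le_mul h3 b1 (by positivity) (norm_nonneg _))
          (mul_le_mul h4 b2 (by positivity) (norm_nonneg _))
    _ = _ := by ring

/-- The derivative of the direction `β / ‖β‖`. -/
theorem norm_fderiv_direction_le (h : IsCodazziPair α β) (hz : z ∈ Hset) (hβ1 : 1 ≤ ‖β z‖) :
    DifferentiableAt ℝ (fun z => β z / ‖β z‖) z ∧
      ∀ v, z.im * ‖fderiv ℝ (fun z => β z / ‖β z‖) z v‖ ≤ 100 * ‖v‖ := by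
  have hβ0 : β z ≠ 0 := norm_pos_iff.1 (by linarith)
  have hρ0 : ‖β z‖ ≠ 0 := norm_ne_zero_iff.2 hβ0
  have dβ := h.differentiableAt_β hz
  have dρ : DifferentiableAt ℝ (fun z => ‖β z‖) z := dβ.norm ℝ hβ0
  have dρi : DifferentiableAt ℝ (fun z => ((‖β z‖⁻¹ : ℝ) : ℂ)) z :=
    Complex.ofRealCLM.differentiableAt.comp z (dρ.inv hρ0)
  have heq : (fun z => β z / ‖β z‖) = fun z => β z * ((‖β z‖⁻¹ : ℝ) : ℂ) := by
    ext w; push_cast; rw [div_eq_mul_inv]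
  refine ⟨by rw [heq]; exact dβ.mul dρi, fun v => ?_⟩
  have hd : fderiv ℝ (fun z => β z / ‖β z‖) z v
      = β z * ((fderiv ℝ β z v * conj (β z)).im / ‖β z‖ ^ 3 : ℝ) * Complex.I := by
    have e1 : fderiv ℝ (fun z => β z / ‖β z‖) z v
        = dirDeriv (fun _ => v) (fun z => β z * ((‖β z‖⁻¹ : ℝ) : ℂ)) z := by rw [heq]; rfl
    have d3 := (hasDerivAt_inv hρ0).ofReal_comp
    rw [e1, dirDeriv_mul dβ dρi, dirDeriv_comp (f := fun z => ‖β z‖)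
      (h := fun t : ℝ => ((t⁻¹ : ℝ) : ℂ)) d3 dρ]
    simp only [dirDeriv, Complex.real_smul]
    have r := h.re_fderiv_mul_conj hz v
    rw [← h.dirDeriv_norm hz hβ0 v] at r
    have hri := Complex.re_add_im (fderiv ℝ β z v * conj (β z))
    rw [r] at hri
    have hbb : β z * conj (β z) = (‖β z‖ : ℂ) ^ 2 := by
      rw [Complex.mul_conj, Complex.normSq_eq_norm_sq]; push_cast; rfl
    have hρ0' : (‖β z‖ : ℂ) ≠ 0 := by exact_mod_cast hρ0
    push_cast at hri ⊢
    field_simp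
    linear_combination -fderiv ℝ β z v * hbb - β z * hri
  rw [hd, norm_mul, norm_mul, Complex.norm_I, mul_one, Complex.norm_real, Real.norm_eq_abs, abs_div,
    abs_of_nonneg (show 0 ≤ ‖β z‖ ^ 3 by positivity)]
  have := h.im_mul_rotation_le hz hβ1 v
  have e : z.im * (‖β z‖ * (|(fderiv ℝ β z v * conj (β z)).im| / ‖β z‖ ^ 3))
      = (z.im * |(fderiv ℝ β z v * conj (β z)).im|) / ‖β z‖ ^ 2 := by field_simp
  rw [e, div_le_iff₀ (by positivity)]
  linarith

end IsCodazziPair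

/-! ### The complex form of a minimal Lagrangian map -/

/-- The complex-linear part of a real-linear endomorphism of `ℂ`. -/
def linPart (D : ℂ →L[ℝ] ℂ) : ℂ := (D 1 - Complex.I * D Complex.I) / 2

/-- The complex-antilinear part of a real-linear endomorphism of `ℂ`. -/
def antiPart (D : ℂ →L[ℝ] ℂ) : ℂ := (D 1 + Complex.I * D Complex.I) / 2

theorem apply_eq_linPart (D : ℂ →L[ℝ] ℂ) (v : ℂ) :
    D v = linPart D * v + antiPart D * conj v := by
  have hv : v = v.re • (1 : ℂ) + v.im • Complex.I := by
    simp [Complex.re_add_im]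
  have hD : D v = v.re * D 1 + v.im * D Complex.I := by
    conv_lhs => rw [hv]
    rw [map_add, map_smul, map_smul, Complex.real_smul, Complex.real_smul]
  rw [hD]
  conv_rhs => rw [hv]
  simp only [linPart, antiPart, Complex.real_smul, map_add, map_mul, Complex.conj_ofReal,
    Complex.conj_I, map_one]
  linear_combination ((v.im : ℂ) * D Complex.I) * Complex.I_sq

theorem exists_real_form {B : ℂ →L[ℝ] ℂ} (hsa : ∀ v w : ℂ, rinner (B v) w = rinner v (B w))
    (hdet : LinearMap.det (B : ℂ →ₗ[ℝ] ℂ) = 1) :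
    ∃ (s : ℝ) (t : ℂ), (∀ v, B v = s * v + t * conj v) ∧ s ^ 2 = 1 + ‖t‖ ^ 2 := by
  have h1 := hsa 1 Complex.I
  simp [rinner] at h1
  have hl : linPart B = ((linPart B).re : ℂ) := by
    apply Complex.ext
    · simp
    · simp [linPart, h1]
  refine ⟨(linPart B).re, antiPart B, fun v => by rw [← hl]; exact apply_eq_linPart B v, ?_⟩
  rw [← LinearMap.det_toMatrix Complex.basisOneI, Matrix.det_fin_two] at hdet
  simp [LinearMap.toMatrix_apply] at hdet
  rw [← Complex.normSq_eq_norm_sq, Complex.normSq_apply]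
  simp [linPart, antiPart]
  linear_combination hdet - (1/4) * ((B 1).im - (B Complex.I).re) * h1

theorem pullback_form {P Q t : ℂ} {s k : ℝ}
    (h : ∀ v w : ℂ, rinner (P * v + Q * conj v) (P * w + Q * conj w)
      = k ^ 2 * rinner (s * v + t * conj v) (s * w + t * conj w)) :
    P * conj Q = k ^ 2 * (s * conj t) ∧ ‖P‖ ^ 2 + ‖Q‖ ^ 2 = k ^ 2 * (s ^ 2 + ‖t‖ ^ 2) := by
  have h1 := h 1 1
  have h2 := h Complex.I Complex.I
  have h3 := h 1 Complex.I
  simp [rinner] at h1 h2 h3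
  refine ⟨?_, ?_⟩
  · apply Complex.ext
    · simp [← Complex.ofReal_pow]; linarith
    · simp [← Complex.ofReal_pow]; linarith
  · simp only [← Complex.normSq_eq_norm_sq, Complex.normSq_apply]; linarith

/-- The differential-geometric content of `IsMinimalLagrangian`, with the operator field `b`. -/
structure IsMLWith (Φ : ℂ → ℂ) (b : ℂ → ℂ →L[ℝ] ℂ) : Prop where
  smooth : ContDiffOn ℝ (⊤ : ℕ∞) Φ Hset
  mapsTo : MapsTo Φ Hset Hset
  selfAdjoint : ∀ z ∈ Hset, ∀ v w : ℂ, rinner (b z v) w = rinner v (b z w)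
  det : ∀ z ∈ Hset, LinearMap.det ((b z : ℂ →L[ℝ] ℂ) : ℂ →ₗ[ℝ] ℂ) = 1
  metric : ∀ z ∈ Hset, ∀ v w : ℂ,
    rinner (fderiv ℝ Φ z v) (fderiv ℝ Φ z w) / (Φ z).im ^ 2 = rinner (b z v) (b z w) / z.im ^ 2
  codazzi : ∀ z ∈ Hset, ∀ v w : ℂ,
    fderiv ℝ (fun u => b u w) z v + Gamma z v (b z w) - b z (Gamma z v w)
      = fderiv ℝ (fun u => b u v) z w + Gamma z w (b z v) - b z (Gamma z w v)

/-- The map `Φ` has differential `v ↦ a (α v + β conj v)` with `(α, β)` a Codazzi pair and `a`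
the (rescaled) parallel rotation it induces. -/
structure IsMLFrame (Φ a : ℂ → ℂ) (α : ℂ → ℝ) (β : ℂ → ℂ) : Prop extends IsCodazziPair α β where
  smooth_Φ : ContDiffOn ℝ (⊤ : ℕ∞) Φ Hset
  mapsTo : MapsTo Φ Hset Hset
  smooth_a : ContDiffOn ℝ (⊤ : ℕ∞) a Hset
  norm_a : ∀ z ∈ Hset, ‖a z‖ * z.im = (Φ z).im
  fderiv_Φ : ∀ z ∈ Hset, ∀ v, fderiv ℝ Φ z v = a z * (α z * v + β z * conj v)
  fderiv_a : ∀ z ∈ Hset, ∀ v, fderiv ℝ a z v = a z * (Complex.I * v / z.im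
    - Complex.I * a z * (α z * v + β z * conj v) / (Φ z).im)

/-- The Jacobian determinant of `Φ`. -/
def jacobian (Φ : ℂ → ℂ) (z : ℂ) : ℝ :=
  ‖linPart (fderiv ℝ Φ z)‖ ^ 2 - ‖antiPart (fderiv ℝ Φ z)‖ ^ 2

theorem smooth_linPart {Φ : ℂ → ℂ} (h : ContDiffOn ℝ (⊤ : ℕ∞) Φ Hset) :
    ContDiffOn ℝ (⊤ : ℕ∞) (fun z => linPart (fderiv ℝ Φ z)) Hset := by
  have h1 := dirDeriv_smooth isOpen_Hset (contDiffOn_const (c := (1 : ℂ))) h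
  have h2 := dirDeriv_smooth isOpen_Hset (contDiffOn_const (c := Complex.I)) h
  exact (h1.sub (contDiffOn_const.mul h2)).div_const 2

theorem smooth_antiPart {Φ : ℂ → ℂ} (h : ContDiffOn ℝ (⊤ : ℕ∞) Φ Hset) :
    ContDiffOn ℝ (⊤ : ℕ∞) (fun z => antiPart (fderiv ℝ Φ z)) Hset := by
  have h1 := dirDeriv_smooth isOpen_Hset (contDiffOn_const (c := (1 : ℂ))) h
  have h2 := dirDeriv_smooth isOpen_Hset (contDiffOn_const (c := Complex.I)) h
  exact (h1.add (contDiffOn_const.mul h2)).div_const 2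

namespace IsMLWith

variable {Φ : ℂ → ℂ} {b : ℂ → ℂ →L[ℝ] ℂ} {z : ℂ}

theorem exists_form (h : IsMLWith Φ b) (hz : z ∈ Hset) :
    ∃ (s : ℝ) (t : ℂ), (∀ v, b z v = s * v + t * conj v) ∧ s ^ 2 = 1 + ‖t‖ ^ 2 ∧
      linPart (fderiv ℝ Φ z) * conj (antiPart (fderiv ℝ Φ z))
        = (((Φ z).im / z.im : ℝ) : ℂ) ^ 2 * (s * conj t) ∧
      ‖linPart (fderiv ℝ Φ z)‖ ^ 2 + ‖antiPart (fderiv ℝ Φ z)‖ ^ 2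
        = ((Φ z).im / z.im) ^ 2 * (s ^ 2 + ‖t‖ ^ 2) := by
  obtain ⟨s, t, hb, hd⟩ := exists_real_form (h.selfAdjoint z hz) (h.det z hz)
  have hy : 0 < z.im := hz
  have hY : 0 < (Φ z).im := h.mapsTo hz
  refine ⟨s, t, hb, hd, pullback_form fun v w => ?_⟩
  have := h.metric z hz v w
  rw [← apply_eq_linPart, ← apply_eq_linPart, ← hb, ← hb]
  field_simp at this ⊢
  linarith

theorem jacobian_sq (h : IsMLWith Φ b) (hz : z ∈ Hset) :
    jacobian Φ z ^ 2 = ((Φ z).im / z.im) ^ 4 := by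
  obtain ⟨s, t, -, hd, h1, h2⟩ := h.exists_form hz
  have h3 := congrArg (fun c => ‖c‖ ^ 2) h1
  simp only [norm_mul, norm_pow, Complex.norm_real, Complex.norm_conj, norm_eq_abs, mul_pow,
    sq_abs] at h3
  set k := (Φ z).im / z.im
  set A := ‖linPart (fderiv ℝ Φ z)‖ ^ 2
  set B := ‖antiPart (fderiv ℝ Φ z)‖ ^ 2
  simp only [jacobian]
  linear_combination (A + B + k ^ 2 * (s ^ 2 + ‖t‖ ^ 2)) * h2 - 4 * h3
    + k ^ 4 * (s ^ 2 - ‖t‖ ^ 2 + 1) * hd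

theorem continuousOn_jacobian (h : IsMLWith Φ b) : ContinuousOn (jacobian Φ) Hset :=
  ((smooth_linPart h.smooth).continuousOn.norm.pow 2).sub
    ((smooth_antiPart h.smooth).continuousOn.norm.pow 2)

theorem jacobian_sign (h : IsMLWith Φ b) :
    (∀ z ∈ Hset, 0 < jacobian Φ z) ∨ (∀ z ∈ Hset, jacobian Φ z < 0) := by
  have hne : ∀ z ∈ Hset, jacobian Φ z ≠ 0 := by
    intro z hz h0
    have := h.jacobian_sq hz
    rw [h0] at this
    have hk : 0 < (Φ z).im / z.im := div_pos (h.mapsTo hz) hz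
    have := pow_pos hk 4
    simp at *
    linarith
  have hconn : IsPreconnected Hset := (convex_halfSpace_im_gt 0).isPreconnected
  by_contra hcon
  push Not at hcon
  obtain ⟨⟨z, hz, hz'⟩, ⟨w, hw, hw'⟩⟩ := hcon
  obtain ⟨u, hu, hu'⟩ := hconn.intermediate_value hz hw h.continuousOn_jacobian ⟨hz', hw'⟩
  exact hne u hu hu'

theorem jacobian_eq (h : IsMLWith Φ b) (hpos : ∀ z ∈ Hset, 0 < jacobian Φ z) (hz : z ∈ Hset) :
    jacobian Φ z = ((Φ z).im / z.im) ^ 2 := by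
  have h1 := h.jacobian_sq hz
  have h2 := hpos z hz
  have : jacobian Φ z ^ 2 = (((Φ z).im / z.im) ^ 2) ^ 2 := by rw [h1]; ring
  exact (pow_left_inj₀ h2.le (sq_nonneg _) two_ne_zero).1 this

theorem neg_conj (h : IsMLWith Φ b) : IsMLWith (fun z => -conj (Φ z)) b ∧
    ∀ z ∈ Hset, jacobian (fun z => -conj (Φ z)) z = - jacobian Φ z := by
  have hL : (fun z => -conj (Φ z)) = (-(Complex.conjCLE : ℂ →L[ℝ] ℂ)) ∘ Φ := by
    funext z; simp
  have hd : ∀ z ∈ Hset, ∀ v, fderiv ℝ (fun z => -conj (Φ z)) z v = -conj (fderiv ℝ Φ z v) := by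
    intro z hz v
    have := ((-(Complex.conjCLE : ℂ →L[ℝ] ℂ)).hasFDerivAt.comp z
      (differentiableAt_of_smooth isOpen_Hset h.smooth hz).hasFDerivAt).fderiv
    rw [hL, this]
    simp
  refine ⟨⟨?_, fun z hz => by simpa [Hset] using h.mapsTo hz, h.selfAdjoint, h.det, ?_,
    h.codazzi⟩, fun z hz => ?_⟩
  · rw [hL]
    exact (ContinuousLinearMap.contDiff _).comp_contDiffOn h.smooth
  · intro z hz v w
    rw [← h.metric z hz v w, hd z hz, hd z hz]
    simp [rinner]
  · simp only [jacobian, linPart, antiPart, hd z hz, ← Complex.normSq_eq_norm_sq,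
      Complex.normSq_apply]
    simp
    ring

end IsMLWith

namespace IsMLWith

variable {Φ : ℂ → ℂ} {b : ℂ → ℂ →L[ℝ] ℂ} {z : ℂ}

theorem exists_smooth_form (h : IsMLWith Φ b) (hpos : ∀ z ∈ Hset, 0 < jacobian Φ z) :
    ∃ (a : ℂ → ℂ) (α : ℂ → ℝ) (β : ℂ → ℂ), ContDiffOn ℝ (⊤ : ℕ∞) a Hset ∧
      ContDiffOn ℝ (⊤ : ℕ∞) α Hset ∧ ContDiffOn ℝ (⊤ : ℕ∞) β Hset ∧
      ∀ z ∈ Hset, 0 < α z ∧ α z ^ 2 = 1 + ‖β z‖ ^ 2 ∧ ‖a z‖ * z.im = (Φ z).im ∧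
        (∀ v, fderiv ℝ Φ z v = a z * (α z * v + β z * conj v)) ∧
        ((∀ v, b z v = α z * v + β z * conj v) ∨ (∀ v, b z v = -(α z * v + β z * conj v))) := by
  set P : ℂ → ℂ := fun z => linPart (fderiv ℝ Φ z) with hP
  set Q : ℂ → ℂ := fun z => antiPart (fderiv ℝ Φ z) with hQ
  have hPs : ContDiffOn ℝ (⊤ : ℕ∞) P Hset := smooth_linPart h.smooth
  have hQs : ContDiffOn ℝ (⊤ : ℕ∞) Q Hset := smooth_antiPart h.smooth
  have him : ContDiffOn ℝ (⊤ : ℕ∞) (fun z : ℂ => z.im) Hset := Complex.imCLM.contDiff.contDiffOn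
  have hΦim : ContDiffOn ℝ (⊤ : ℕ∞) (fun z : ℂ => (Φ z).im) Hset :=
    Complex.imCLM.contDiff.comp_contDiffOn h.smooth
  have hY : ∀ z ∈ Hset, 0 < (Φ z).im := fun z hz => h.mapsTo hz
  have hP0 : ∀ z ∈ Hset, P z ≠ 0 := by
    intro z hz h0
    have := hpos z hz
    simp only [hP] at h0
    simp only [jacobian, h0] at this
    simp at this
    linarith [sq_nonneg ‖antiPart (fderiv ℝ Φ z)‖]
  set α : ℂ → ℝ := fun z => ‖P z‖ * z.im / (Φ z).im with hα
  have hαpos : ∀ z ∈ Hset, 0 < α z := fun z hz =>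
    div_pos (mul_pos (norm_pos_iff.2 (hP0 z hz)) hz) (hY z hz)
  have hαs : ContDiffOn ℝ (⊤ : ℕ∞) α Hset :=
    ((hPs.norm ℝ hP0).mul him).div hΦim fun z hz => (hY z hz).ne'
  set a : ℂ → ℂ := fun z => P z / α z with ha
  have hα0 : ∀ z ∈ Hset, (α z : ℂ) ≠ 0 := fun z hz => by exact_mod_cast (hαpos z hz).ne'
  have has : ContDiffOn ℝ (⊤ : ℕ∞) a Hset := by
    have := hPs.mul ((Complex.ofRealCLM.contDiff.comp_contDiffOn hαs).inv hα0)
    simp only [ha, div_eq_mul_inv]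
    exact this
  have ha0 : ∀ z ∈ Hset, a z ≠ 0 := fun z hz => div_ne_zero (hP0 z hz) (hα0 z hz)
  refine ⟨a, α, fun z => Q z / a z, has, hαs, by
    simp only [div_eq_mul_inv]
    exact hQs.mul (has.inv ha0), fun z hz => ?_⟩
  obtain ⟨s, t, hb, hd, h1, h2⟩ := h.exists_form hz
  have h3 := h.jacobian_eq hpos hz
  have hy : 0 < z.im := hz
  have hYz := hY z hz
  have hk : 0 < (Φ z).im / z.im := div_pos hYz hy
  have hαk : α z * ((Φ z).im / z.im) = ‖P z‖ := by simp only [hα]; field_simp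
  have haα : a z * α z = P z := by simp only [ha]; field_simp [hα0 z hz]
  have hna : ‖a z‖ = (Φ z).im / z.im := by
    have := congrArg norm haα
    rw [norm_mul, Complex.norm_real, norm_eq_abs, abs_of_pos (hαpos z hz), ← hαk] at this
    have h' : (‖a z‖ - (Φ z).im / z.im) * α z = 0 := by linear_combination this
    rcases mul_eq_zero.1 h' with h'' | h''
    · linarith
    · exact absurd h'' (hαpos z hz).ne'
  simp only [jacobian] at h3
  change ‖P z‖ ^ 2 - ‖Q z‖ ^ 2 = _ at h3
  change ‖P z‖ ^ 2 + ‖Q z‖ ^ 2 = _ at h2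
  change P z * conj (Q z) = _ at h1
  set k := (Φ z).im / z.im
  have hsq : α z ^ 2 = s ^ 2 := by
    have : k ^ 2 * (α z ^ 2 - s ^ 2) = 0 := by
      rw [← hαk] at h2 h3
      linear_combination (1/2) * h2 + (1/2) * h3 - k ^ 2 / 2 * hd
    rcases mul_eq_zero.1 this with h' | h'
    · exact absurd h' (pow_pos hk 2).ne'
    · linarith
  obtain ⟨β, hβ⟩ : ∃ β, β = Q z / a z := ⟨_, rfl⟩
  have hQβ : Q z = a z * β := by rw [hβ]; field_simp [ha0 z hz]
  have hβt : (α z : ℂ) * β = s * t := by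
    have h4 : (k : ℂ) ^ 2 * (α z * conj β - s * conj t) = 0 := by
      have h5 : a z * conj (a z) = (k : ℂ) ^ 2 := by
        rw [Complex.mul_conj, Complex.normSq_eq_norm_sq, hna]; push_cast; rfl
      rw [← haα, hQβ, map_mul] at h1
      linear_combination h1 - α z * conj β * h5
    have hk0 : (k : ℂ) ^ 2 ≠ 0 := by exact_mod_cast (pow_pos hk 2).ne'
    have h5 := (mul_eq_zero.1 h4).resolve_left hk0
    have h6 := congrArg conj h5
    simp at h6
    linear_combination h6
  have hst : (s = α z ∧ t = β) ∨ (s = -α z ∧ t = -β) := by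
    rcases sq_eq_sq_iff_eq_or_eq_neg.1 hsq with h' | h'
    · left
      refine ⟨h'.symm, ?_⟩
      rw [← h'] at hβt
      exact (mul_left_cancel₀ (hα0 z hz) hβt).symm
    · right
      have hs : s = -α z := by linarith
      refine ⟨hs, ?_⟩
      rw [hs] at hβt
      refine mul_left_cancel₀ (hα0 z hz) ?_
      push_cast at hβt
      linear_combination hβt
  simp only [← hβ]
  refine ⟨hαpos z hz, ?_, by rw [hna]; simp only [k]; field_simp, fun v => ?_, ?_⟩
  · rcases hst with ⟨h', h''⟩ | ⟨h', h''⟩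
    · rw [hsq, hd, h'']
    · rw [hsq, hd, h'', norm_neg]
  · rw [apply_eq_linPart]
    change P z * v + Q z * conj v = _
    rw [hQβ, ← haα]
    ring
  · rcases hst with ⟨h', h''⟩ | ⟨h', h''⟩
    · left; intro v; rw [hb, h', h'']
    · right; intro v; rw [hb, h', h'']; push_cast; ring

end IsMLWith

/-- The defect in the Codazzi equation for the operator field `v ↦ α v + β conj v`. -/
def codazziDefect (α : ℂ → ℝ) (β : ℂ → ℂ) (v w z : ℂ) : ℂ :=
  ((fderiv ℝ α z v : ℂ) * w + fderiv ℝ β z v * conj w + Complex.I / z.im * β z * v * conj w)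
    - ((fderiv ℝ α z w : ℂ) * v + fderiv ℝ β z w * conj v + Complex.I / z.im * β z * w * conj v)

theorem continuousOn_codazziDefect {α : ℂ → ℝ} {β : ℂ → ℂ}
    (hα : ContDiffOn ℝ (⊤ : ℕ∞) α Hset) (hβ : ContDiffOn ℝ (⊤ : ℕ∞) β Hset) (v w : ℂ) :
    ContinuousOn (codazziDefect α β v w) Hset := by
  have h1 : ∀ v, ContinuousOn (fun z => ((fderiv ℝ α z v : ℝ) : ℂ)) Hset := fun v =>
    Complex.continuous_ofReal.comp_continuousOn
      (dirDeriv_smooth isOpen_Hset (contDiffOn_const (c := v)) hα).continuousOn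
  have h2 : ∀ v, ContinuousOn (fun z => fderiv ℝ β z v) Hset := fun v =>
    (dirDeriv_smooth isOpen_Hset (contDiffOn_const (c := v)) hβ).continuousOn
  have h3 : ContinuousOn (fun z : ℂ => Complex.I / z.im * β z) Hset := by
    refine ContinuousOn.mul (ContinuousOn.div continuousOn_const
      (Complex.continuous_ofReal.comp Complex.continuous_im).continuousOn ?_) hβ.continuousOn
    intro z hz
    exact_mod_cast (show (0:ℝ) < z.im from hz).ne'
  have h4 : ∀ v w : ℂ, ContinuousOn (fun z : ℂ => ((fderiv ℝ α z v : ℝ) : ℂ) * w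
      + fderiv ℝ β z v * conj w + Complex.I / z.im * β z * v * conj w) Hset := fun v w =>
    (((h1 v).mul continuousOn_const).add ((h2 v).mul continuousOn_const)).add
      ((h3.mul continuousOn_const).mul continuousOn_const)
  exact (h4 v w).sub (h4 w v)

theorem hasFDerivAt_form {α : ℂ → ℝ} {β : ℂ → ℂ} {z : ℂ} (hα : DifferentiableAt ℝ α z)
    (hβ : DifferentiableAt ℝ β z) (w v : ℂ) :
    DifferentiableAt ℝ (fun u => (α u : ℂ) * w + β u * conj w) z ∧
    fderiv ℝ (fun u => (α u : ℂ) * w + β u * conj w) z v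
      = (fderiv ℝ α z v : ℂ) * w + fderiv ℝ β z v * conj w := by
  have h1 : HasFDerivAt (fun u => (α u : ℂ)) (Complex.ofRealCLM.comp (fderiv ℝ α z)) z :=
    Complex.ofRealCLM.hasFDerivAt.comp z hα.hasFDerivAt
  have h2 := (h1.mul_const' w).add (hβ.hasFDerivAt.mul_const' (conj w))
  refine ⟨h2.differentiableAt, ?_⟩
  have := h2.fderiv
  change fderiv ℝ (fun u => (α u : ℂ) * w + β u * conj w) z = _ at this
  rw [this]
  simp
  ring

/-- A positive form `v ↦ α v + β conj v` of determinant one is injective. -/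
theorem form_ne_zero {s : ℝ} {t : ℂ} (hs : 0 < s) (hd : s ^ 2 = 1 + ‖t‖ ^ 2) {w : ℂ}
    (hw : w ≠ 0) : (s : ℂ) * w + t * conj w ≠ 0 := by
  intro h0
  have h1 : (s : ℂ) * w = -(t * conj w) := by linear_combination h0
  have h2 := congrArg norm h1
  rw [norm_neg, norm_mul, norm_mul, Complex.norm_conj, Complex.norm_real, norm_eq_abs,
    abs_of_pos hs] at h2
  have h3 := mul_right_cancel₀ (norm_ne_zero_iff.2 hw) h2
  rw [h3] at hd
  linarith

theorem rinner_self (v : ℂ) : rinner v v = ‖v‖ ^ 2 := by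
  rw [← Complex.normSq_eq_norm_sq, Complex.normSq_apply]; rfl

theorem rinner_neg_left (v w : ℂ) : rinner (-v) w = -rinner v w := by simp [rinner]; ring

/-- A field which agrees up to sign with a continuous nonvanishing field, and is continuous at a
point, agrees with it near that point up to a fixed sign. -/
theorem eventually_sign_of_continuousAt {N : Set ℂ} {f g : ℂ → ℂ} {z : ℂ} (hN : N ∈ 𝓝 z)
    (hf : ContinuousAt f z) (hg : ContinuousAt g z) (hg0 : g z ≠ 0)
    (h : ∀ u ∈ N, f u = g u ∨ f u = -g u) :
    (∀ᶠ u in 𝓝 z, f u = g u) ∨ (∀ᶠ u in 𝓝 z, f u = -g u) := by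
  have hc : ContinuousAt (fun u => rinner (f u) (g u)) z := by
    unfold rinner
    exact ((Complex.continuous_re.continuousAt.comp hf).mul
      (Complex.continuous_re.continuousAt.comp hg)).add
      ((Complex.continuous_im.continuousAt.comp hf).mul
      (Complex.continuous_im.continuousAt.comp hg))
  have hpos : 0 < rinner (g z) (g z) := by rw [rinner_self]; positivity
  rcases h z (mem_of_mem_nhds hN) with h' | h'
  · left
    have h0 : 0 < rinner (f z) (g z) := by rw [h']; exact hpos
    filter_upwards [hc.eventually (lt_mem_nhds h0), hN] with u hu hu'
    rcases h u hu' with h'' | h''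
    · exact h''
    · rw [h'', rinner_neg_left, rinner_self] at hu
      linarith [sq_nonneg ‖g u‖]
  · right
    have h0 : rinner (f z) (g z) < 0 := by rw [h', rinner_neg_left]; linarith
    filter_upwards [hc.eventually (gt_mem_nhds h0), hN] with u hu hu'
    rcases h u hu' with h'' | h''
    · rw [h'', rinner_self] at hu
      linarith [sq_nonneg ‖g u‖]
    · exact h''

/-- If `b` is a Codazzi field which is pointwise equal to plus or minus a smooth form, then at
points where the form is not itself Codazzi it is the identity. -/
theorem anti_eq_zero_of_codazziDefect_ne {b : ℂ → ℂ →L[ℝ] ℂ} {α : ℂ → ℝ} {β : ℂ → ℂ} {z v w : ℂ}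
    (hz : z ∈ Hset) (hα : ContDiffOn ℝ (⊤ : ℕ∞) α Hset) (hβ : ContDiffOn ℝ (⊤ : ℕ∞) β Hset)
    (hpos : ∀ z ∈ Hset, 0 < α z) (hd : ∀ z ∈ Hset, α z ^ 2 = 1 + ‖β z‖ ^ 2)
    (hcod : ∀ v w : ℂ, fderiv ℝ (fun u => b u w) z v + Gamma z v (b z w) - b z (Gamma z v w)
      = fderiv ℝ (fun u => b u v) z w + Gamma z w (b z v) - b z (Gamma z w v))
    (hb : ∀ z ∈ Hset, (∀ v, b z v = α z * v + β z * conj v) ∨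
      (∀ v, b z v = -(α z * v + β z * conj v)))
    (hne : codazziDefect α β v w z ≠ 0) : β z = 0 := by
  have hN := isOpen_Hset.mem_nhds hz
  have hαz := differentiableAt_of_smooth isOpen_Hset hα hz
  have hβz := differentiableAt_of_smooth isOpen_Hset hβ hz
  have hcod' : ∀ v w : ℂ, fderiv ℝ (fun u => b u w) z v + Gamma z v (b z w)
      = fderiv ℝ (fun u => b u v) z w + Gamma z w (b z v) := by
    intro v w
    have hG : Gamma z v w = Gamma z w v := by simp only [Gamma]; ring
    have := hcod v w
    rw [hG] at this
    linear_combination this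
  by_cases hcase : ∃ w : ℂ, w ≠ 0 ∧ ContinuousAt (fun u => b u w) z
  · exfalso
    obtain ⟨w₀, hw₀, hc⟩ := hcase
    have hform : ∀ w, DifferentiableAt ℝ (fun u => (α u : ℂ) * w + β u * conj w) z :=
      fun w => (hasFDerivAt_form hαz hβz w 0).1
    apply hne
    have hsign := eventually_sign_of_continuousAt hN hc (hform w₀).continuousAt
      (form_ne_zero (hpos z hz) (hd z hz) hw₀)
      (fun u hu => (hb u hu).imp (fun h => h w₀) (fun h => h w₀))
    rcases hsign with hs | hs
    · have hall : ∀ᶠ u in 𝓝 z, ∀ w, b u w = α u * w + β u * conj w := by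
        filter_upwards [hs, hN] with u hu hu'
        rcases hb u hu' with h' | h'
        · exact h'
        · have := h' w₀
          rw [hu] at this
          exact absurd (self_eq_neg.1 this) (form_ne_zero (hpos u hu') (hd u hu') hw₀)
      have hfd : ∀ w v, fderiv ℝ (fun u => b u w) z v
          = (fderiv ℝ α z v : ℂ) * w + fderiv ℝ β z v * conj w := by
        intro w v
        have : (fun u => b u w) =ᶠ[𝓝 z] fun u => (α u : ℂ) * w + β u * conj w :=
          hall.mono fun u hu => hu w
        rw [this.fderiv_eq]
        exact (hasFDerivAt_form hαz hβz w v).2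
      have := hcod' v w
      rw [hfd, hfd, hall.self_of_nhds, hall.self_of_nhds] at this
      simp only [Gamma] at this
      simp only [codazziDefect]
      linear_combination this
    · have hall : ∀ᶠ u in 𝓝 z, ∀ w, b u w = -(α u * w + β u * conj w) := by
        filter_upwards [hs, hN] with u hu hu'
        rcases hb u hu' with h' | h'
        · have := h' w₀
          rw [hu] at this
          exact absurd (neg_eq_self.1 this) (form_ne_zero (hpos u hu') (hd u hu') hw₀)
        · exact h'
      have hfd : ∀ w v, fderiv ℝ (fun u => b u w) z v
          = -((fderiv ℝ α z v : ℂ) * w + fderiv ℝ β z v * conj w) := by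
        intro w v
        have : (fun u => b u w) =ᶠ[𝓝 z] fun u => -((α u : ℂ) * w + β u * conj w) :=
          hall.mono fun u hu => hu w
        rw [this.fderiv_eq, fderiv_fun_neg, neg_apply, (hasFDerivAt_form hαz hβz w v).2]
      have := hcod' v w
      rw [hfd, hfd, hall.self_of_nhds, hall.self_of_nhds] at this
      simp only [Gamma] at this
      simp only [codazziDefect]
      linear_combination -this
  · push Not at hcase
    have h0 : ∀ w : ℂ, w ≠ 0 → fderiv ℝ (fun u => b u w) z = 0 := fun w hw =>
      fderiv_zero_of_not_differentiableAt fun hdiff => hcase w hw hdiff.continuousAt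
    have h1 := hcod' 1 Complex.I
    rw [h0 1 one_ne_zero, h0 Complex.I Complex.I_ne_zero] at h1
    have hy : (z.im : ℂ) ≠ 0 := by exact_mod_cast (show (0:ℝ) < z.im from hz).ne'
    simp only [Gamma, zero_apply, zero_add] at h1
    rcases hb z hz with h' | h'
    · rw [h', h'] at h1
      simp at h1
      field_simp at h1
      simp at h1
      exact neg_eq_self.1 (h1.resolve_right (by exact_mod_cast hy))
    · rw [h', h'] at h1
      simp at h1
      field_simp at h1
      simp at h1
      exact self_eq_neg.1 (h1.resolve_right (by exact_mod_cast hy))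

namespace IsMLWith

variable {Φ : ℂ → ℂ} {b : ℂ → ℂ →L[ℝ] ℂ} {z : ℂ}

theorem exists_frame (h : IsMLWith Φ b) (hpos : ∀ z ∈ Hset, 0 < jacobian Φ z) :
    ∃ (a : ℂ → ℂ) (α : ℂ → ℝ) (β : ℂ → ℂ), IsMLFrame Φ a α β := by
  obtain ⟨a, α, β, ha, hα, hβ, H⟩ := h.exists_smooth_form hpos
  have hpair : IsCodazziPair α β := by
    refine ⟨hα, hβ, fun z hz => (H z hz).1, fun z hz => (H z hz).2.1, fun z hz v w => ?_⟩
    rw [← sub_eq_zero]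
    change codazziDefect α β v w z = 0
    by_contra hne
    have hN : ∀ᶠ u in 𝓝 z, u ∈ Hset ∧ codazziDefect α β v w u ≠ 0 :=
      Filter.Eventually.and (isOpen_Hset.mem_nhds hz)
        (((continuousOn_codazziDefect hα hβ v w).continuousAt
          (isOpen_Hset.mem_nhds hz)).eventually_ne hne)
    have hβ0 : ∀ᶠ u in 𝓝 z, u ∈ Hset ∧ β u = 0 := hN.mono fun u hu =>
      ⟨hu.1, anti_eq_zero_of_codazziDefect_ne hu.1 hα hβ (fun z hz => (H z hz).1)
        (fun z hz => (H z hz).2.1) (h.codazzi u hu.1) (fun z hz => (H z hz).2.2.2.2) hu.2⟩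
    have hβd : fderiv ℝ β z = 0 := by
      have : β =ᶠ[𝓝 z] fun _ => 0 := hβ0.mono fun u hu => hu.2
      rw [this.fderiv_eq]; simp
    have hαd : fderiv ℝ α z = 0 := by
      have : α =ᶠ[𝓝 z] fun _ => 1 := hβ0.mono fun u hu => by
        have h1 := (H u hu.1).2.1
        have h2 := (H u hu.1).1
        rw [hu.2] at h1
        simp at h1
        rcases h1 with h1 | h1 <;> [exact h1; linarith]
      rw [this.fderiv_eq]; simp
    apply hne
    simp [codazziDefect, hβd, hαd, hβ0.self_of_nhds.2]
  refine ⟨a, α, β, hpair, h.smooth, h.mapsTo, ha, fun z hz => (H z hz).2.2.1,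
    fun z hz => (H z hz).2.2.2.1, fun z hz v => ?_⟩
  have hy : 0 < z.im := hz
  have hY : 0 < (Φ z).im := h.mapsTo hz
  have hyc : (z.im : ℂ) ≠ 0 := by exact_mod_cast hy.ne'
  have hYc : ((Φ z).im : ℂ) ≠ 0 := by exact_mod_cast hY.ne'
  have hna : ∀ u ∈ Hset, ‖a u‖ * u.im = (Φ u).im := fun u hu => (H u hu).2.2.1
  have ha0 : a z ≠ 0 := by
    intro h0
    have := hna z hz
    rw [h0] at this
    simp at this
    linarith
  have hdz := differentiableAt_of_smooth isOpen_Hset ha hz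
  have hdα := differentiableAt_of_smooth isOpen_Hset hα hz
  have hdβ := differentiableAt_of_smooth isOpen_Hset hβ hz
  have hdΦ := differentiableAt_of_smooth isOpen_Hset h.smooth hz
  -- symmetry of the second derivative of `Φ`
  have hsecond : ∀ v w, fderiv ℝ (fun u => fderiv ℝ Φ u w) z v
      = fderiv ℝ a z v * (α z * w + β z * conj w)
        + a z * ((fderiv ℝ α z v : ℂ) * w + fderiv ℝ β z v * conj w) := by
    intro v w
    have h1 : (fun u => fderiv ℝ Φ u w) =ᶠ[𝓝 z] fun u => a u * (α u * w + β u * conj w) := by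
      filter_upwards [isOpen_Hset.mem_nhds hz] with u hu
      exact (H u hu).2.2.2.1 w
    have hf := hasFDerivAt_form hdα hdβ w v
    rw [h1.fderiv_eq, fderiv_fun_mul hdz hf.1]
    simp [hf.2]
    ring
  have hsym : ∀ v w, fderiv ℝ (fun u => fderiv ℝ Φ u w) z v
      = fderiv ℝ (fun u => fderiv ℝ Φ u v) z w := fun v w =>
    dirDeriv_comm (V := fun _ => v) (W := fun _ => w) isOpen_Hset hz contDiffOn_const
      contDiffOn_const (by simp [dirDeriv_const]) h.smooth
  set ρ : ℂ → ℂ := fun v => fderiv ℝ a z v / a z - (Complex.I * v / z.im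
    - Complex.I * a z * (α z * v + β z * conj v) / (Φ z).im) with hρ
  have hda : ∀ v, fderiv ℝ a z v = a z * (ρ v + (Complex.I * v / z.im
    - Complex.I * a z * (α z * v + β z * conj v) / (Φ z).im)) := by
    intro v
    simp only [hρ]
    field_simp
    ring
  have hρsym : ρ 1 * (Complex.I * (α z - β z)) = ρ Complex.I * (α z + β z) := by
    have h1 := hsym 1 Complex.I
    rw [hsecond, hsecond, hda, hda] at h1
    have h2 := hpair.codazzi z hz 1 Complex.I
    simp at h1 h2
    have h3 : a z * (ρ 1 * (Complex.I * (α z - β z)) - ρ Complex.I * (α z + β z)) = 0 := by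
      linear_combination h1 - a z * h2
        - a z * (z.im : ℂ)⁻¹ * (α z + β z) * Complex.I_sq
    exact sub_eq_zero.1 ((mul_eq_zero.1 h3).resolve_left ha0)
  have hρre : ∀ v, (ρ v).re = 0 := by
    intro v
    have hre := Complex.reCLM.hasFDerivAt.comp z hdz.hasFDerivAt
    have him := Complex.imCLM.hasFDerivAt.comp z hdz.hasFDerivAt
    have hΦ := Complex.imCLM.hasFDerivAt.comp z hdΦ.hasFDerivAt
    have hid := Complex.imCLM.hasFDerivAt (x := z)
    have h1 := ((hre.mul hre).add (him.mul him)).mul (hid.mul hid)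
    have h2 := hΦ.mul hΦ
    have hsq : ∀ u ∈ Hset, ((a u).re * (a u).re + (a u).im * (a u).im) * (u.im * u.im)
        = (Φ u).im * (Φ u).im := by
      intro u hu
      rw [← hna u hu, ← Complex.normSq_apply, Complex.normSq_eq_norm_sq]
      ring
    have h3 := h1.congr_of_eventuallyEq (f₁ := fun u => (Φ u).im * (Φ u).im) (by
      filter_upwards [isOpen_Hset.mem_nhds hz] with u hu
      exact (hsq u hu).symm)
    have h4 := congrArg (fun L => L v) (h3.unique h2)
    have h5 := hda v
    rw [mul_assoc, ← (H z hz).2.2.2.1 v] at h5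
    have h6 := hsq z hz
    simp [h5] at h4
    have e1 : v.im / z.im * z.im = v.im := div_mul_cancel₀ _ hy.ne'
    have e2 : (fderiv ℝ Φ z v).im / (Φ z).im * (Φ z).im = (fderiv ℝ Φ z v).im :=
      div_mul_cancel₀ _ hY.ne'
    have h7 : ((Φ z).im * (Φ z).im) * (ρ v).re = 0 := by
      rw [← h6]
      linear_combination (1/2) * h4
        + ((a z).re * (a z).re + (a z).im * (a z).im) * z.im * e1
        - (fderiv ℝ Φ z v).im / (Φ z).im * h6 - (Φ z).im * e2
    exact (mul_eq_zero.1 h7).resolve_left (mul_pos hY hY).ne'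
  have hρ0 : ρ 1 = 0 ∧ ρ Complex.I = 0 := by
    have h1 := hρre 1
    have h2 := hρre Complex.I
    have h3 := congrArg Complex.re hρsym
    have h4 := congrArg Complex.im hρsym
    have hd := hpair.det z hz
    rw [← Complex.normSq_eq_norm_sq, Complex.normSq_apply] at hd
    simp [h1, h2] at h3 h4
    constructor
    · apply Complex.ext
      · simpa using h1
      · simp
        linear_combination (-(ρ 1).im) * hd + (α z + (β z).re) * h3 - (β z).im * h4
    · apply Complex.ext
      · simpa using h2
      · simp
        linear_combination (-(ρ Complex.I).im) * hd - (α z - (β z).re) * h4 + (β z).im * h3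
  have hρv : ρ v = 0 := by
    have hv : v = v.re • (1 : ℂ) + v.im • Complex.I := by simp [Complex.re_add_im]
    have hlin : ρ v = v.re * ρ 1 + v.im * ρ Complex.I := by
      have hd : fderiv ℝ a z v = v.re * fderiv ℝ a z 1 + v.im * fderiv ℝ a z Complex.I := by
        conv_lhs => rw [hv]
        rw [map_add, map_smul, map_smul, Complex.real_smul, Complex.real_smul]
      have hv' : v = v.re + v.im * Complex.I := by simp [Complex.re_add_im]
      have hc : conj v = v.re - v.im * Complex.I := by
        apply Complex.ext <;> simp
      simp only [hρ, hd, hc, map_one, Complex.conj_I]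
      linear_combination (-Complex.I / z.im + Complex.I * a z * α z / (Φ z).im) * hv'
    rw [hlin, hρ0.1, hρ0.2]; simp
  rw [hda, hρv, zero_add]

end IsMLWith

/-! ### The sector condition at the boundary -/

/-- The algebra behind the derivative of the sector function along a geodesic. -/
theorem sector_derivative_algebra {κ K c C a y Y q r α β W : ℂ} (ha : a ≠ 0) (hC0 : C ≠ 0)
    (hy : y ≠ 0) (hY : Y ≠ 0) (hK : K = κ + 2 * Complex.I * q * Y)
    (hC : c = C + 2 * Complex.I * r * y) (hW : W = a * (Complex.I * (α * C ^ 2 - β * c ^ 2))) :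
    -(((2 * κ * (-q * W)) * c + κ ^ 2 * (Complex.I * r * c ^ 2)) * (a * C * y)
      - κ ^ 2 * c * ((a * (-C ^ 2 / y - Complex.I * W / Y) * C + a * (-Complex.I * r * C ^ 2)) * y
        + a * C * ((c ^ 2 + C ^ 2) / 2))) / (a * C * y) ^ 2
      = κ * K / (y * Y) * (α * (c * C) - β * c ^ 3 / C) := by
  have h1 : -(((2 * κ * (-q * W)) * c + κ ^ 2 * (Complex.I * r * c ^ 2)) * (a * C * y)
      - κ ^ 2 * c * ((a * (-C ^ 2 / y - Complex.I * W / Y) * C + a * (-Complex.I * r * C ^ 2)) * y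
        + a * C * ((c ^ 2 + C ^ 2) / 2))) / (a * C * y) ^ 2
      = -(κ * c * W * Complex.I * K) / (a * C * y * Y) := by
    rw [hK]
    field_simp
    rw [hC]
    linear_combination (4 * κ * C * y * q * W * Y + 8 * κ * Complex.I * r * y ^ 2 * q * W * Y) * Complex.I_sq
  rw [h1, hW]
  field_simp
  linear_combination (-κ * c * K * (α * C ^ 2 - β * c ^ 2)) * Complex.I_sq

/-- Evaluation of the linear form `(p, q)` at a point of the plane. -/
def lform (p q : ℝ) (u : ℂ) : ℂ := p - q * u

/-- The function of `z` whose real part is monotone along the geodesics ending at the boundary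
point `[r₀ : r₁]`. -/
def sectorFun (Φ a : ℂ → ℂ) (r₀ r₁ p q : ℝ) (z : ℂ) : ℂ :=
  -(lform p q (Φ z) ^ 2 * lform r₀ r₁ (conj z)) / (a z * lform r₀ r₁ z * z.im)

namespace IsMLFrame

variable {Φ a : ℂ → ℂ} {α : ℂ → ℝ} {β : ℂ → ℂ} {z : ℂ}

theorem a_ne_zero (h : IsMLFrame Φ a α β) (hz : z ∈ Hset) : a z ≠ 0 := by
  intro h0
  have h1 := h.norm_a z hz
  have h2 : 0 < (Φ z).im := h.mapsTo hz
  rw [h0] at h1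
  simp at h1
  linarith

theorem hasDerivAt_sectorFun (h : IsMLFrame Φ a α β) {ζ : ℝ → ℂ} {t r₀ r₁ p q : ℝ}
    (hz : ζ t ∈ Hset) (hc : lform r₀ r₁ (ζ t) ≠ 0)
    (hζ : HasDerivAt ζ (Complex.I * lform r₀ r₁ (ζ t) ^ 2) t) :
    HasDerivAt (fun t => sectorFun Φ a r₀ r₁ p q (ζ t))
      (lform p q (Φ (ζ t)) * conj (lform p q (Φ (ζ t))) / ((ζ t).im * (Φ (ζ t)).im) *
        (α (ζ t) * (lform r₀ r₁ (conj (ζ t)) * lform r₀ r₁ (ζ t))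
          - β (ζ t) * lform r₀ r₁ (conj (ζ t)) ^ 3 / lform r₀ r₁ (ζ t))) t := by
  have hy : ((ζ t).im : ℂ) ≠ 0 := by exact_mod_cast (show (0:ℝ) < (ζ t).im from hz).ne'
  have hY : ((Φ (ζ t)).im : ℂ) ≠ 0 := by
    exact_mod_cast (show (0:ℝ) < (Φ (ζ t)).im from h.mapsTo hz).ne'
  have ha := h.a_ne_zero hz
  have dΦ : HasDerivAt (fun t => Φ (ζ t)) (fderiv ℝ Φ (ζ t) (Complex.I * lform r₀ r₁ (ζ t) ^ 2)) t :=
    (differentiableAt_of_smooth isOpen_Hset h.smooth_Φ hz).hasFDerivAt.comp_hasDerivAt t hζ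
  have da : HasDerivAt (fun t => a (ζ t)) (fderiv ℝ a (ζ t) (Complex.I * lform r₀ r₁ (ζ t) ^ 2)) t :=
    (differentiableAt_of_smooth isOpen_Hset h.smooth_a hz).hasFDerivAt.comp_hasDerivAt t hζ
  have hconj : conj (lform r₀ r₁ (ζ t)) = lform r₀ r₁ (conj (ζ t)) := by simp [lform]
  have dconj : HasDerivAt (fun t => conj (ζ t)) (-Complex.I * lform r₀ r₁ (conj (ζ t)) ^ 2) t := by
    have := Complex.conjCLE.hasFDerivAt.comp_hasDerivAt t hζ
    simpa [hconj, Function.comp_def] using this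
  have dy : HasDerivAt (fun t => ((ζ t).im : ℂ))
      ((lform r₀ r₁ (conj (ζ t)) ^ 2 + lform r₀ r₁ (ζ t) ^ 2) / 2) t := by
    have h1 := (hζ.sub dconj).div_const (2 * Complex.I)
    have h2 : (fun t => ((ζ t).im : ℂ)) = fun t => (ζ t - conj (ζ t)) / (2 * Complex.I) := by
      funext t
      rw [Complex.sub_conj, eq_div_iff (by simp)]
      push_cast
      ring
    rw [h2]
    refine h1.congr_deriv ?_
    rw [div_eq_div_iff (by simp) (by simp)]
    ring
  have dκ : HasDerivAt (fun t => lform p q (Φ (ζ t)))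
      (-q * fderiv ℝ Φ (ζ t) (Complex.I * lform r₀ r₁ (ζ t) ^ 2)) t := by
    simpa [lform] using (dΦ.const_mul (q : ℂ)).const_sub (p : ℂ)
  have dc : HasDerivAt (fun t => lform r₀ r₁ (conj (ζ t)))
      (Complex.I * r₁ * lform r₀ r₁ (conj (ζ t)) ^ 2) t := by
    refine ((dconj.const_mul (r₁ : ℂ)).const_sub (r₀ : ℂ)).congr_deriv ?_
    ring
  have dC : HasDerivAt (fun t => lform r₀ r₁ (ζ t))
      (-Complex.I * r₁ * lform r₀ r₁ (ζ t) ^ 2) t := by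
    refine ((hζ.const_mul (r₁ : ℂ)).const_sub (r₀ : ℂ)).congr_deriv ?_
    ring
  have key := (((dκ.pow 2).mul dc).neg).div ((da.mul dC).mul dy)
    (mul_ne_zero (mul_ne_zero ha hc) hy)
  refine key.congr_deriv ?_
  have e1 : fderiv ℝ a (ζ t) (Complex.I * lform r₀ r₁ (ζ t) ^ 2)
      = a (ζ t) * (-lform r₀ r₁ (ζ t) ^ 2 / (ζ t).im - Complex.I *
        fderiv ℝ Φ (ζ t) (Complex.I * lform r₀ r₁ (ζ t) ^ 2) / (Φ (ζ t)).im) := by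
    rw [h.fderiv_a _ hz, h.fderiv_Φ _ hz]
    linear_combination (a (ζ t) * lform r₀ r₁ (ζ t) ^ 2 / (ζ t).im) * Complex.I_sq
  rw [← sector_derivative_algebra (κ := lform p q (Φ (ζ t))) (C := lform r₀ r₁ (ζ t)) (q := q)
    (r := r₁) ha hc hy hY ?_ ?_
    (W := fderiv ℝ Φ (ζ t) (Complex.I * lform r₀ r₁ (ζ t) ^ 2)) ?_, e1]
  · simp
    ring
  · simp only [lform, map_sub, map_mul, Complex.conj_ofReal]
    have := Complex.sub_conj (Φ (ζ t))
    push_cast at this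
    linear_combination (q : ℂ) * this
  · simp only [lform]
    have := Complex.sub_conj (ζ t)
    push_cast at this
    linear_combination (r₁ : ℂ) * this
  · rw [h.fderiv_Φ _ hz]
    simp only [map_mul, map_pow, Complex.conj_I, hconj]
    ring

theorem re_derivative_sectorFun_nonneg (h : IsMLFrame Φ a α β) (hz : z ∈ Hset) {r₀ r₁ : ℝ} (κ : ℂ)
    (hc : lform r₀ r₁ z ≠ 0) :
    0 ≤ (κ * conj κ / (z.im * (Φ z).im) *
        (α z * (lform r₀ r₁ (conj z) * lform r₀ r₁ z)
          - β z * lform r₀ r₁ (conj z) ^ 3 / lform r₀ r₁ z)).re := by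
  have hconj : lform r₀ r₁ (conj z) = conj (lform r₀ r₁ z) := by simp [lform]
  have hy : 0 < z.im := hz
  have hY : 0 < (Φ z).im := h.mapsTo hz
  set C := lform r₀ r₁ z
  have e1 : κ * conj κ / (z.im * (Φ z).im) = ((‖κ‖ ^ 2 / (z.im * (Φ z).im) : ℝ) : ℂ) := by
    rw [Complex.mul_conj, Complex.normSq_eq_norm_sq]; push_cast; rfl
  have e2 : lform r₀ r₁ (conj z) * C = ((‖C‖ ^ 2 : ℝ) : ℂ) := by
    rw [hconj, mul_comm, Complex.mul_conj, Complex.normSq_eq_norm_sq]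
  rw [e1, e2, Complex.re_ofReal_mul, ← Complex.ofReal_mul, Complex.sub_re, Complex.ofReal_re]
  refine mul_nonneg (by positivity) ?_
  have h1 : (β z * lform r₀ r₁ (conj z) ^ 3 / C).re ≤ ‖β z‖ * ‖C‖ ^ 2 := by
    refine (Complex.re_le_norm _).trans ?_
    rw [norm_div, norm_mul, norm_pow, hconj, Complex.norm_conj]
    have : 0 < ‖C‖ := norm_pos_iff.2 hc
    apply le_of_eq
    field_simp
  have h2 := (h.toIsCodazziPair.norm_lt hz).le
  have h3 := mul_le_mul_of_nonneg_right h2 (sq_nonneg ‖C‖)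
  linarith

end IsMLFrame

/-- The boundary point of the Riemann sphere with homogeneous coordinates `[v₀ : v₁]`. -/
def toSphere (v₀ v₁ : ℝ) : OnePoint ℂ :=
  if v₁ = 0 then OnePoint.infty else OnePoint.some ((v₀ / v₁ : ℝ) : ℂ)

/-- The trace on the upper half-plane of the neighbourhoods of `[v₀ : v₁]`. -/
def bdryFilter (v₀ v₁ : ℝ) : Filter ℂ :=
  comap OnePoint.some (nhds (toSphere v₀ v₁)) ⊓ 𝓟 Hset

theorem lform_ne_zero {v₀ v₁ : ℝ} (hv : v₀ ≠ 0 ∨ v₁ ≠ 0) {z : ℂ} (hz : z ∈ Hset) :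
    lform v₀ v₁ z ≠ 0 := by
  intro h
  have hy : z.im ≠ 0 := (show (0 : ℝ) < z.im from hz).ne'
  have h1 := congrArg Complex.im h
  have h2 := congrArg Complex.re h
  simp [lform] at h1 h2
  rcases h1 with h1 | h1
  · simp [h1] at h2
    tauto
  · exact hy h1

/-- Geodesic rays towards a boundary point, in the parametrization used for `sectorFun`. -/
theorem exists_ray {v₀ v₁ : ℝ} (hv : v₀ ≠ 0 ∨ v₁ ≠ 0) {z₀ : ℂ} (hz : z₀ ∈ Hset) :
    ∃ ζ : ℝ → ℂ, ζ 0 = z₀ ∧ (∀ t, 0 ≤ t → ζ t ∈ Hset) ∧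
      (∀ t, 0 ≤ t → HasDerivAt ζ (Complex.I * lform v₀ v₁ (ζ t) ^ 2) t) ∧
      Tendsto ζ atTop (bdryFilter v₀ v₁) := by
  have hy : 0 < z₀.im := hz
  set c := lform v₀ v₁ z₀ with hc
  have hc0 : c ≠ 0 := lform_ne_zero hv hz
  have hcre : c.re = v₀ - v₁ * z₀.re := by simp [hc, lform]
  have hcim : c.im = -(v₁ * z₀.im) := by simp [hc, lform]
  set D : ℝ → ℂ := fun t => 1 + Complex.I * v₁ * c * t with hD
  set ζ : ℝ → ℂ := fun t => z₀ + Complex.I * t * c ^ 2 / D t with hζ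
  have hDre : ∀ t, (D t).re = 1 + v₁ ^ 2 * z₀.im * t := by
    intro t
    simp [hD, hcim, -mul_eq_mul_right_iff]
    ring
  have hDim : ∀ t, (D t).im = v₁ * c.re * t := by
    intro t
    simp [hD, -mul_eq_mul_right_iff]
  have hD0 : ∀ t, 0 ≤ t → D t ≠ 0 := by
    intro t ht h0
    have := congrArg Complex.re h0
    rw [hDre] at this
    have : 0 ≤ v₁ ^ 2 * z₀.im * t := by positivity
    simp at *
    linarith
  have hl : ∀ t, 0 ≤ t → lform v₀ v₁ (ζ t) = c / D t := by
    intro t ht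
    have e : lform v₀ v₁ (ζ t) = c - v₁ * (Complex.I * t * c ^ 2 / D t) := by
      change _ = lform v₀ v₁ z₀ - _
      simp only [lform, hζ]
      ring
    rw [e]
    have := hD0 t ht
    field_simp
    simp only [hD]
    ring
  have hmem : ∀ t, 0 ≤ t → ζ t ∈ Hset := by
    intro t ht
    have h1 : (ζ t).im * Complex.normSq (D t) = z₀.im + t * Complex.normSq c := by
      have h2 : 0 < Complex.normSq (D t) := Complex.normSq_pos.2 (hD0 t ht)
      have h3 : (Complex.I * t * c ^ 2).re = -(2 * t * c.re * c.im) := by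
        simp [pow_two]; ring
      have h4 : (Complex.I * t * c ^ 2).im = t * (c.re ^ 2 - c.im ^ 2) := by
        simp [pow_two]; 
      simp only [hζ, Complex.add_im, Complex.div_im, h3, h4]
      field_simp
      simp only [Complex.normSq_apply, hDre, hDim, hcim]
      ring
    have h2 : 0 < Complex.normSq (D t) := Complex.normSq_pos.2 (hD0 t ht)
    have h3 : 0 ≤ Complex.normSq c := Complex.normSq_nonneg _
    have h4 : 0 < (ζ t).im * Complex.normSq (D t) := by rw [h1]; positivity
    exact pos_of_mul_pos_left h4 h2.le
  refine ⟨ζ, by simp [hζ], hmem, ?_, ?_⟩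
  · intro t ht
    have d0 : HasDerivAt (fun t : ℝ => (t : ℂ)) 1 t := Complex.ofRealCLM.hasDerivAt
    have d1 : HasDerivAt D (Complex.I * v₁ * c) t := by
      refine ((d0.const_mul (Complex.I * v₁ * c)).const_add 1).congr_deriv (mul_one _)
    have d2 := (((d0.const_mul Complex.I).mul_const (c ^ 2)).div d1 (hD0 t ht)).const_add z₀
    refine d2.congr_deriv ?_
    rw [hl t ht]
    have := hD0 t ht
    field_simp
    simp only [hD]
    ring
  · refine tendsto_inf.2 ⟨?_, tendsto_principal.2 ?_⟩
    · refine tendsto_comap_iff.2 ?_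
      by_cases h1 : v₁ = 0
      · have h2 : toSphere v₀ v₁ = OnePoint.infty := by simp [toSphere, h1]
        rw [h2]
        refine OnePoint.tendsto_coe_infty.comp ?_
        rw [coclosedCompact_eq_cocompact, ← Metric.cobounded_eq_cocompact,
          ← tendsto_norm_atTop_iff_cobounded]
        have h3 : v₀ ≠ 0 := by tauto
        have h4 : ∀ t : ℝ, t * v₀ ^ 2 ≤ ‖ζ t‖ := by
          intro t
          have : (ζ t).im = z₀.im + t * v₀ ^ 2 := by
            simp [hζ, hD, h1, hc, lform, pow_two]
          refine le_trans ?_ ((le_abs_self _).trans (Complex.abs_im_le_norm (ζ t)))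
          linarith
        exact tendsto_atTop_mono h4 (tendsto_id.atTop_mul_const (by positivity))
      · have h2 : toSphere v₀ v₁ = OnePoint.some ((v₀ / v₁ : ℝ) : ℂ) := by simp [toSphere, h1]
        rw [h2]
        refine (OnePoint.continuous_coe.tendsto _).comp ?_
        have h1' : (v₁ : ℂ) ≠ 0 := by exact_mod_cast h1
        have h3 : Tendsto (fun t => c / D t) atTop (𝓝 0) := by
          rw [tendsto_zero_iff_norm_tendsto_zero]
          have h4 : Tendsto (fun t : ℝ => ‖D t‖) atTop atTop := by
            have h5 : ∀ t : ℝ, v₁ ^ 2 * z₀.im * t ≤ ‖D t‖ := by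
              intro t
              refine le_trans ?_ ((le_abs_self _).trans (Complex.abs_re_le_norm (D t)))
              rw [hDre]
              linarith
            exact tendsto_atTop_mono h5 (tendsto_id.const_mul_atTop (by positivity))
          simpa only [norm_div] using h4.const_div_atTop ‖c‖
        have h4 := (h3.const_sub (v₀ : ℂ)).div_const (v₁ : ℂ)
        rw [sub_zero] at h4
        push_cast
        refine h4.congr' ?_
        filter_upwards [eventually_ge_atTop 0] with t ht
        rw [← hl t ht, lform]
        field_simp
        ring
    · filter_upwards [eventually_ge_atTop 0] with t ht using hmem t ht

theorem tendsto_lform_div {l : Filter ℂ} {Φ : ℂ → ℂ} {w₀ w₁ : ℝ} (hw : w₀ ≠ 0 ∨ w₁ ≠ 0)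
    (h : Tendsto (fun z => OnePoint.some (Φ z)) l (nhds (toSphere w₀ w₁))) :
    Tendsto (fun z => lform w₀ w₁ (Φ z) / lform (-w₁) w₀ (Φ z)) l (𝓝 0) := by
  by_cases h1 : w₁ = 0
  · have h2 : toSphere w₀ w₁ = OnePoint.infty := by simp [toSphere, h1]
    rw [h2] at h
    have h3 : w₀ ≠ 0 := by tauto
    have h4 : Tendsto Φ l (cocompact ℂ) := by
      rw [← coclosedCompact_eq_cocompact, ← OnePoint.comap_coe_nhds_infty]
      exact tendsto_comap_iff.2 h
    have h5 := (tendsto_inv₀_cobounded (α := ℂ)).comp (Metric.cobounded_eq_cocompact (α := ℂ) ▸ h4)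
    have h6 := h5.neg
    rw [neg_zero] at h6
    refine h6.congr fun z => ?_
    have h3' : (w₀ : ℂ) ≠ 0 := by exact_mod_cast h3
    by_cases h7 : Φ z = 0
    · simp [lform, h1, h7]
    · simp only [lform, h1, Function.comp_apply]
      push_cast
      field_simp
      ring
  · have h2 : toSphere w₀ w₁ = OnePoint.some ((w₀ / w₁ : ℝ) : ℂ) := by simp [toSphere, h1]
    rw [h2] at h
    have h1' : (w₁ : ℂ) ≠ 0 := by exact_mod_cast h1
    have h3 : Tendsto Φ l (𝓝 ((w₀ / w₁ : ℝ) : ℂ)) :=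
      OnePoint.isOpenEmbedding_coe.tendsto_nhds_iff.2 h
    have h4 : lform (-w₁) w₀ ((w₀ / w₁ : ℝ) : ℂ) ≠ 0 := by
      have : lform (-w₁) w₀ ((w₀ / w₁ : ℝ) : ℂ) = ((-(w₀ ^ 2 + w₁ ^ 2) / w₁ : ℝ) : ℂ) := by
        simp only [lform]
        push_cast
        field_simp
        ring
      rw [this]
      norm_cast
      have : 0 < w₀ ^ 2 + w₁ ^ 2 := by positivity
      exact div_ne_zero (by linarith) h1
    have h5 := ((h3.const_mul (w₁ : ℂ)).const_sub (w₀ : ℂ)).div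
      ((h3.const_mul (w₀ : ℂ)).const_sub ((-w₁ : ℝ) : ℂ)) h4
    have h6 : ((w₀ : ℂ) - w₁ * ((w₀ / w₁ : ℝ) : ℂ)) / (((-w₁ : ℝ) : ℂ) - w₀ * ((w₀ / w₁ : ℝ) : ℂ))
        = 0 := by
      rw [div_eq_zero_iff]
      left
      push_cast
      field_simp
      ring
    rw [h6] at h5
    exact h5

theorem IsMLFrame.sector {Φ a : ℂ → ℂ} {α : ℂ → ℝ} {β : ℂ → ℂ} (h : IsMLFrame Φ a α β)
    {v₀ v₁ w₀ w₁ : ℝ} (hv : v₀ ≠ 0 ∨ v₁ ≠ 0) (hw : w₀ ≠ 0 ∨ w₁ ≠ 0)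
    (hlim : Tendsto (fun z => OnePoint.some (Φ z)) (bdryFilter v₀ v₁) (nhds (toSphere w₀ w₁)))
    {z : ℂ} (hz : z ∈ Hset) :
    0 ≤ (lform w₀ w₁ (Φ z) ^ 2 * lform v₀ v₁ (conj z) ^ 2 / a z).re := by
  by_contra! hneg
  obtain ⟨ζ, h0, hmem, hder, htend⟩ := exists_ray hv hz
  have hw' : -w₁ ≠ 0 ∨ w₀ ≠ 0 := by simpa [or_comm] using hw
  have hF : ∀ s : ℝ, ∀ u, lform (w₀ - s * w₁) (w₁ + s * w₀) u
      = lform w₀ w₁ u + s * lform (-w₁) w₀ u := by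
    intro s u
    simp only [lform]
    push_cast
    ring
  have hpos : 0 < (sectorFun Φ a v₀ v₁ w₀ w₁ z).re := by
    have hc := lform_ne_zero hv hz
    have hconj : lform v₀ v₁ (conj z) = conj (lform v₀ v₁ z) := by simp [lform]
    have hy : 0 < z.im := hz
    have e : sectorFun Φ a v₀ v₁ w₀ w₁ z = -(((‖lform v₀ v₁ z‖ ^ 2 * z.im)⁻¹ : ℝ) : ℂ) *
        (lform w₀ w₁ (Φ z) ^ 2 * lform v₀ v₁ (conj z) ^ 2 / a z) := by
      have h1 : ((‖lform v₀ v₁ z‖ : ℂ)) ^ 2 = lform v₀ v₁ z * conj (lform v₀ v₁ z) := by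
        rw [Complex.mul_conj, Complex.normSq_eq_norm_sq]; push_cast; rfl
      have h2 : conj (lform v₀ v₁ z) ≠ 0 := by simpa using hc
      have h3 := h.a_ne_zero hz
      have h4 : (z.im : ℂ) ≠ 0 := by exact_mod_cast hy.ne'
      push_cast
      rw [h1, sectorFun, hconj]
      field_simp
    rw [e, ← Complex.ofReal_neg, Complex.re_ofReal_mul]
    have : 0 < ‖lform v₀ v₁ z‖ := norm_pos_iff.2 hc
    have : 0 < (‖lform v₀ v₁ z‖ ^ 2 * z.im)⁻¹ := by positivity
    nlinarith
  have hcont : Continuous fun s : ℝ =>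
      (sectorFun Φ a v₀ v₁ (w₀ - s * w₁) (w₁ + s * w₀) z).re := by
    simp only [sectorFun, hF]
    fun_prop
  have hev : ∀ᶠ s in 𝓝 (0 : ℝ), 0 < (sectorFun Φ a v₀ v₁ (w₀ - s * w₁) (w₁ + s * w₀) z).re := by
    refine hcont.continuousAt.eventually (lt_mem_nhds ?_)
    simpa using hpos
  obtain ⟨ε, hε, hball⟩ := Metric.eventually_nhds_iff.1 hev
  have hmono : ∀ s : ℝ, |s| < ε → ∀ t, 0 ≤ t →
      0 < (sectorFun Φ a v₀ v₁ (w₀ - s * w₁) (w₁ + s * w₀) (ζ t)).re := by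
    intro s hs t ht
    have h1 := hball (y := s) (by simpa using hs)
    refine h1.trans_le ?_
    have hd : ∀ x ∈ Ici (0 : ℝ), HasDerivAt (fun t =>
        (sectorFun Φ a v₀ v₁ (w₀ - s * w₁) (w₁ + s * w₀) (ζ t)).re) _ x := fun x hx =>
      Complex.reCLM.hasFDerivAt.comp_hasDerivAt x
        (h.hasDerivAt_sectorFun (hmem x hx) (lform_ne_zero hv (hmem x hx)) (hder x hx))
    have hm := monotoneOn_of_deriv_nonneg (convex_Ici (0 : ℝ))
      (fun x hx => (hd x hx).continuousAt.continuousWithinAt)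
      (fun x hx => (hd x (interior_subset hx)).differentiableAt.differentiableWithinAt)
      (fun x hx => by
        rw [(hd x (interior_subset hx)).deriv]
        exact h.re_derivative_sectorFun_nonneg (hmem x (interior_subset hx)) _
          (lform_ne_zero hv (hmem x (interior_subset hx))))
    have := hm self_mem_Ici (mem_Ici.2 ht) ht
    simpa [h0] using this
  have hr := (tendsto_lform_div hw hlim).comp htend
  obtain ⟨t, hrt, ht⟩ := ((Metric.tendsto_nhds.1 hr (ε / 2) (by positivity)).and
    (eventually_ge_atTop 0)).exists
  have hκ := lform_ne_zero hw' (h.mapsTo (hmem t ht))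
  set r := lform w₀ w₁ (Φ (ζ t)) / lform (-w₁) w₀ (Φ (ζ t)) with hrdef
  have hrn : ‖r‖ < ε / 2 := by simpa [hrdef] using hrt
  have hκr : lform w₀ w₁ (Φ (ζ t)) = lform (-w₁) w₀ (Φ (ζ t)) * (r.re + r.im * Complex.I) := by
    rw [Complex.re_add_im, hrdef]
    field_simp
  have hre := Complex.abs_re_le_norm r
  have him := Complex.abs_im_le_norm r
  have h1 := hmono (-r.re + r.im) (by
    have := abs_add_le (-r.re) r.im
    rw [abs_neg] at this
    linarith) t ht
  have h2 := hmono (-r.re - r.im) (by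
    have := abs_sub (-r.re) r.im
    rw [abs_neg] at this
    linarith) t ht
  have h3 := add_pos h1 h2
  rw [← Complex.add_re, sectorFun, sectorFun, hF, hF, hκr, ← add_div] at h3
  have h4 : -((lform (-w₁) w₀ (Φ (ζ t)) * (r.re + r.im * Complex.I)
        + ((-r.re + r.im : ℝ) : ℂ) * lform (-w₁) w₀ (Φ (ζ t))) ^ 2 * lform v₀ v₁ (conj (ζ t)))
      + -((lform (-w₁) w₀ (Φ (ζ t)) * (r.re + r.im * Complex.I)
        + ((-r.re - r.im : ℝ) : ℂ) * lform (-w₁) w₀ (Φ (ζ t))) ^ 2 * lform v₀ v₁ (conj (ζ t)))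
      = 0 := by
    push_cast
    linear_combination (-2 * lform (-w₁) w₀ (Φ (ζ t)) ^ 2 * r.im ^ 2 * lform v₀ v₁ (conj (ζ t)))
      * Complex.I_sq
  rw [h4] at h3
  simp at h3

theorem toSphere_smul {c : ℝ} (hc : c ≠ 0) (v₀ v₁ : ℝ) :
    toSphere (c * v₀) (c * v₁) = toSphere v₀ v₁ := by
  simp only [toSphere, mul_eq_zero, hc, false_or, mul_div_mul_left _ _ hc]

theorem rp1ToSphere_eq (ξ : RP1) : rp1ToSphere ξ = toSphere (ξ.rep 0) (ξ.rep 1) := rfl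

theorem exists_mul_rep {v : Fin 2 → ℝ} (hv : v ≠ 0) :
    ∃ c : ℝ, c ≠ 0 ∧ ∀ i, (Projectivization.mk ℝ v hv).rep i = c * v i := by
  obtain ⟨c, hc⟩ := Projectivization.exists_smul_eq_mk_rep ℝ v hv
  exact ⟨c, c.ne_zero, fun i => by rw [← hc]; rfl⟩

theorem ne_zero_or {v : Fin 2 → ℝ} (hv : v ≠ 0) : v 0 ≠ 0 ∨ v 1 ≠ 0 := by
  by_contra! h
  exact hv (by ext i; fin_cases i <;> simp [h.1, h.2])

theorem ExtendsToBoundary.tendsto {Φ : ℂ → ℂ} {φ : RP1 → RP1} (h : ExtendsToBoundary Φ φ)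
    {v : Fin 2 → ℝ} (hv : v ≠ 0) :
    Tendsto (fun z => OnePoint.some (Φ z)) (bdryFilter (v 0) (v 1))
      (nhds (toSphere ((φ (.mk ℝ v hv)).rep 0) ((φ (.mk ℝ v hv)).rep 1))) := by
  obtain ⟨c, hc, hcv⟩ := exists_mul_rep hv
  have := h (.mk ℝ v hv)
  rw [rp1ToSphere_eq, rp1ToSphere_eq, hcv, hcv, toSphere_smul hc] at this
  exact this

theorem tendsto_some_toSphere_iff_of_eq_zero {l : Filter ℂ} {f : ℂ → ℂ} {w₀ w₁ : ℝ} (h1 : w₁ = 0) :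
    Tendsto (fun z => OnePoint.some (f z)) l (nhds (toSphere w₀ w₁)) ↔
      Tendsto (fun z => ‖f z‖) l atTop := by
  have h2 : toSphere w₀ w₁ = OnePoint.infty := by simp [toSphere, h1]
  rw [h2, tendsto_norm_atTop_iff_cobounded, Metric.cobounded_eq_cocompact,
    ← coclosedCompact_eq_cocompact, ← OnePoint.comap_coe_nhds_infty]
  exact tendsto_comap_iff.symm

theorem tendsto_some_toSphere_iff_of_ne_zero {l : Filter ℂ} {f : ℂ → ℂ} {w₀ w₁ : ℝ} (h1 : w₁ ≠ 0) :
    Tendsto (fun z => OnePoint.some (f z)) l (nhds (toSphere w₀ w₁)) ↔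
      Tendsto f l (𝓝 ((w₀ / w₁ : ℝ) : ℂ)) := by
  have h2 : toSphere w₀ w₁ = OnePoint.some ((w₀ / w₁ : ℝ) : ℂ) := by simp [toSphere, h1]
  rw [h2]
  exact (OnePoint.isOpenEmbedding_coe.tendsto_nhds_iff (f := f)).symm

theorem tendsto_neg_conj_toSphere {l : Filter ℂ} {Φ : ℂ → ℂ} {w₀ w₁ : ℝ}
    (h : Tendsto (fun z => OnePoint.some (Φ z)) l (nhds (toSphere w₀ w₁))) :
    Tendsto (fun z => OnePoint.some (-conj (Φ z))) l (nhds (toSphere (-w₀) w₁)) := by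
  by_cases h1 : w₁ = 0
  · rw [tendsto_some_toSphere_iff_of_eq_zero h1] at h ⊢
    simpa using h
  · rw [tendsto_some_toSphere_iff_of_ne_zero h1] at h ⊢
    have := ((Complex.continuous_conj.tendsto _).comp h).neg
    rw [Complex.conj_ofReal] at this
    rw [neg_div, Complex.ofReal_neg]
    exact this

theorem continuous_mk : Continuous fun v : {v : Fin 2 → ℝ // v ≠ 0} =>
    (Projectivization.mk ℝ v.1 v.2 : RP1) :=
  continuous_quot_mk

theorem continuous_of_comp_mk {X : Type*} [TopologicalSpace X] {f : RP1 → X}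
    (h : Continuous fun v : {v : Fin 2 → ℝ // v ≠ 0} => f (.mk ℝ v.1 v.2)) : Continuous f :=
  continuous_coinduced_dom.2 h

/-- The unit vector of angle `θ`. -/
def dirVec (θ : ℝ) : Fin 2 → ℝ := ![cos θ, sin θ]

theorem dirVec_ne_zero (θ : ℝ) : dirVec θ ≠ 0 := by
  intro h
  have h0 := congrFun h 0
  have h1 := congrFun h 1
  have := sin_sq_add_cos_sq θ
  simp [dirVec] at h0 h1
  simp [h0, h1] at this

theorem not_orientationPreserving_of_sector {φ : RP1 → RP1} (hc : Continuous φ)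
    {P ρ : ℂ} (hP : 0 < P.im) (hρ : ρ ≠ 0)
    (hsec : ∀ (v : Fin 2 → ℝ) (hv : v ≠ 0), 0 ≤ ((ρ * conj (lform ((φ (.mk ℝ v hv)).rep 0)
      ((φ (.mk ℝ v hv)).rep 1) P) * (v 0 + v 1 * Complex.I)) ^ 2).re) :
    ¬ OrientationPreserving φ := by
  intro hφ
  obtain ⟨σ, hσ⟩ : ∃ σ : (Fin 2 → ℝ) → ℂ, ∀ w, σ w = ρ * conj (lform (w 0) (w 1) P) :=
    ⟨_, fun _ => rfl⟩
  have hσ0 : ∀ w, w ≠ 0 → σ w ≠ 0 := fun w hw => by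
    rw [hσ]
    exact mul_ne_zero hρ (by simpa using lform_ne_zero (ne_zero_or hw) hP)
  have hdet : ∀ w w', (conj (σ w) * σ w').im = ‖ρ‖ ^ 2 * P.im * det2 w w' := by
    intro w w'
    simp only [hσ, det2, ← Complex.normSq_eq_norm_sq, Complex.normSq_apply, lform]
    simp
    ring
  set Q : RP1 → ℂ := fun ξ => (σ ξ.rep / ‖σ ξ.rep‖) ^ 2 with hQ
  have hQc : Continuous Q := by
    refine continuous_of_comp_mk ?_
    have : ∀ v : {v : Fin 2 → ℝ // v ≠ 0}, Q (.mk ℝ v.1 v.2) = (σ v / ‖σ v‖) ^ 2 := by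
      intro v
      obtain ⟨c, hc, hcv⟩ := exists_mul_rep v.2
      have e : σ (Projectivization.mk ℝ v.1 v.2).rep = c * σ v := by
        simp only [hσ, hcv, lform]
        simp
        ring
      simp only [hQ, e, norm_mul, Complex.norm_real, div_pow]
      have h1 : ((‖c‖ : ℝ) : ℂ) ^ 2 = (c : ℂ) ^ 2 := by norm_cast; simp
      have h2 : ((‖σ v‖ : ℝ) : ℂ) ≠ 0 := by simpa using hσ0 v v.2
      have h3 : (c : ℂ) ≠ 0 := by exact_mod_cast hc
      push_cast
      rw [mul_pow, mul_pow, h1]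
      field_simp
    simp only [this]
    have h1 : Continuous fun v : {v : Fin 2 → ℝ // v ≠ 0} => σ v := by
      have h2 : ∀ i, Continuous fun v : {v : Fin 2 → ℝ // v ≠ 0} => ((v.1 i : ℝ) : ℂ) := fun i =>
        Complex.continuous_ofReal.comp ((continuous_apply i).comp continuous_subtype_val)
      simp only [hσ, lform]
      exact continuous_const.mul (Complex.continuous_conj.comp
        ((h2 0).sub ((h2 1).mul continuous_const)))
    refine (h1.div (Complex.continuous_ofReal.comp h1.norm) fun v => ?_).pow 2
    simpa using hσ0 v v.2
  set pt : ℝ → RP1 := fun θ => .mk ℝ (dirVec θ) (dirVec_ne_zero θ) with hpt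
  have hptc : Continuous pt := by
    have : Continuous fun θ : ℝ => (⟨dirVec θ, dirVec_ne_zero θ⟩ : {v : Fin 2 → ℝ // v ≠ 0}) := by
      refine Continuous.subtype_mk ?_ _
      refine continuous_pi fun i => ?_
      fin_cases i
      · exact continuous_cos
      · exact continuous_sin
    exact continuous_mk.comp this
  have hptπ : pt π = pt 0 := by
    simp only [hpt]
    rw [Projectivization.mk_eq_mk_iff']
    refine ⟨-1, ?_⟩
    ext i
    fin_cases i <;> simp [dirVec]
  set F : ℝ → ℂ := fun θ => Q (φ (pt θ)) * Complex.exp (2 * θ * Complex.I) with hF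
  have hFc : Continuous F := (hQc.comp (hc.comp hptc)).mul (by fun_prop)
  have hσn : ∀ θ, ((‖σ (φ (pt θ)).rep‖ : ℝ) : ℂ) ≠ 0 := fun θ => by
    simpa using hσ0 _ (Projectivization.rep_nonzero _)
  have hFn : ∀ θ, ‖F θ‖ = 1 := by
    intro θ
    have h1 : ‖Complex.exp (2 * θ * Complex.I)‖ = 1 := by
      have := Complex.norm_exp_ofReal_mul_I (2 * θ)
      push_cast at this
      exact this
    have h2 := hσ0 _ (Projectivization.rep_nonzero (φ (pt θ)))
    simp [hF, hQ, h1, h2]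
  have hFre : ∀ θ, 0 ≤ (F θ).re := by
    intro θ
    have h1 := hsec (dirVec θ) (dirVec_ne_zero θ)
    have h2 : F θ = ((‖σ (φ (pt θ)).rep‖ ^ 2)⁻¹ : ℝ) * (σ (φ (pt θ)).rep *
        (cos θ + sin θ * Complex.I)) ^ 2 := by
      have h3 : Complex.exp (2 * θ * Complex.I) = (cos θ + sin θ * Complex.I) ^ 2 := by
        rw [show (2 * θ * Complex.I : ℂ) = (2 : ℕ) * (θ * Complex.I) by push_cast; ring,
          Complex.exp_nat_mul, Complex.exp_mul_I]
        push_cast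
        rfl
      simp only [hF, hQ, h3]
      have := hσn θ
      push_cast
      field_simp
    rw [h2, Complex.re_ofReal_mul]
    refine mul_nonneg (by positivity) ?_
    simpa [hσ, hpt, dirVec] using h1
  have hslit : ∀ θ, F θ ∈ Complex.slitPlane := by
    intro θ
    rw [Complex.mem_slitPlane_iff]
    by_contra! h
    have h1 : (F θ).re = 0 := le_antisymm h.1 (hFre θ)
    have : F θ = 0 := Complex.ext h1 h.2
    have h2 := hFn θ
    rw [this] at h2
    simp at h2
  set ψ : ℝ → ℝ := fun θ => -θ + (F θ).arg / 2 with hψ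
  have hψc : Continuous ψ := by
    have : Continuous fun θ => (F θ).arg := continuous_iff_continuousAt.2 fun θ =>
      (Complex.continuousAt_arg (hslit θ)).comp hFc.continuousAt
    fun_prop
  have hψπ : ψ π = ψ 0 - π := by
    have : F π = F 0 := by
      simp [hF, hptπ]
    simp only [hψ, this]
    ring
  have hpolar : ∀ θ, ∃ m : ℝ, m ≠ 0 ∧ σ (φ (pt θ)).rep = m * Complex.exp (ψ θ * Complex.I) := by
    intro θ
    have h1 : F θ = Complex.exp ((F θ).arg * Complex.I) := by
      conv_lhs => rw [← Complex.norm_mul_exp_arg_mul_I (F θ)]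
      simp [hFn]
    have h2 : Q (φ (pt θ)) = Complex.exp (ψ θ * Complex.I) ^ 2 := by
      have h3 : Q (φ (pt θ)) = F θ * Complex.exp (-(2 * θ * Complex.I)) := by
        simp only [hF]
        rw [mul_assoc, ← Complex.exp_add]
        simp
      rw [h3, h1, ← Complex.exp_add, ← Complex.exp_nat_mul]
      congr 1
      simp only [hψ]
      push_cast
      ring
    have h4 : (σ (φ (pt θ)).rep) ^ 2 = ((‖σ (φ (pt θ)).rep‖ : ℝ) * Complex.exp (ψ θ * Complex.I)) ^ 2 := by
      rw [mul_pow, ← h2]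
      simp only [hQ]
      have := hσn θ
      field_simp
    rcases sq_eq_sq_iff_eq_or_eq_neg.1 h4 with h5 | h5
    · exact ⟨_, by exact_mod_cast hσn θ, h5⟩
    · refine ⟨-‖σ (φ (pt θ)).rep‖, by simpa using hσn θ, ?_⟩
      exact h5.trans (by rw [Complex.ofReal_neg, neg_mul])
  obtain ⟨θ₂, hθ₂, e₂⟩ : ψ 0 - 2 * π / 3 ∈ ψ '' Ioo 0 π :=
    intermediate_value_Ioo' pi_pos.le hψc.continuousOn
      ⟨by rw [hψπ]; linarith [pi_pos], by linarith [pi_pos]⟩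
  obtain ⟨θ₁, hθ₁, e₁⟩ : ψ 0 - π / 3 ∈ ψ '' Ioo 0 θ₂ :=
    intermediate_value_Ioo' hθ₂.1.le hψc.continuousOn
      ⟨by rw [e₂]; linarith [pi_pos], by linarith [pi_pos]⟩
  have hdetpt : ∀ s, ∃ c : ℝ, c ≠ 0 ∧ ∀ i, (pt s).rep i = c * dirVec s i :=
    fun s => exists_mul_rep (dirVec_ne_zero s)
  obtain ⟨c₀, hc₀, hr₀⟩ := hdetpt 0
  obtain ⟨c₁, hc₁, hr₁⟩ := hdetpt θ₁
  obtain ⟨c₂, hc₂, hr₂⟩ := hdetpt θ₂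
  have hpos : 0 < tripleOrient (pt 0) (pt θ₂) (pt θ₁) := by
    have e : tripleOrient (pt 0) (pt θ₂) (pt θ₁)
        = (c₀ * c₁ * c₂) ^ 2 * (sin θ₂ * sin (θ₂ - θ₁) * sin θ₁) := by
      simp only [tripleOrient, det2, hr₀, hr₁, hr₂, dirVec, sin_sub]
      simp
      ring
    rw [e]
    have h1 := sin_pos_of_pos_of_lt_pi hθ₂.1 hθ₂.2
    have h2 := sin_pos_of_pos_of_lt_pi hθ₁.1 (hθ₁.2.trans hθ₂.2)
    have h3 := sin_pos_of_pos_of_lt_pi (sub_pos.2 hθ₁.2) (by linarith [hθ₁.1, hθ₂.2])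
    positivity
  have himg := hφ _ _ _ hpos
  obtain ⟨m₀, hm₀, hs₀⟩ := hpolar 0
  obtain ⟨m₁, hm₁, hs₁⟩ := hpolar θ₁
  obtain ⟨m₂, hm₂, hs₂⟩ := hpolar θ₂
  have hρ2 : 0 < ‖ρ‖ ^ 2 * P.im := by
    have := norm_pos_iff.2 hρ
    positivity
  have hdet' : ∀ (w w' : Fin 2 → ℝ) (m m' s s' : ℝ), σ w = m * Complex.exp (s * Complex.I) →
      σ w' = m' * Complex.exp (s' * Complex.I) →
      ‖ρ‖ ^ 2 * P.im * det2 w w' = m * m' * sin (s' - s) := by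
    intro w w' m m' s s' h h'
    rw [← hdet, h, h']
    simp [Complex.exp_re, Complex.exp_im, sin_sub]
    ring
  have d1 := hdet' _ _ _ _ _ _ hs₀ hs₂
  have d2 := hdet' _ _ _ _ _ _ hs₂ hs₁
  have d3 := hdet' _ _ _ _ _ _ hs₁ hs₀
  have hprod : (‖ρ‖ ^ 2 * P.im) ^ 3 * tripleOrient (φ (pt 0)) (φ (pt θ₂)) (φ (pt θ₁))
      = -((m₀ * m₁ * m₂) ^ 2 * (sin (2 * π / 3) * sin (π / 3) * sin (π / 3))) := by
    have e1 : sin (ψ θ₂ - ψ 0) = -sin (2 * π / 3) := by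
      rw [e₂, ← sin_neg]; congr 1; ring
    have e2 : sin (ψ θ₁ - ψ θ₂) = sin (π / 3) := by
      rw [e₂, e₁]; congr 1; ring
    have e3 : sin (ψ 0 - ψ θ₁) = sin (π / 3) := by
      rw [e₁]; congr 1; ring
    rw [e1] at d1
    rw [e2] at d2
    rw [e3] at d3
    simp only [tripleOrient]
    calc _ = (‖ρ‖ ^ 2 * P.im * det2 (φ (pt 0)).rep (φ (pt θ₂)).rep)
          * (‖ρ‖ ^ 2 * P.im * det2 (φ (pt θ₂)).rep (φ (pt θ₁)).rep)
          * (‖ρ‖ ^ 2 * P.im * det2 (φ (pt θ₁)).rep (φ (pt 0)).rep) := by ring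
      _ = _ := by rw [d1, d2, d3]; ring
  have h1 : 0 < sin (π / 3) := sin_pos_of_pos_of_lt_pi (by positivity) (by linarith [pi_pos])
  have h2 : 0 < sin (2 * π / 3) :=
    sin_pos_of_pos_of_lt_pi (by positivity) (by linarith [pi_pos])
  have h3 : 0 < (m₀ * m₁ * m₂) ^ 2 * (sin (2 * π / 3) * sin (π / 3) * sin (π / 3)) := by
    positivity
  have h4 : 0 < (‖ρ‖ ^ 2 * P.im) ^ 3 * tripleOrient (φ (pt 0)) (φ (pt θ₂)) (φ (pt θ₁)) := by
    positivity
  linarith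

theorem IsMinimalLagrangian.exists_isMLWith {Φ : ℂ → ℂ} (h : IsMinimalLagrangian Φ) :
    ∃ b, IsMLWith Φ b := by
  obtain ⟨h1, h2, -, b, h3, h4, h5, h6⟩ := h
  exact ⟨b, h1, h2.mapsTo, h3, h4, h5, h6⟩

/-- A minimal Lagrangian extension is given by a frame satisfying the sector condition. -/
theorem IsMinimalLagrangianExtension.exists_frame {Φ : ℂ → ℂ} {φ : RP1 → RP1} (hc : Continuous φ)
    (hφ : OrientationPreserving φ) (h : IsMinimalLagrangianExtension Φ φ) :
    ∃ a α β, IsMLFrame Φ a α β ∧ ∀ (v : Fin 2 → ℝ) (hv : v ≠ 0), ∀ z ∈ Hset,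
      0 ≤ (lform ((φ (.mk ℝ v hv)).rep 0) ((φ (.mk ℝ v hv)).rep 1) (Φ z) ^ 2
        * lform (v 0) (v 1) (conj z) ^ 2 / a z).re := by
  obtain ⟨hml, hext⟩ := h
  obtain ⟨b, hb⟩ := hml.exists_isMLWith
  have hrep : ∀ ξ : RP1, ξ.rep 0 ≠ 0 ∨ ξ.rep 1 ≠ 0 := fun ξ =>
    ne_zero_or (Projectivization.rep_nonzero ξ)
  rcases hb.jacobian_sign with hJ | hJ
  · obtain ⟨a, α, β, hf⟩ := hb.exists_frame hJ
    exact ⟨a, α, β, hf, fun v hv z hz =>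
      hf.sector (ne_zero_or hv) (hrep _) (hext.tendsto hv) hz⟩
  · exfalso
    obtain ⟨hb', hJ'⟩ := hb.neg_conj
    obtain ⟨a, α, β, hf⟩ := hb'.exists_frame fun z hz => by
      rw [hJ' z hz]
      exact neg_pos.2 (hJ z hz)
    have hI : Complex.I ∈ Hset := by simp [Hset]
    obtain ⟨ρ, hρ⟩ := IsAlgClosed.exists_pow_nat_eq (a Complex.I)⁻¹ (n := 2) (by norm_num)
    have hρ0 : ρ ≠ 0 := by
      rintro rfl
      exact hf.a_ne_zero hI (by simpa using hρ.symm)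
    refine not_orientationPreserving_of_sector hc (hb.mapsTo hI) hρ0 (fun v hv => ?_) hφ
    have hw := hrep (φ (.mk ℝ v hv))
    have := hf.sector (ne_zero_or hv) (by simpa using hw)
      (tendsto_neg_conj_toSphere (hext.tendsto hv)) hI
    convert this using 2
    rw [div_eq_mul_inv, ← hρ]
    simp [lform]
    ring

/-- Pointwise bound of the dilatation of a frame. -/
theorem IsMLFrame.dilatationAt_le {Φ a : ℂ → ℂ} {α : ℂ → ℝ} {β : ℂ → ℂ} (h : IsMLFrame Φ a α β)
    {z : ℂ} (hz : z ∈ Hset) : dilatationAt Φ z ≤ 4 * α z ^ 2 := by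
  have ha : 0 < ‖a z‖ := norm_pos_iff.2 (h.a_ne_zero hz)
  have hβ := h.toIsCodazziPair.norm_lt hz
  have hα := h.pos z hz
  have hdet := h.det z hz
  have : Nonempty {v : ℂ // ‖v‖ = 1} := ⟨⟨1, by simp⟩⟩
  have hup : (⨆ v : {v : ℂ // ‖v‖ = 1}, ‖fderiv ℝ Φ z v‖) ≤ ‖a z‖ * (α z + ‖β z‖) := by
    refine ciSup_le fun v => ?_
    rw [h.fderiv_Φ z hz, norm_mul]
    refine mul_le_mul_of_nonneg_left ((norm_add_le _ _).trans (le_of_eq ?_)) ha.le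
    simp [v.2, abs_of_pos hα]
  have hlow : ‖a z‖ * (α z - ‖β z‖) ≤ ⨅ v : {v : ℂ // ‖v‖ = 1}, ‖fderiv ℝ Φ z v‖ := by
    refine le_ciInf fun v => ?_
    rw [h.fderiv_Φ z hz, norm_mul]
    refine mul_le_mul_of_nonneg_left (le_trans (le_of_eq ?_) (norm_sub_le_norm_add _ _)) ha.le
    simp [v.2, abs_of_pos hα]
  have hpos : 0 < ‖a z‖ * (α z - ‖β z‖) := mul_pos ha (by linarith)
  rw [dilatationAt]
  refine (div_le_div₀ (by positivity) hup hpos hlow).trans ?_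
  rw [mul_div_mul_left _ _ ha.ne', div_le_iff₀ (by linarith)]
  nlinarith [norm_nonneg (β z)]

theorem IsMLFrame.log_maxDilatation_le {Φ a : ℂ → ℂ} {α : ℂ → ℝ} {β : ℂ → ℂ}
    (h : IsMLFrame Φ a α β) {B : ℝ} (hB : 0 ≤ B) (hα : ∀ z ∈ Hset, log (α z) ≤ B) :
    log (maxDilatation Φ) ≤ log 4 + 2 * B := by
  have h0 : 0 ≤ log 4 + 2 * B := by
    have := log_nonneg (show (1 : ℝ) ≤ 4 by norm_num)
    linarith
  have : Nonempty Hset := ⟨⟨Complex.I, by simp [Hset]⟩⟩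
  have hle : maxDilatation Φ ≤ 4 * exp B ^ 2 := by
    refine ciSup_le fun z => (h.dilatationAt_le z.2).trans ?_
    have h1 := h.pos z z.2
    have h2 := (log_le_iff_le_exp h1).1 (hα z z.2)
    gcongr
  have hnn : 0 ≤ maxDilatation Φ := by
    refine Real.iSup_nonneg fun z => ?_
    exact div_nonneg (Real.iSup_nonneg fun v => norm_nonneg _)
      (Real.iInf_nonneg fun v => norm_nonneg _)
  rcases hnn.eq_or_lt with h1 | h1
  · rw [← h1, log_zero]
    exact h0
  · refine (log_le_log h1 hle).trans (le_of_eq ?_)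
    rw [log_mul (by norm_num) (by positivity), log_pow, log_exp]
    push_cast
    ring

/-! ### Growth of solutions of the half-angle equation -/

theorem image_zero_le_of_deriv {Y Y' ε : ℝ → ℝ} {μ M c θ L : ℝ} (hc : 0 ≤ c) (hL : 0 ≤ L)
    (hμ : 0 ≤ μ) (hM : 0 ≤ M) (hY : ∀ t ∈ Icc 0 L, HasDerivAt Y (Y' t) t)
    (hY' : ∀ t ∈ Icc 0 L, |Y' t - ε t * Y t| ≤ ε t * μ)
    (hε : ∀ t ∈ Icc 0 L, θ * c / (1 + c * t) < ε t) (hYL : Y L ≤ M) :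
    Y 0 ≤ μ + M * (1 + c * L) ^ (-θ) := by
  have hpow : 0 < (1 + c * L) ^ (-θ) := rpow_pos_of_pos (by positivity) _
  by_cases h0 : Y 0 ≤ μ
  · nlinarith
  push Not at h0
  set B : ℝ → ℝ := fun t => (Y 0 - μ) * (1 + c * t) ^ θ with hB
  have hBd : ∀ t ∈ Icc 0 L, HasDerivAt B ((Y 0 - μ) * (c * θ * (1 + c * t) ^ (θ - 1))) t := by
    intro t ht
    have h1 : HasDerivAt (fun t => 1 + c * t) c t := by
      simpa using ((hasDerivAt_id t).const_mul c).const_add 1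
    have h2 : 0 < 1 + c * t := by have := mul_nonneg hc ht.1; linarith
    exact (h1.rpow_const (Or.inl h2.ne')).const_mul _
  have key := image_le_of_deriv_right_lt_deriv_boundary' (f := B) (B := fun t => Y t - μ)
    (a := 0) (b := L)
    (f' := fun t => (Y 0 - μ) * (c * θ * (1 + c * t) ^ (θ - 1))) (B' := Y')
    (fun t ht => (hBd t ht).continuousAt.continuousWithinAt)
    (fun t ht => (hBd t (Ico_subset_Icc_self ht)).hasDerivWithinAt)
    (by simp [hB])
    (fun t ht => ((hY t ht).sub_const μ).continuousAt.continuousWithinAt)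
    (fun t ht => ((hY t (Ico_subset_Icc_self ht)).sub_const μ).hasDerivWithinAt)
    (fun t ht hcontact => by
      have ht' := Ico_subset_Icc_self ht
      have h2 : 0 < 1 + c * t := by have := mul_nonneg hc ht.1; linarith
      have h3 : 0 < B t := mul_pos (by linarith) (rpow_pos_of_pos h2 _)
      have h4 := (abs_le.1 (hY' t ht')).1
      have h5 : (Y 0 - μ) * (c * θ * (1 + c * t) ^ (θ - 1)) = θ * c / (1 + c * t) * B t := by
        rw [rpow_sub_one h2.ne']
        simp only [hB]
        ring
      rw [h5]
      have h6 := mul_lt_mul_of_pos_right (hε t ht') h3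
      have h7 : ε t * B t = ε t * Y t - ε t * μ := by rw [hcontact]; ring
      linarith)
  have hend : B L ≤ Y L - μ := key (right_mem_Icc.2 hL)
  have hpos : 0 < 1 + c * L := by positivity
  have h1 : (Y 0 - μ) * (1 + c * L) ^ θ ≤ M := by linarith
  rw [rpow_neg hpos.le, ← div_eq_mul_inv]
  have h2 := (le_div_iff₀ (rpow_pos_of_pos hpos θ)).2 h1
  linarith

theorem abs_image_zero_le_of_deriv {Y Y' ε : ℝ → ℝ} {μ M c θ L : ℝ} (hc : 0 ≤ c) (hL : 0 ≤ L)
    (hμ : 0 ≤ μ) (hY : ∀ t ∈ Icc 0 L, HasDerivAt Y (Y' t) t)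
    (hY' : ∀ t ∈ Icc 0 L, |Y' t - ε t * Y t| ≤ ε t * μ)
    (hε : ∀ t ∈ Icc 0 L, θ * c / (1 + c * t) < ε t) (hYL : |Y L| ≤ M) :
    |Y 0| ≤ μ + M * (1 + c * L) ^ (-θ) := by
  have hM : 0 ≤ M := (abs_nonneg _).trans hYL
  refine abs_le'.2 ⟨image_zero_le_of_deriv hc hL hμ hM hY hY' hε (abs_le.1 hYL).2,
    image_zero_le_of_deriv (Y := -Y) (Y' := -Y') hc hL hμ hM (fun t ht => (hY t ht).neg)
      (fun t ht => ?_) hε (neg_le.1 (abs_le.1 hYL).1)⟩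
  rw [← abs_neg]
  convert hY' t ht using 2
  simp
  ring

/-- The half-angle cotangent of a complex number. -/
def cotHalf (s : ℂ) : ℝ := s.im / (‖s‖ - s.re)

theorem hasDerivAt_cotHalf {s : ℝ → ℂ} {t lam : ℝ} {Ω e : ℂ}
    (hs : HasDerivAt s (lam * (‖s t‖ * Ω - Complex.I * e * s t)) t)
    (hD : 0 < ‖s t‖ - (s t).re) :
    HasDerivAt (fun t => cotHalf (s t)) (lam * (Ω.re * cotHalf (s t)
      + (Ω.im * (1 - cotHalf (s t) ^ 2) + e.re * (1 + cotHalf (s t) ^ 2)) / 2)) t := by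
  have hn : 0 < ‖s t‖ := by
    rw [norm_pos_iff]
    rintro h0
    simp [h0] at hD
  have hsq : ∀ t, ‖s t‖ ^ 2 = (s t).re ^ 2 + (s t).im ^ 2 := fun t => by
    rw [← Complex.normSq_eq_norm_sq, Complex.normSq_apply]; ring
  have d1 : HasDerivAt (fun t => (s t).re) _ t := Complex.reCLM.hasFDerivAt.comp_hasDerivAt t hs
  have d2 : HasDerivAt (fun t => (s t).im) _ t := Complex.imCLM.hasFDerivAt.comp_hasDerivAt t hs
  have dn := ((d1.pow 2).add (d2.pow 2)).sqrt (by
    change (s t).re ^ 2 + (s t).im ^ 2 ≠ 0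
    rw [← hsq]; positivity)
  have hfun : (fun t => ‖s t‖) = fun t => √((s t).re ^ 2 + (s t).im ^ 2) := by
    funext t
    rw [← hsq, sqrt_sq (norm_nonneg _)]
  have dn' : HasDerivAt (fun t => ‖s t‖)
      (lam * (Ω.re * (s t).re + Ω.im * (s t).im + e.im * ‖s t‖)) t := by
    rw [hfun]
    refine dn.congr_deriv ?_
    have : √(((fun t => (s t).re) ^ 2 + (fun t => (s t).im) ^ 2) t) = ‖s t‖ :=
      (congrFun hfun t).symm
    rw [this, div_eq_iff (by positivity)]
    simp
    linear_combination (-2 * lam * e.im * 1) * hsq t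
  have key := d2.div (dn'.sub d1) hD.ne'
  refine key.congr_deriv ?_
  have hsq' := hsq t
  have hexp : (lam * (‖s t‖ * Ω - Complex.I * e * s t)).im
      = lam * (‖s t‖ * Ω.im + e.im * (s t).im - e.re * (s t).re) := by
    simp [-mul_eq_mul_left_iff]
    ring
  have hexp' : (lam * (‖s t‖ * Ω - Complex.I * e * s t)).re
      = lam * (‖s t‖ * Ω.re + e.im * (s t).re + e.re * (s t).im) := by
    simp [-mul_eq_mul_left_iff]
    ring
  simp only [cotHalf, Pi.sub_apply, Complex.imCLM_apply, Complex.reCLM_apply, hexp, hexp']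
  generalize ‖s t‖ = n at *
  generalize (s t).re = p at *
  generalize (s t).im = q at *
  obtain ⟨D, rfl⟩ : ∃ D, p = n - D := ⟨n - p, by ring⟩
  have hD0 : D ≠ 0 := by
    rintro rfl
    simp at hD
  rw [sub_sub_cancel]
  field_simp
  linear_combination lam * (Ω.im - e.re) * hsq'

/-- The Euclidean ray from `x` in the direction `e`, in units of the height of `x`. -/
def ray (x e : ℂ) (t : ℝ) : ℂ := x + t * (x.im * e)

theorem ray_zero (x e : ℂ) : ray x e 0 = x := by simp [ray]

theorem hasDerivAt_ray (x e : ℂ) (t : ℝ) : HasDerivAt (ray x e) (x.im * e) t := by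
  have d0 : HasDerivAt (fun t : ℝ => (t : ℂ)) 1 t := Complex.ofRealCLM.hasDerivAt
  exact ((d0.mul_const _).const_add x).congr_deriv (one_mul _)

theorem ray_im_mem {x e : ℂ} (hx : x ∈ Hset) (he : ‖e‖ = 1) {t : ℝ} (ht : 0 ≤ t)
    (ht' : t ≤ 1 / 10) : 9 / 10 * x.im ≤ (ray x e t).im ∧ (ray x e t).im ≤ 11 / 10 * x.im := by
  have hy : 0 < x.im := hx
  have h1 := abs_le.1 ((Complex.abs_im_le_norm e).trans he.le)
  have h2 : (ray x e t).im = x.im * (1 + t * e.im) := by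
    simp [ray]
    ring
  rw [h2]
  constructor <;> nlinarith [mul_nonneg ht hy.le]

theorem ray_mem {x e : ℂ} (hx : x ∈ Hset) (he : ‖e‖ = 1) {t : ℝ} (ht : 0 ≤ t)
    (ht' : t ≤ 1 / 10) : ray x e t ∈ Hset := by
  have hy : 0 < x.im := hx
  exact lt_of_lt_of_le (by positivity) (ray_im_mem hx he ht ht').1

theorem norm_im_mul {x e : ℂ} (hx : x ∈ Hset) (he : ‖e‖ = 1) : ‖(x.im * e : ℂ)‖ = x.im := by
  have hy : 0 < x.im := hx
  simp [he, abs_of_pos hy]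

namespace IsCodazziPair

variable {α : ℂ → ℝ} {β : ℂ → ℂ} {x e : ℂ} {t L : ℝ}

theorem inv_ray_le (h : IsCodazziPair α β) (hx : x ∈ Hset) (he : ‖e‖ = 1) (ht : 0 ≤ t)
    (ht' : t ≤ 1 / 10) : (α (ray x e t))⁻¹ ≤ (α x)⁻¹ + 40 * t := by
  have hy : 0 < x.im := hx
  have hd : ∀ s ∈ Icc (0 : ℝ) (1 / 10), HasDerivWithinAt (fun t => (α (ray x e t))⁻¹)
      (-(fderiv ℝ α (ray x e s) (x.im * e)) / α (ray x e s) ^ 2) (Icc 0 (1 / 10)) s := by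
    intro s hs
    have hm := ray_mem hx he hs.1 hs.2
    exact (((h.differentiableAt_α hm).hasFDerivAt.comp_hasDerivAt s (hasDerivAt_ray x e s)).inv
      (h.pos _ hm).ne').hasDerivWithinAt
  have hb : ∀ s ∈ Icc (0 : ℝ) (1 / 10),
      ‖-(fderiv ℝ α (ray x e s) (x.im * e)) / α (ray x e s) ^ 2‖ ≤ 40 := by
    intro s hs
    have hm := ray_mem hx he hs.1 hs.2
    have h1 := h.im_mul_fderiv_le hm (x.im * e)
    rw [norm_im_mul hx he] at h1
    have h2 := (ray_im_mem hx he hs.1 hs.2).1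
    have h3 := h.pos _ hm
    rw [norm_div, norm_neg, norm_pow, norm_eq_abs, norm_eq_abs, abs_of_pos h3,
      div_le_iff₀ (by positivity)]
    have h4 := mul_le_mul_of_nonneg_right h2 (abs_nonneg (fderiv ℝ α (ray x e s) (x.im * e)))
    have h5 : x.im * (9 / 10 * |fderiv ℝ α (ray x e s) (x.im * e)|)
        ≤ x.im * (36 * α (ray x e s) ^ 2) := by linarith
    have := le_of_mul_le_mul_left h5 hy
    linarith
  have key := (convex_Icc (0 : ℝ) (1 / 10)).norm_image_sub_le_of_norm_hasDerivWithin_le hd hb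
    (left_mem_Icc.2 (by norm_num)) ⟨ht, ht'⟩
  rw [norm_eq_abs, norm_eq_abs, sub_zero, abs_of_nonneg ht, ray_zero] at key
  linarith [(abs_le.1 key).2]

theorem le_ray (h : IsCodazziPair α β) (hx : x ∈ Hset) (he : ‖e‖ = 1) (ht : 0 ≤ t)
    (ht' : t ≤ 1 / 10) : α x / (1 + 40 * α x * t) ≤ α (ray x e t) := by
  have h1 := h.inv_ray_le hx he ht ht'
  have h2 := h.pos x hx
  have h3 := h.pos _ (ray_mem hx he ht ht')
  rw [div_le_iff₀ (by positivity)]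
  have h4 := mul_le_mul_of_nonneg_left h1 (mul_pos h2 h3).le
  field_simp at h4
  linarith

/-- The constants in force along a short ray. -/
theorem ray_bounds (h : IsCodazziPair α β) (hx : x ∈ Hset) (he : ‖e‖ = 1)
    (hL : 0 < L) (hL' : L ≤ 1 / 141) (hαL : α x * L ^ 2 = 1) (ht : t ∈ Icc 0 L) :
    1 / (41 * L) ≤ α (ray x e t) ∧ 1 ≤ ‖β (ray x e t)‖ := by
  have hm := ray_mem hx he ht.1 (by linarith [ht.2])
  have h1 := h.inv_ray_le hx he ht.1 (by linarith [ht.2])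
  have h2 := h.pos x hx
  have h3 := h.pos _ hm
  have h4 : (α x)⁻¹ = L ^ 2 := by
    field_simp
    linarith
  have h5 : (α (ray x e t))⁻¹ ≤ 41 * L := by
    rw [h4] at h1
    nlinarith [ht.2]
  have h6 : 1 / (41 * L) ≤ α (ray x e t) := by
    rw [one_div]
    exact inv_le_of_inv_le₀ h3 h5
  refine ⟨h6, ?_⟩
  have h7 : 2 ≤ 1 / (41 * L) := by
    rw [le_div_iff₀ (by positivity)]
    linarith
  have h8 := h.det _ hm
  nlinarith [norm_nonneg (β (ray x e t))]

theorem direction_ray (h : IsCodazziPair α β) (hx : x ∈ Hset) (he : ‖e‖ = 1)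
    (hL : 0 < L) (hL' : L ≤ 1 / 141) (hαL : α x * L ^ 2 = 1) (ht : t ∈ Icc 0 L)
    (hβ : β x = ‖β x‖ * e ^ 2) :
    ‖β (ray x e t) / ‖β (ray x e t)‖ - e ^ 2‖ ≤ 112 * t := by
  have hy : 0 < x.im := hx
  have hd : ∀ s ∈ Icc (0 : ℝ) L, HasDerivWithinAt
      (fun t => β (ray x e t) / (‖β (ray x e t)‖ : ℂ))
      (fderiv ℝ (fun z => β z / (‖β z‖ : ℂ)) (ray x e s) (x.im * e)) (Icc 0 L) s := by
    intro s hs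
    have hm := ray_mem hx he hs.1 (by linarith [hs.2])
    obtain ⟨h1, -⟩ := h.norm_fderiv_direction_le hm (h.ray_bounds hx he hL hL' hαL hs).2
    exact (h1.hasFDerivAt.comp_hasDerivAt s (hasDerivAt_ray x e s)).hasDerivWithinAt
  have hb : ∀ s ∈ Icc (0 : ℝ) L,
      ‖fderiv ℝ (fun z => β z / (‖β z‖ : ℂ)) (ray x e s) (x.im * e)‖ ≤ 112 := by
    intro s hs
    have hm := ray_mem hx he hs.1 (by linarith [hs.2])
    obtain ⟨-, h1⟩ := h.norm_fderiv_direction_le hm (h.ray_bounds hx he hL hL' hαL hs).2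
    have h2 := h1 (x.im * e)
    rw [norm_im_mul hx he] at h2
    have h3 := (ray_im_mem hx he hs.1 (by linarith [hs.2])).1
    have h4 := mul_le_mul_of_nonneg_right h3 (norm_nonneg
      (fderiv ℝ (fun z => β z / (‖β z‖ : ℂ)) (ray x e s) (x.im * e)))
    have h5 : x.im * (9 / 10 * ‖fderiv ℝ (fun z => β z / (‖β z‖ : ℂ)) (ray x e s) (x.im * e)‖)
        ≤ x.im * 100 := by linarith
    have := le_of_mul_le_mul_left h5 hy
    linarith
  have key := (convex_Icc (0 : ℝ) L).norm_image_sub_le_of_norm_hasDerivWithin_le hd hb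
    (left_mem_Icc.2 hL.le) ht
  have h0 : β x / (‖β x‖ : ℂ) = e ^ 2 := by
    have h1 := (h.ray_bounds hx he hL hL' hαL (left_mem_Icc.2 hL.le)).2
    rw [ray_zero] at h1
    have h2 : (‖β x‖ : ℂ) ≠ 0 := by exact_mod_cast (by linarith : (0:ℝ) < ‖β x‖).ne'
    nth_rewrite 1 [hβ]
    field_simp
  rw [norm_eq_abs, sub_zero, abs_of_nonneg ht.1, ray_zero, h0] at key
  exact key

theorem omega_ray (h : IsCodazziPair α β) (hx : x ∈ Hset) (he : ‖e‖ = 1)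
    (hL : 0 < L) (hL' : L ≤ 1 / 141) (hαL : α x * L ^ 2 = 1) (ht : t ∈ Icc 0 L)
    (hβ : β x = ‖β x‖ * e ^ 2) :
    α (ray x e t) ≤ (α (ray x e t) + β (ray x e t) * conj e ^ 2 : ℂ).re ∧
    |(α (ray x e t) + β (ray x e t) * conj e ^ 2 : ℂ).im|
      ≤ 112 * t * (α (ray x e t) + β (ray x e t) * conj e ^ 2 : ℂ).re := by
  have hm := ray_mem hx he ht.1 (by linarith [ht.2])
  have h1 := (h.ray_bounds hx he hL hL' hαL ht).2
  have h2 := h.direction_ray hx he hL hL' hαL ht hβ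
  have h3 := h.norm_lt hm
  set z := ray x e t
  have hn : (‖β z‖ : ℂ) ≠ 0 := by exact_mod_cast (by linarith : (0:ℝ) < ‖β z‖).ne'
  have hee : e * conj e = 1 := by
    rw [Complex.mul_conj, Complex.normSq_eq_norm_sq, he]; simp
  set q := β z / ‖β z‖ * conj e ^ 2 with hq
  have hq1 : ‖q - 1‖ ≤ 112 * t := by
    have : q - 1 = (β z / ‖β z‖ - e ^ 2) * conj e ^ 2 := by
      rw [hq]
      linear_combination (e * conj e + 1) * hee
    rw [this, norm_mul, norm_pow, Complex.norm_conj, he]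
    simpa using h2
  have e1 : (α z + β z * conj e ^ 2 : ℂ) = α z + ‖β z‖ * q := by
    rw [hq]
    field_simp
  have h4 := abs_le.1 ((Complex.abs_re_le_norm (q - 1)).trans hq1)
  have h5 := (Complex.abs_im_le_norm (q - 1)).trans hq1
  simp at h4 h5
  have h6 : 0 ≤ q.re := by linarith [h4.1, ht.2]
  rw [e1]
  have e2 : (α z + ‖β z‖ * q : ℂ).re = α z + ‖β z‖ * q.re := by simp
  have e3 : (α z + ‖β z‖ * q : ℂ).im = ‖β z‖ * q.im := by simp
  rw [e2, e3, abs_mul, abs_norm]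
  have h7 : 0 ≤ ‖β z‖ * q.re := by positivity
  refine ⟨by linarith, ?_⟩
  have h8 : 0 ≤ 112 * t := by linarith [ht.1]
  have h9 := h.pos _ hm
  have h10 := h9.le
  calc ‖β z‖ * |q.im| ≤ α z * (112 * t) := by gcongr
    _ ≤ 112 * t * (α z + ‖β z‖ * q.re) := by nlinarith

end IsCodazziPair

theorem mul_conj_of_norm_eq_one {e : ℂ} (he : ‖e‖ = 1) : e * conj e = 1 := by
  rw [Complex.mul_conj, Complex.normSq_eq_norm_sq, he]; simp

/-- The rotated square of a linear form along `Φ`, which takes values in a half-plane by the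
sector property. -/
def turnFun (Φ a : ℂ → ℂ) (p q : ℝ) (e z : ℂ) : ℂ :=
  -Complex.I * conj e * lform p q (Φ z) ^ 2 / a z

theorem IsMLFrame.hasDerivAt_turnFun {Φ a : ℂ → ℂ} {α : ℂ → ℝ} {β : ℂ → ℂ}
    (h : IsMLFrame Φ a α β) {x e : ℂ} {t p q : ℝ} (he : ‖e‖ = 1) (hz : ray x e t ∈ Hset) :
    HasDerivAt (fun t => turnFun Φ a p q e (ray x e t))
      ((x.im / (ray x e t).im : ℝ) * (‖turnFun Φ a p q e (ray x e t)‖ *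
        (α (ray x e t) + β (ray x e t) * conj e ^ 2)
        - Complex.I * e * turnFun Φ a p q e (ray x e t))) t := by
  have hζ := hasDerivAt_ray x e t
  have hee := mul_conj_of_norm_eq_one he
  have hy0 : 0 < (ray x e t).im := hz
  have hY0 : 0 < (Φ (ray x e t)).im := h.mapsTo hz
  have ha := h.a_ne_zero hz
  have hnorm : ‖turnFun Φ a p q e (ray x e t)‖
      = ‖lform p q (Φ (ray x e t))‖ ^ 2 * (ray x e t).im / (Φ (ray x e t)).im := by
    rw [← h.norm_a _ hz]
    have : 0 < ‖a (ray x e t)‖ := norm_pos_iff.2 ha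
    simp only [turnFun, norm_div, norm_mul, norm_neg, Complex.norm_I, Complex.norm_conj, he,
      norm_pow]
    field_simp
  have dΦ : HasDerivAt (fun t => Φ (ray x e t)) (fderiv ℝ Φ (ray x e t) (x.im * e)) t :=
    (differentiableAt_of_smooth isOpen_Hset h.smooth_Φ hz).hasFDerivAt.comp_hasDerivAt t hζ
  have da : HasDerivAt (fun t => a (ray x e t)) (fderiv ℝ a (ray x e t) (x.im * e)) t :=
    (differentiableAt_of_smooth isOpen_Hset h.smooth_a hz).hasFDerivAt.comp_hasDerivAt t hζ
  have dκ : HasDerivAt (fun t => lform p q (Φ (ray x e t)))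
      (-(q * fderiv ℝ Φ (ray x e t) (x.im * e))) t :=
    (dΦ.const_mul (q : ℂ)).const_sub (p : ℂ)
  have key := ((dκ.pow 2).const_mul (-Complex.I * conj e)).div da ha
  refine key.congr_deriv ?_
  rw [hnorm, h.fderiv_a _ hz, h.fderiv_Φ _ hz]
  have hκ : (‖lform p q (Φ (ray x e t))‖ ^ 2 : ℂ) = lform p q (Φ (ray x e t)) *
      (lform p q (Φ (ray x e t)) + 2 * Complex.I * q * (Φ (ray x e t)).im) := by
    have h1 : conj (lform p q (Φ (ray x e t)))
        = lform p q (Φ (ray x e t)) + 2 * Complex.I * q * (Φ (ray x e t)).im := by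
      simp only [lform, map_sub, map_mul, Complex.conj_ofReal]
      have := Complex.sub_conj (Φ (ray x e t))
      push_cast at this
      linear_combination (q : ℂ) * this
    rw [← h1, Complex.mul_conj, Complex.normSq_eq_norm_sq]
    push_cast
    rfl
  have hy : ((ray x e t).im : ℂ) ≠ 0 := by exact_mod_cast hy0.ne'
  have hY : ((Φ (ray x e t)).im : ℂ) ≠ 0 := by exact_mod_cast hY0.ne'
  push_cast
  rw [hκ]
  simp only [turnFun, map_mul, Complex.conj_ofReal, Pi.pow_apply]
  generalize lform p q (Φ (ray x e t)) = κ at *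
  generalize (Φ (ray x e t)).im = Y at *
  generalize (ray x e t).im = y at *
  generalize a (ray x e t) = A at *
  generalize conj e = E at *
  generalize α (ray x e t) = al at *
  generalize β (ray x e t) = be at *
  have e1 : (al * (x.im * e) + be * (x.im * E) : ℂ) = x.im * e * (al + be * E ^ 2) := by
    linear_combination (-(be * x.im * E) : ℂ) * hee
  rw [e1]
  generalize (al + be * E ^ 2 : ℂ) = Ω at *
  simp only [pow_one]
  field_simp
  linear_combination (Complex.I * x.im * (2 * κ * q * A * Ω * y * Y
    + Complex.I * κ ^ 2 * (Y - A * Ω * y)) - κ ^ 2 * x.im * Y * Complex.I ^ 2) * hee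
    - κ ^ 2 * x.im * A * Ω * y * Complex.I_sq

/-- A nonzero number in a half-plane that stays away from the positive axis. -/
theorem cotHalf_bound_of_mul {s g : ℂ} (hs : s ≠ 0) (hsg : (s * g).im ≤ 0) (hg : 0 < g.im)
    (hg' : |g.re| ≤ 9 * g.im) : 0 < ‖s‖ - s.re ∧ |cotHalf s| ≤ 19 := by
  have h1 : s.re ≤ 9 * |s.im| := by
    have h2 : s.re * g.im + s.im * g.re ≤ 0 := by simpa using hsg
    have h3 : |s.im * g.re| ≤ |s.im| * (9 * g.im) := by
      rw [abs_mul]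
      gcongr
    have h4 : s.re * g.im ≤ 9 * |s.im| * g.im := by linarith [(abs_le.1 h3).1]
    exact le_of_mul_le_mul_right h4 hg
  have hn : ‖s‖ ^ 2 = s.re ^ 2 + |s.im| ^ 2 := by
    rw [sq_abs, Complex.sq_norm, Complex.normSq_apply]
    ring
  have hi := abs_nonneg s.im
  have hn0 := norm_nonneg s
  have hD : 0 < ‖s‖ - s.re := by
    by_contra! hD
    have h5 : |s.im| = 0 := by nlinarith
    have h6 : ‖s‖ = 0 := by rw [h5] at h1; linarith
    exact hs (norm_eq_zero.1 h6)
  refine ⟨hD, ?_⟩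
  rw [cotHalf, abs_div, abs_of_pos hD, div_le_iff₀ hD]
  rcases le_or_gt s.re 0 with h0 | h0
  · have := Complex.abs_im_le_norm s
    linarith
  · nlinarith

theorem lform_conj_im (p q : ℝ) (z : ℂ) : (lform p q (conj z)).im = q * z.im := by
  simp [lform]

theorem sq_lform_ray {x e : ℂ} {p q t : ℝ} (he : ‖e‖ = 1)
    (hg : 0 < (e * lform p q (conj x) ^ 2).im)
    (hg' : |(e * lform p q (conj x) ^ 2).re| ≤ 4 * (e * lform p q (conj x) ^ 2).im)
    (ht : 0 ≤ t) (ht' : t ≤ 1 / 141) :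
    0 < (e * lform p q (conj (ray x e t)) ^ 2).im ∧
    |(e * lform p q (conj (ray x e t)) ^ 2).re|
      ≤ 9 * (e * lform p q (conj (ray x e t)) ^ 2).im := by
  have e1 : lform p q (conj (ray x e t))
      = lform p q (conj x) - t * (((lform p q (conj x)).im : ℝ) * conj e) := by
    rw [lform_conj_im]
    simp [lform, ray]
    ring
  rw [e1]
  have e0 : ‖e * lform p q (conj x) ^ 2‖ = ‖lform p q (conj x)‖ ^ 2 := by simp [he]
  set c := lform p q (conj x) with hc
  set g := e * c ^ 2
  set g1 := e * (c - t * ((c.im : ℝ) * conj e)) ^ 2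
  have h1 := Complex.abs_im_le_norm c
  have h2 : ‖g1 - g‖ ≤ 3 * t * ‖c‖ ^ 2 := by
    have : g1 - g = -(e * (t * ((c.im : ℝ) * conj e)) * (c + (c - t * ((c.im : ℝ) * conj e)))) := by
      simp only [g1, g]
      ring
    rw [this, norm_neg]
    simp only [norm_mul, he, Complex.norm_real, Complex.norm_conj, norm_eq_abs, abs_of_nonneg ht]
    have h3 : ‖c + (c - t * ((c.im : ℝ) * conj e))‖ ≤ 3 * ‖c‖ := by
      have h4 : ‖(t * ((c.im : ℝ) * conj e) : ℂ)‖ ≤ ‖c‖ := by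
        simp only [norm_mul, he, Complex.norm_real, Complex.norm_conj, norm_eq_abs,
          abs_of_nonneg ht]
        nlinarith [norm_nonneg c, abs_nonneg c.im]
      calc _ ≤ ‖c‖ + (‖c‖ + ‖(t * ((c.im : ℝ) * conj e) : ℂ)‖) :=
            (norm_add_le _ _).trans (by gcongr; exact norm_sub_le _ _)
        _ ≤ 3 * ‖c‖ := by linarith
    calc 1 * (t * (|c.im| * 1)) * ‖c + (c - t * ((c.im : ℝ) * conj e))‖
        ≤ 1 * (t * (‖c‖ * 1)) * (3 * ‖c‖) := by gcongr
      _ = _ := by ring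
  have h5 : ‖c‖ ^ 2 ≤ 5 * g.im := by
    rw [← e0]
    have := Complex.norm_le_abs_re_add_abs_im g
    rw [abs_of_pos hg] at this
    linarith
  have h6 : ‖g1 - g‖ ≤ 15 / 141 * g.im := by
    have : 3 * t * ‖c‖ ^ 2 ≤ 3 * (1 / 141) * (5 * g.im) := by gcongr
    linarith
  have h7 := abs_le.1 ((Complex.abs_re_le_norm _).trans h6)
  have h8 := abs_le.1 ((Complex.abs_im_le_norm _).trans h6)
  have h9 := abs_le.1 hg'
  rw [Complex.sub_re] at h7
  rw [Complex.sub_im] at h8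
  refine ⟨by linarith, abs_le.2 ⟨by linarith, by linarith⟩⟩

/-- Near a point of large dilatation, the image of a boundary point lying in a quarter of the
circle determined by the direction of stretch is almost determined. -/
theorem IsMLFrame.cotHalf_turnFun_le {Φ a : ℂ → ℂ} {α : ℂ → ℝ} {β : ℂ → ℂ}
    (h : IsMLFrame Φ a α β) {x e : ℂ} {v₀ v₁ p q : ℝ} (hx : x ∈ Hset) (he : ‖e‖ = 1)
    (hβ : β x = ‖β x‖ * e ^ 2) (hα : 20000 ≤ α x) (hpq : p ≠ 0 ∨ q ≠ 0)
    (hsec : ∀ z ∈ Hset, 0 ≤ (lform p q (Φ z) ^ 2 * lform v₀ v₁ (conj z) ^ 2 / a z).re)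
    (hg : 0 < (e * lform v₀ v₁ (conj x) ^ 2).im)
    (hg' : |(e * lform v₀ v₁ (conj x) ^ 2).re| ≤ 4 * (e * lform v₀ v₁ (conj x) ^ 2).im) :
    0 < ‖turnFun Φ a p q e x‖ - (turnFun Φ a p q e x).re ∧
    |cotHalf (turnFun Φ a p q e x)| ≤ 27712 * α x ^ (-(1 / 200) : ℝ) := by
  have hα0 : 0 < α x := by linarith
  obtain ⟨L, hL, hαL⟩ : ∃ L, 0 < L ∧ α x * L ^ 2 = 1 := by
    refine ⟨(√(α x))⁻¹, by positivity, ?_⟩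
    rw [inv_pow, sq_sqrt hα0.le, mul_inv_cancel₀ hα0.ne']
  have hL' : L ≤ 1 / 141 := by
    by_contra! hL'
    have : (1 / 141 : ℝ) ^ 2 < L ^ 2 := by gcongr
    nlinarith
  have hm : ∀ t ∈ Icc 0 L, ray x e t ∈ Hset := fun t ht =>
    ray_mem hx he ht.1 (by linarith [ht.2])
  set s : ℝ → ℂ := fun t => turnFun Φ a p q e (ray x e t) with hs
  have hee := mul_conj_of_norm_eq_one he
  have hcot : ∀ t ∈ Icc 0 L, 0 < ‖s t‖ - (s t).re ∧ |cotHalf (s t)| ≤ 19 := by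
    intro t ht
    obtain ⟨h1, h2⟩ := sq_lform_ray he hg hg' ht.1 (by linarith [ht.2])
    have he0 : e ≠ 0 := by
      rintro rfl
      simp at he
    refine cotHalf_bound_of_mul ?_ ?_ h1 h2
    · exact div_ne_zero (mul_ne_zero (mul_ne_zero (neg_ne_zero.2 Complex.I_ne_zero)
        (by simpa using he0)) (pow_ne_zero _ (lform_ne_zero hpq (h.mapsTo (hm t ht)))))
        (h.a_ne_zero (hm t ht))
    · have h3 := hsec _ (hm t ht)
      have h4 : s t * (e * lform v₀ v₁ (conj (ray x e t)) ^ 2) = -Complex.I *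
          (lform p q (Φ (ray x e t)) ^ 2 * lform v₀ v₁ (conj (ray x e t)) ^ 2
            / a (ray x e t)) := by
        simp only [hs, turnFun]
        linear_combination (-Complex.I * (lform p q (Φ (ray x e t)) ^ 2 *
          lform v₀ v₁ (conj (ray x e t)) ^ 2 / a (ray x e t))) * hee
      rw [h4]
      simpa using h3
  set lam : ℝ → ℝ := fun t => x.im / (ray x e t).im with hlam
  set Ω : ℝ → ℂ := fun t => α (ray x e t) + β (ray x e t) * conj e ^ 2 with hΩ
  have hlam' : ∀ t ∈ Icc 0 L, 10 / 11 ≤ lam t := by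
    intro t ht
    have h1 := (ray_im_mem hx he ht.1 (by linarith [ht.2])).2
    have h2 : 0 < (ray x e t).im := hm t ht
    rw [hlam, le_div_iff₀ h2]
    linarith
  have key := abs_image_zero_le_of_deriv (Y := fun t => cotHalf (s t))
    (Y' := fun t => lam t * ((Ω t).re * cotHalf (s t)
      + ((Ω t).im * (1 - cotHalf (s t) ^ 2) + e.re * (1 + cotHalf (s t) ^ 2)) / 2))
    (ε := fun t => lam t * (Ω t).re) (μ := 27693 * L) (M := 19) (c := 40 * α x) (θ := 1 / 100)
    (L := L) (by positivity) hL.le (by positivity)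
    (fun t ht => hasDerivAt_cotHalf (h.hasDerivAt_turnFun he (hm t ht)) (hcot t ht).1) ?_ ?_
    (hcot L (right_mem_Icc.2 hL.le)).2
  · simp only [hs, ray_zero] at key hcot
    have h0 := (hcot 0 (left_mem_Icc.2 hL.le)).1
    simp only [ray_zero] at h0
    refine ⟨h0, key.trans ?_⟩
    have hL1 : L = α x ^ (-(1 / 2) : ℝ) := by
      have h1 : α x = L⁻¹ ^ 2 := by
        rw [inv_pow]
        exact eq_inv_of_mul_eq_one_left hαL
      rw [h1, ← rpow_natCast, ← rpow_mul (by positivity)]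
      norm_num
      rw [rpow_neg_one, inv_inv]
    have hL2 : L ≤ α x ^ (-(1 / 200) : ℝ) := by
      rw [hL1]
      exact rpow_le_rpow_of_exponent_le (by linarith) (by norm_num)
    have h2 : α x ^ (1 / 2 : ℝ) ≤ 1 + 40 * α x * L := by
      have h3 : α x ^ (1 / 2 : ℝ) = α x * L := by
        rw [hL1]
        nth_rewrite 2 [← rpow_one (α x)]
        rw [← rpow_add hα0]
        norm_num
      rw [h3]
      nlinarith [mul_pos hα0 hL]
    have h4 : (1 + 40 * α x * L) ^ (-(1 / 100) : ℝ) ≤ α x ^ (-(1 / 200) : ℝ) := by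
      calc _ ≤ (α x ^ (1 / 2 : ℝ)) ^ (-(1 / 100) : ℝ) :=
            rpow_le_rpow_of_nonpos (by positivity) h2 (by norm_num)
        _ = _ := by
            rw [← rpow_mul hα0.le]
            norm_num
    linarith
  · intro t ht
    obtain ⟨h1, h2⟩ := h.omega_ray hx he hL hL' hαL ht hβ
    have h3 := (h.ray_bounds hx he hL hL' hαL ht).1
    have h4 := hlam' t ht
    have h5 := (hcot t ht).2
    change α (ray x e t) ≤ (Ω t).re at h1
    change |(Ω t).im| ≤ 112 * t * (Ω t).re at h2
    generalize cotHalf (s t) = Y at h5 ⊢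
    have hl : 0 ≤ lam t := by linarith
    have e1 : lam t * ((Ω t).re * Y + ((Ω t).im * (1 - Y ^ 2) + e.re * (1 + Y ^ 2)) / 2)
        - lam t * (Ω t).re * Y = lam t * (((Ω t).im * (1 - Y ^ 2) + e.re * (1 + Y ^ 2)) / 2) := by
      ring
    rw [e1, abs_mul, abs_of_nonneg hl, mul_assoc]
    have hY2 : Y ^ 2 ≤ 361 := by
      have := sq_le_sq' (abs_le.1 h5).1 (abs_le.1 h5).2
      norm_num at this ⊢
      exact this
    have h6 : |1 - Y ^ 2| ≤ 362 := abs_le.2 ⟨by nlinarith [sq_nonneg Y], by nlinarith [sq_nonneg Y]⟩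
    have h7 : |1 + Y ^ 2| ≤ 362 := abs_le.2 ⟨by nlinarith [sq_nonneg Y], by nlinarith [sq_nonneg Y]⟩
    have h8 : |e.re| ≤ 1 := (Complex.abs_re_le_norm e).trans he.le
    have h9 : 1 ≤ 41 * L * (Ω t).re := by
      rw [div_le_iff₀ (by positivity)] at h3
      nlinarith
    have h10 : 0 ≤ (Ω t).re := by
      have : 0 < 41 * L := by positivity
      by_contra! hneg
      nlinarith
    gcongr
    calc |((Ω t).im * (1 - Y ^ 2) + e.re * (1 + Y ^ 2)) / 2|
        ≤ (112 * t * (Ω t).re * 362 + 1 * 362) / 2 := by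
          rw [abs_div, abs_two]
          gcongr
          refine (abs_add_le _ _).trans ?_
          rw [abs_mul, abs_mul]
          have : 0 ≤ 112 * t * (Ω t).re := (abs_nonneg _).trans h2
          gcongr
      _ ≤ (112 * L * (Ω t).re * 362 + 41 * L * (Ω t).re * 362) / 2 := by
          have := ht.2
          gcongr
      _ = (Ω t).re * (27693 * L) := by ring
  · intro t ht
    obtain ⟨h1, -⟩ := h.omega_ray hx he hL hL' hαL ht hβ
    change α (ray x e t) ≤ (Ω t).re at h1
    have h2 := h.le_ray hx he ht.1 (by linarith [ht.2])
    have h4 := hlam' t ht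
    have h5 : 0 < α x / (1 + 40 * α x * t) := by
      have := ht.1
      positivity
    have h6 : 1 / 100 * (40 * α x) / (1 + 40 * α x * t) = 2 / 5 * (α x / (1 + 40 * α x * t)) := by
      ring
    rw [h6]
    have h7 : 10 / 11 * (α x / (1 + 40 * α x * t)) ≤ lam t * (Ω t).re := by
      have : 0 ≤ lam t := by linarith
      gcongr
      linarith
    linarith

theorem det2_rep_ne_zero {ξ η : RP1} (h : ξ ≠ η) : det2 ξ.rep η.rep ≠ 0 := by
  intro h0
  apply h
  rw [← ξ.mk_rep, ← η.mk_rep, Projectivization.mk_eq_mk_iff']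
  simp only [det2] at h0
  rcases ne_zero_or η.rep_nonzero with h1 | h1
  · refine ⟨ξ.rep 0 / η.rep 0, ?_⟩
    ext i
    fin_cases i
    · simp [h1]
    · simp only [Pi.smul_apply, smul_eq_mul, Fin.mk_one]
      field_simp
      linarith
  · refine ⟨ξ.rep 1 / η.rep 1, ?_⟩
    ext i
    fin_cases i
    · simp only [Pi.smul_apply, smul_eq_mul, Fin.zero_eta]
      field_simp
      linarith
    · simp [h1]

theorem exists_lform_conj_eq {x c : ℂ} (hx : x ∈ Hset) (hc : c ≠ 0) :
    ∃ v : Fin 2 → ℝ, v ≠ 0 ∧ lform (v 0) (v 1) (conj x) = c := by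
  have hy : x.im ≠ 0 := (show 0 < x.im from hx).ne'
  have h : lform (c.re + c.im / x.im * x.re) (c.im / x.im) (conj x) = c := by
    apply Complex.ext <;> simp [lform, hy]
  refine ⟨![c.re + c.im / x.im * x.re, c.im / x.im], ?_, by simpa using h⟩
  intro h0
  have h1 := congrFun h0 0
  have h2 := congrFun h0 1
  simp only [Matrix.cons_val_zero, Matrix.cons_val_one, Pi.zero_apply] at h1 h2
  rw [h1, h2] at h
  exact hc (by rw [← h]; simp [lform])

theorem conj_lform_mul_lform_im (v w : Fin 2 → ℝ) (z : ℂ) :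
    (conj (lform (v 0) (v 1) z) * lform (w 0) (w 1) z).im = -z.im * det2 v w := by
  simp [lform, det2]
  ring

theorem crossRatio_eq_of_det2 {ξ₁ ξ₂ ξ₃ ξ₄ : RP1} {m : ℝ} {k₁ k₂ k₃ k₄ : ℂ} (hm : m ≠ 0)
    (h₄₁ : det2 ξ₄.rep ξ₁.rep = m * (conj k₄ * k₁).im)
    (h₃₂ : det2 ξ₃.rep ξ₂.rep = m * (conj k₃ * k₂).im)
    (h₂₁ : det2 ξ₂.rep ξ₁.rep = m * (conj k₂ * k₁).im)
    (h₃₄ : det2 ξ₃.rep ξ₄.rep = m * (conj k₃ * k₄).im) :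
    crossRatio ξ₁ ξ₂ ξ₃ ξ₄ = (conj k₄ * k₁).im * (conj k₃ * k₂).im
      / ((conj k₂ * k₁).im * (conj k₃ * k₄).im) := by
  rw [crossRatio, h₄₁, h₃₂, h₂₁, h₃₄]
  refine Eq.trans ?_ (mul_div_mul_left _ _ (mul_ne_zero hm hm))
  congr 1 <;> ring

theorem abs_conj_mul_im_le {k l : ℂ} {δ : ℝ} (hk : |k.re| ≤ δ * |k.im|) (hl : |l.re| ≤ δ * |l.im|) :
    |(conj k * l).im| ≤ 2 * δ * (|k.im| * |l.im|) := by
  have e : (conj k * l).im = k.re * l.im - k.im * l.re := by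
    simp
    ring
  rw [e]
  refine (abs_sub _ _).trans ?_
  rw [abs_mul, abs_mul]
  have h1 := mul_le_mul_of_nonneg_right hk (abs_nonneg l.im)
  have h2 := mul_le_mul_of_nonneg_left hl (abs_nonneg k.im)
  linarith

theorem abs_conj_mul_im_le' {k l : ℂ} {δ : ℝ} (hk : |k.im| ≤ δ * |k.re|)
    (hl : |l.im| ≤ δ * |l.re|) : |(conj k * l).im| ≤ 2 * δ * (|k.re| * |l.re|) := by
  have e : (conj k * l).im = k.re * l.im - k.im * l.re := by
    simp
    ring
  rw [e]
  refine (abs_sub _ _).trans ?_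
  rw [abs_mul, abs_mul]
  have h1 := mul_le_mul_of_nonneg_right hk (abs_nonneg l.re)
  have h2 := mul_le_mul_of_nonneg_left hl (abs_nonneg k.re)
  linarith

theorem le_abs_conj_mul_im {k l : ℂ} {δ : ℝ} (hδ : δ ≤ 1 / 2)
    (hk : |k.im| ≤ δ * |k.re|) (hl : |l.re| ≤ δ * |l.im|) :
    3 / 4 * (|k.re| * |l.im|) ≤ |(conj k * l).im| := by
  have e : (conj k * l).im = k.re * l.im - k.im * l.re := by
    simp
    ring
  rw [e]
  have h0 := abs_sub_abs_le_abs_sub (k.re * l.im) (k.im * l.re)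
  rw [abs_mul, abs_mul] at h0
  have h1 : |k.im| * |l.re| ≤ (1 / 2 * |k.re|) * (1 / 2 * |l.im|) := by
    have h2 : δ * |k.re| ≤ 1 / 2 * |k.re| := by gcongr
    have h3 : δ * |l.im| ≤ 1 / 2 * |l.im| := by gcongr
    gcongr
    · exact hk.trans h2
    · exact hl.trans h3
  linarith

/-- A quadruple in which two points are clustered along each axis has large cross-ratio. -/
theorem le_abs_crossRatio_of_clustered {k₁ k₂ k₃ k₄ : ℂ} {δ : ℝ} (hδ : 0 < δ) (hδ' : δ ≤ 1 / 2)
    (h₁ : |k₁.re| ≤ δ * |k₁.im|) (h₂ : |k₂.re| ≤ δ * |k₂.im|)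
    (h₃ : |k₃.im| ≤ δ * |k₃.re|) (h₄ : |k₄.im| ≤ δ * |k₄.re|)
    (h₂₁ : (conj k₂ * k₁).im ≠ 0) (h₃₄ : (conj k₃ * k₄).im ≠ 0) :
    1 / (8 * δ ^ 2) ≤ |(conj k₄ * k₁).im * (conj k₃ * k₂).im
      / ((conj k₂ * k₁).im * (conj k₃ * k₄).im)| := by
  rw [abs_div, abs_mul, abs_mul, div_le_div_iff₀ (by positivity) (by positivity), one_mul]
  calc |(conj k₂ * k₁).im| * |(conj k₃ * k₄).im|
      ≤ (2 * δ * (|k₂.im| * |k₁.im|)) * (2 * δ * (|k₃.re| * |k₄.re|)) := by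
        gcongr
        · exact abs_conj_mul_im_le h₂ h₁
        · exact abs_conj_mul_im_le' h₃ h₄
    _ ≤ (3 / 4 * (|k₄.re| * |k₁.im|)) * (3 / 4 * (|k₃.re| * |k₂.im|)) * (8 * δ ^ 2) := by
        have : 0 ≤ δ ^ 2 * (|k₂.im| * |k₁.im| * (|k₃.re| * |k₄.re|)) := by positivity
        nlinarith
    _ ≤ _ := by
        gcongr
        · exact le_abs_conj_mul_im hδ' h₄ h₁
        · exact le_abs_conj_mul_im hδ' h₃ h₂

theorem cotHalf_sq (k : ℂ) : ‖k ^ 2‖ - (k ^ 2).re = 2 * k.im ^ 2 ∧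
    cotHalf (k ^ 2) = k.re / k.im := by
  have h1 : ‖k ^ 2‖ - (k ^ 2).re = 2 * k.im ^ 2 := by
    rw [norm_pow, Complex.sq_norm, Complex.normSq_apply, sq k, Complex.mul_re]
    ring
  refine ⟨h1, ?_⟩
  rw [cotHalf, h1, sq k, Complex.mul_im]
  rcases eq_or_ne k.im 0 with h | h
  · simp [h]
  · field_simp
    ring

theorem abs_re_le_of_cotHalf_sq {k : ℂ} {δ : ℝ} (h : 0 < ‖k ^ 2‖ - (k ^ 2).re)
    (h' : |cotHalf (k ^ 2)| ≤ δ) : |k.re| ≤ δ * |k.im| := by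
  obtain ⟨h1, h2⟩ := cotHalf_sq k
  rw [h1] at h
  have h3 : 0 < |k.im| := by
    rw [abs_pos]
    rintro h0
    simp [h0] at h
  rwa [h2, abs_div, div_le_iff₀ h3] at h'

/-- The size of the Codazzi pair coming from a minimal Lagrangian extension is controlled by the
cross-ratio norm of the boundary value. -/
theorem IsMLFrame.log_α_le {Φ a : ℂ → ℂ} {α : ℂ → ℝ} {β : ℂ → ℂ} (h : IsMLFrame Φ a α β)
    {φ : RP1 → RP1} (hφ : Function.Injective φ) (hcr : BddAbove (crSet φ)) (hcr0 : 0 ≤ crNorm φ)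
    (hsec : ∀ (v : Fin 2 → ℝ) (hv : v ≠ 0), ∀ z ∈ Hset,
      0 ≤ (lform ((φ (.mk ℝ v hv)).rep 0) ((φ (.mk ℝ v hv)).rep 1) (Φ z) ^ 2 *
        lform (v 0) (v 1) (conj z) ^ 2 / a z).re)
    {x : ℂ} (hx : x ∈ Hset) :
    log (α x) ≤ 100 * crNorm φ + (log 20000 + 200 * log 55424 + 100 * log 8) := by
  have hl1 : 0 ≤ log (20000 : ℝ) := log_nonneg (by norm_num)
  have hl2 : 0 ≤ log (55424 : ℝ) := log_nonneg (by norm_num)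
  have hl3 : 0 ≤ log (8 : ℝ) := log_nonneg (by norm_num)
  have hα0 : 0 < α x := h.pos x hx
  rcases lt_or_ge (α x) 20000 with hα | hα
  · have := log_le_log hα0 hα.le
    linarith
  set δ := 27712 * α x ^ (-(1 / 200) : ℝ) with hδ
  have hδ0 : 0 < δ := by positivity
  have hlogδ : log δ = log 27712 - 1 / 200 * log (α x) := by
    rw [hδ, log_mul (by norm_num) (by positivity), log_rpow hα0]
    ring
  rcases lt_or_ge (1 / 2) δ with hδ' | hδ'
  · have h1 := log_lt_log (by norm_num) hδ'
    rw [hlogδ] at h1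
    have h2 : log (55424 : ℝ) = log 27712 - log (1 / 2) := by
      rw [← log_div (by norm_num) (by norm_num)]
      norm_num
    linarith
  have hβ0 : β x ≠ 0 := by
    intro h0
    have := h.det x hx
    rw [h0] at this
    norm_num at this
    rcases this with h1 | h1 <;> linarith
  obtain ⟨e, he, hβ⟩ := exists_unit_sq hβ0
  have hee := mul_conj_of_norm_eq_one he
  obtain ⟨γ, hγ⟩ := IsAlgClosed.exists_pow_nat_eq (conj e) (n := 2) (by norm_num)
  obtain ⟨ρ, hρ⟩ := IsAlgClosed.exists_pow_nat_eq (-Complex.I * conj e / a x) (n := 2) (by norm_num)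
  have he0 : conj e ≠ 0 := right_ne_zero_of_mul_eq_one hee
  have hγ0 : γ ≠ 0 := by
    rintro rfl
    exact he0 (by simpa using hγ.symm)
  have hγ1 : ‖γ‖ ^ 2 = 1 := by
    rw [← norm_pow, hγ, Complex.norm_conj, he]
  have hρ0 : ρ ≠ 0 := by
    rintro rfl
    have := div_ne_zero (mul_ne_zero (neg_ne_zero.2 Complex.I_ne_zero) he0) (h.a_ne_zero hx)
    exact this (by simpa using hρ.symm)
  have hc : ∀ τ : ℝ, γ * (1 + τ * Complex.I) ≠ 0 := by
    intro τ
    refine mul_ne_zero hγ0 fun h0 => ?_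
    have := congrArg Complex.re h0
    simp at this
  choose v hv hvc using fun τ => exists_lform_conj_eq hx (hc τ)
  obtain ⟨ξ, hξ⟩ : ∃ ξ : ℝ → RP1, ∀ τ, ξ τ = .mk ℝ (v τ) (hv τ) := ⟨_, fun _ => rfl⟩
  obtain ⟨k, hk⟩ : ∃ k : ℝ → ℂ, ∀ τ, k τ = ρ * lform ((φ (ξ τ)).rep 0) ((φ (ξ τ)).rep 1) (Φ x) :=
    ⟨_, fun _ => rfl⟩
  have hy : 0 < x.im := hx
  have hY : 0 < (Φ x).im := h.mapsTo hx
  have hturn : ∀ τ, turnFun Φ a ((φ (ξ τ)).rep 0) ((φ (ξ τ)).rep 1) e x = k τ ^ 2 := by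
    intro τ
    rw [hk, mul_pow, hρ, turnFun]
    ring
  have hturn' : ∀ τ, turnFun Φ a ((φ (ξ τ)).rep 0) ((φ (ξ τ)).rep 1) (-e) x
      = (Complex.I * k τ) ^ 2 := by
    intro τ
    rw [mul_pow, ← hturn, turnFun, turnFun, Complex.I_sq, map_neg]
    ring
  have hgτ : ∀ τ, e * lform (v τ 0) (v τ 1) (conj x) ^ 2
      = ((1 - τ ^ 2 : ℝ) : ℂ) + ((2 * τ : ℝ) : ℂ) * Complex.I := by
    intro τ
    rw [hvc, mul_pow, hγ]
    push_cast
    linear_combination (1 + τ * Complex.I : ℂ) ^ 2 * hee + (τ : ℂ) ^ 2 * Complex.I_sq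
  have hre : ∀ τ, (e * lform (v τ 0) (v τ 1) (conj x) ^ 2).re = 1 - τ ^ 2 := fun τ => by
    rw [hgτ, Complex.add_re, Complex.re_ofReal_mul, Complex.I_re, mul_zero, add_zero,
      Complex.ofReal_re]
  have him : ∀ τ, (e * lform (v τ 0) (v τ 1) (conj x) ^ 2).im = 2 * τ := fun τ => by
    rw [hgτ, Complex.add_im, Complex.im_ofReal_mul, Complex.I_im, mul_one,
      Complex.ofReal_im, zero_add]
  have hpos : ∀ τ : ℝ, 0 < τ → |1 - τ ^ 2| ≤ 4 * (2 * τ) → |(k τ).re| ≤ δ * |(k τ).im| := by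
    intro τ h1 h2
    have hs := hsec (v τ) (hv τ)
    rw [← hξ] at hs
    obtain ⟨h3, h4⟩ := h.cotHalf_turnFun_le hx he hβ hα (ne_zero_or (φ (ξ τ)).rep_nonzero) hs
      (by rw [him]; linarith) (by rwa [hre, him])
    rw [hturn] at h3 h4
    exact abs_re_le_of_cotHalf_sq h3 h4
  have hneg : ∀ τ : ℝ, τ < 0 → |1 - τ ^ 2| ≤ 4 * (-(2 * τ)) → |(k τ).im| ≤ δ * |(k τ).re| := by
    intro τ h1 h2
    have hs := hsec (v τ) (hv τ)
    rw [← hξ] at hs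
    obtain ⟨h3, h4⟩ := h.cotHalf_turnFun_le (e := -e) hx (by simpa using he)
      (by rw [neg_sq]; exact hβ) hα (ne_zero_or (φ (ξ τ)).rep_nonzero) hs
      (by rw [neg_mul, Complex.neg_im, him]; linarith)
      (by rwa [neg_mul, Complex.neg_re, Complex.neg_im, abs_neg, hre, him])
    rw [hturn'] at h3 h4
    have h5 := abs_re_le_of_cotHalf_sq h3 h4
    rwa [Complex.I_mul_re, Complex.I_mul_im, abs_neg] at h5
  choose r hr hrv using fun τ => exists_mul_rep (hv τ)
  have hdetξ : ∀ τ σ, det2 (ξ τ).rep (ξ σ).rep = r τ * r σ * (σ - τ) / x.im := by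
    intro τ σ
    have h1 := conj_lform_mul_lform_im (v τ) (v σ) (conj x)
    rw [hvc, hvc] at h1
    have h2 : (conj (γ * (1 + τ * Complex.I)) * (γ * (1 + σ * Complex.I))).im = σ - τ := by
      have h3 : conj (γ * (1 + τ * Complex.I)) * (γ * (1 + σ * Complex.I))
          = ((‖γ‖ ^ 2 : ℝ) : ℂ) * ((1 - τ * Complex.I) * (1 + σ * Complex.I)) := by
        rw [← Complex.normSq_eq_norm_sq, ← Complex.mul_conj]
        simp
        ring
      rw [h3, hγ1]
      simp
      ring
    rw [h2, Complex.conj_im, neg_neg] at h1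
    rw [hξ, hξ, det2, hrv, hrv, hrv, hrv, h1, det2]
    field_simp
  have hdetφ : ∀ τ σ, det2 (φ (ξ τ)).rep (φ (ξ σ)).rep
      = -((Φ x).im * ‖ρ‖ ^ 2)⁻¹ * (conj (k τ) * k σ).im := by
    intro τ σ
    have h1 := conj_lform_mul_lform_im (φ (ξ τ)).rep (φ (ξ σ)).rep (Φ x)
    have h3 : conj (k τ) * k σ = ((‖ρ‖ ^ 2 : ℝ) : ℂ) *
        (conj (lform ((φ (ξ τ)).rep 0) ((φ (ξ τ)).rep 1) (Φ x)) *
          lform ((φ (ξ σ)).rep 0) ((φ (ξ σ)).rep 1) (Φ x)) := by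
      rw [← Complex.normSq_eq_norm_sq, ← Complex.mul_conj, hk, hk, map_mul]
      ring
    have h4 : 0 < ‖ρ‖ := norm_pos_iff.2 hρ0
    rw [h3, Complex.im_ofReal_mul, h1]
    field_simp
  have hξinj : ∀ {τ σ}, τ ≠ σ → (conj (k τ) * k σ).im ≠ 0 := by
    intro τ σ hne h0
    have h1 : φ (ξ τ) ≠ φ (ξ σ) := by
      intro h2
      have h3 := hdetξ τ σ
      rw [hφ h2, det2, mul_comm, sub_self] at h3
      have : r τ * r σ * (σ - τ) / x.im ≠ 0 :=
        div_ne_zero (mul_ne_zero (mul_ne_zero (hr τ) (hr σ)) (sub_ne_zero.2 hne.symm)) hy.ne'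
      exact this h3.symm
    exact det2_rep_ne_zero h1 (by rw [hdetφ, h0, mul_zero])
  have hcrξ : crossRatio (ξ 1) (ξ 5) (ξ (-7)) (ξ (-1)) = -1 := by
    have h1 := hr 1
    have h2 := hr 5
    have h3 := hr (-7)
    have h4 := hr (-1)
    rw [crossRatio, hdetξ, hdetξ, hdetξ, hdetξ]
    field_simp
    norm_num
  have hm : -((Φ x).im * ‖ρ‖ ^ 2)⁻¹ ≠ 0 := by
    have h4 : 0 < ‖ρ‖ := norm_pos_iff.2 hρ0
    exact neg_ne_zero.2 (by positivity)
  have hbig := le_abs_crossRatio_of_clustered hδ0 hδ' (hpos 1 (by norm_num) (by norm_num))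
    (hpos 5 (by norm_num) (by norm_num [abs_le])) (hneg (-7) (by norm_num) (by norm_num [abs_le]))
    (hneg (-1) (by norm_num) (by norm_num)) (hξinj (by norm_num)) (hξinj (by norm_num))
  rw [← crossRatio_eq_of_det2 hm (hdetφ _ _) (hdetφ _ _) (hdetφ _ _) (hdetφ _ _)] at hbig
  have hle : |log (abs (crossRatio (φ (ξ 1)) (φ (ξ 5)) (φ (ξ (-7))) (φ (ξ (-1)))))| ≤ crNorm φ :=
    le_csSup hcr ⟨_, _, _, _, hcrξ, rfl⟩
  have h1 := (log_le_log (by positivity) hbig).trans ((le_abs_self _).trans hle)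
  rw [one_div, log_inv, log_mul (by norm_num) (by positivity), log_pow, hlogδ] at h1
  have h2 : log (27712 : ℝ) ≤ log 55424 := log_le_log (by norm_num) (by norm_num)
  push_cast at h1
  linarith

end AdSPaper

namespace AdSPaper

/-- **Theorem E.** There exist universal constants `Δ > 0` and `C₂ > 0` such that, for any
quasisymmetric homeomorphism `φ` of `ℝP¹` with cross-ratio norm `‖φ‖_cr > Δ`, the minimal
Lagrangian extension `Φ_ML : ℍ² → ℍ²` of `φ` has maximal dilatation bounded by
`ln K(Φ_ML) ≤ C₂·‖φ‖_cr`. -/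
theorem log_maxDilatation_le_of_large_crNorm :
    ∃ Δ C₂ : ℝ, 0 < Δ ∧ 0 < C₂ ∧
      ∀ φ : RP1 ≃ₜ RP1, Quasisymmetric φ → Δ < crNorm ⇑φ →
        ∀ Φ : ℂ → ℂ, IsMinimalLagrangianExtension Φ ⇑φ →
          Real.log (maxDilatation Φ) ≤ C₂ * crNorm ⇑φ := by
  refine ⟨1, log 4 + 2 * (100 + (log 20000 + 200 * log 55424 + 100 * log 8)), one_pos, ?_, ?_⟩
  · have h1 := log_pos (show (1 : ℝ) < 4 by norm_num)
    have h2 := log_pos (show (1 : ℝ) < 20000 by norm_num)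
    have h3 := log_pos (show (1 : ℝ) < 55424 by norm_num)
    have h4 := log_pos (show (1 : ℝ) < 8 by norm_num)
    positivity
  intro φ hφ hcr Φ hΦ
  obtain ⟨a, α, β, hf, hsec⟩ := hΦ.exists_frame φ.continuous hφ.1
  have h1 := log_pos (show (1 : ℝ) < 4 by norm_num)
  have h2 := log_pos (show (1 : ℝ) < 20000 by norm_num)
  have h3 := log_pos (show (1 : ℝ) < 55424 by norm_num)
  have h4 := log_pos (show (1 : ℝ) < 8 by norm_num)
  set B := log 20000 + 200 * log 55424 + 100 * log 8
  have hB : 0 < B := by positivity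
  have key := hf.log_maxDilatation_le (B := 100 * crNorm φ + B) (by linarith)
    (fun z hz => hf.log_α_le φ.injective hφ.2 (by linarith) hsec hz)
  nlinarith

end AdSPaper
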